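/- Let N be a prime with N ≡ 1 (mod 9), and let L = Q(ζ_3, N^{1/3}). Let A, B be integers with 4N = A² + 27B². Then the 3-rank of the ideal class group of L equals 2 if and only if A is a 9th power modulo N, i.e., there exists an integer x with x^9 ≡ A (mod N) (and otherwise the 3-rank equals 1). -/

import Mathlib

open NumberField Polynomial

/-- The `p`-rank of a finite abelian group `G`: the `𝔽_p`-dimension of `G ⊗ 𝔽_p`,
equivalently of `G[p]`. -/
noncomputable def pRank (p : ℕ) (G : Type*) [Group G] : ℕ :=
  (Nat.card {g : G // g ^ p = 1}).factorization p

set_option linter.all false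

/-! ### Abstract group theory -/

section AbstractGroup

variable {C : Type*} [CommGroup C] [Finite C] (s : C →* C)

/-- If `1 + s + s²` kills `C`, the fixed subgroup has order 3 and `χ` is a nontrivial `s`-invariant
character, then the size of the 3-torsion is governed by `χ` on the fixed classes. -/
theorem abstract_rank {T : Type*} [CommMonoid T] (hs : ∀ c, c * s c * s (s c) = 1)
    (hfix : Nat.card {c : C // s c = c} = 3) (χ : C →* T) (hχs : ∀ c, χ (s c) = χ c)
    (hχ : ∃ c, χ c ≠ 1) :
    ((∀ c, s c = c → χ c = 1) → Nat.card {g : C // g ^ 3 = 1} = 9) ∧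
    (¬ (∀ c, s c = c → χ c = 1) → Nat.card {g : C // g ^ 3 = 1} = 3) := by
  classical
  -- the map D c = c / s c
  let D : C →* C := (MonoidHom.id C) / s
  have hD : ∀ c, D c = c / s c := fun c => rfl
  have hsss : ∀ c, s (s (s c)) = c := by
    intro c
    have h1 := hs c
    have h2 := hs (s c)
    have h3 : c * (s c * s (s c)) = s (s (s c)) * (s c * s (s c)) := by
      rw [← mul_assoc, h1, mul_comm, h2]
    exact (mul_right_cancel h3).symm
  have hinj : Function.Injective s := fun a b h => by
    rw [← hsss a, ← hsss b, h]
  have hDD : ∀ c, D (D c) = (s c ^ 3)⁻¹ := by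
    intro c
    have h1 := hs c
    have h2 : s (s c) = (c * s c)⁻¹ := by
      rw [eq_inv_iff_mul_eq_one, mul_comm]; exact h1
    simp only [hD, _root_.map_div, h2]
    simp only [div_eq_mul_inv, mul_inv, inv_inv, pow_succ, pow_zero, one_mul]
    have : c * (s c)⁻¹ * ((s c)⁻¹ * (c⁻¹ * (s c)⁻¹)) = (s c)⁻¹ * (s c)⁻¹ * (s c)⁻¹ := by
      rw [mul_comm c, mul_assoc, mul_left_comm c, mul_inv_cancel_left, mul_assoc]
    simpa using this
  have h3 : ∀ c, c ^ 3 = 1 ↔ D (D c) = 1 := by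
    intro c
    rw [hDD, inv_eq_one, ← map_pow]
    constructor
    · intro h; rw [h, map_one]
    · intro h; exact hinj (by rw [h, map_one])
  have hker : ∀ c, c ∈ D.ker ↔ s c = c := by
    intro c
    rw [MonoidHom.mem_ker, hD, div_eq_one]; exact eq_comm
  have hkercard : Nat.card D.ker = 3 := by
    rw [← hfix]
    exact Nat.card_congr (Equiv.subtypeEquivRight hker)
  have hindex : D.range.index = 3 := by
    have h1 := Subgroup.index_mul_card D.range
    have h2 := Subgroup.card_mul_index D.ker
    rw [Subgroup.index_ker] at h2
    rw [← h2, hkercard] at h1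
    have : 0 < Nat.card D.range := Nat.card_pos
    exact Nat.eq_of_mul_eq_mul_right this h1
  have hle : D.range ≤ χ.ker := by
    rintro _ ⟨c, rfl⟩
    rw [MonoidHom.mem_ker, hD]
    have : χ (c / s c) * χ (s c) = χ c := by rw [← map_mul, div_mul_cancel]
    have hu : χ (s c) * χ ((s c)⁻¹) = 1 := by rw [← map_mul, mul_inv_cancel, map_one]
    rw [hχs] at this hu
    have h4 : χ (c / s c) * χ c * χ (s c)⁻¹ = χ c * χ (s c)⁻¹ := by rw [this]
    rw [mul_assoc, hu, mul_one] at h4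
    exact h4
  have hkχ : D.range = χ.ker := by
    apply le_antisymm hle
    have h5 : χ.ker.index ∣ 3 := by rw [← hindex]; exact Subgroup.index_dvd_of_le hle
    have h6 : χ.ker.index ≠ 1 := by
      rw [Ne, Subgroup.index_eq_one]
      intro h
      obtain ⟨c, hc⟩ := hχ
      exact hc (by rw [← MonoidHom.mem_ker, h]; trivial)
    have h7 : χ.ker.index = 3 := by
      rcases (Nat.dvd_prime Nat.prime_three).1 h5 with h | h
      · exact absurd h h6
      · exact h
    have h8 := Subgroup.relIndex_mul_index hle
    rw [h7, hindex] at h8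
    have h9 : D.range.relIndex χ.ker = 1 := by omega
    exact Subgroup.relIndex_eq_one.1 h9
  -- the 3-torsion as the kernel of D ∘ D
  have hcard : Nat.card {g : C // g ^ 3 = 1} = Nat.card (D.comp D).ker := by
    refine Nat.card_congr (Equiv.subtypeEquivRight fun c => ?_)
    rw [MonoidHom.mem_ker]; exact h3 c
  -- restrict D to that kernel
  let D' : (D.comp D).ker →* C := D.comp (D.comp D).ker.subtype
  have hD'k : Nat.card D'.ker = 3 := by
    rw [← hkercard]
    refine Nat.card_congr ⟨fun c => ⟨c.1.1, c.2⟩, fun c => ⟨⟨c.1, ?_⟩, c.2⟩, fun _ => rfl, fun _ => rfl⟩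
    rw [MonoidHom.mem_ker, MonoidHom.comp_apply, (MonoidHom.mem_ker).1 c.2, map_one]
  have hD'r : ∀ c, c ∈ D'.range ↔ c ∈ D.ker ⊓ D.range := by
    intro c
    constructor
    · rintro ⟨⟨e, he⟩, rfl⟩
      exact ⟨he, ⟨e, rfl⟩⟩
    · rintro ⟨hc, ⟨e, rfl⟩⟩
      exact ⟨⟨e, hc⟩, rfl⟩
  have hD'r2 : D'.range = D.ker ⊓ D.range := Subgroup.ext hD'r
  have hprod : Nat.card (D.comp D).ker = 3 * Nat.card (D.ker ⊓ D.range : Subgroup C) := by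
    rw [← Subgroup.card_mul_index D'.ker, Subgroup.index_ker, hD'k, hD'r2]
  rw [hcard, hprod, hkχ]
  constructor
  · intro h
    have : D.ker ⊓ χ.ker = D.ker := by
      rw [inf_eq_left]
      intro c hc
      exact h c ((hker c).1 hc)
    rw [this, hkercard]
  · intro h
    have hlt : D.ker ⊓ χ.ker ≠ D.ker := by
      rw [Ne, inf_eq_left]
      intro h'
      exact h fun c hc => h' ((hker c).2 hc)
    have hd : Nat.card (D.ker ⊓ χ.ker : Subgroup C) ∣ 3 := by
      rw [← hkercard]; exact Subgroup.card_dvd_of_le inf_le_left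
    rcases (Nat.dvd_prime Nat.prime_three).1 hd with h' | h'
    · rw [h']
    · exfalso; apply hlt
      exact Subgroup.eq_of_le_of_card_ge inf_le_left (by rw [h', hkercard])

end AbstractGroup

/-! ### Generic Kummer setup -/

/-- Abstract data of a cubic Kummer extension of rings `O / R`. -/
structure Kum (R O : Type*) [CommRing R] [CommRing O] [Algebra R O] where
  z : R
  hz : z ^ 2 + z + 1 = 0
  p : R
  m : R
  e : R
  α : O
  y : O
  σ : O ≃+* O
  hp : Prime p
  hm : Prime m ∨ m = 1
  cop : IsCoprime p m
  hn : p * m = 1 + (z - 1) ^ 3 * e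
  hα : α ^ 3 = algebraMap R O (p * m)
  hy : algebraMap R O (z - 1) * y = α - 1
  hσR : ∀ r, σ (algebraMap R O r) = algebraMap R O r
  hσα : σ α = algebraMap R O (z ^ 2) * α
  hσ3 : ∀ x, σ (σ (σ x)) = x
  hfix : ∀ x, σ x = x → ∃ r, algebraMap R O r = x
  hinj : Function.Injective (algebraMap R O)
  h3 : (3 : O) ≠ 0
  hunits : ∀ u : R, IsUnit u → ∃ i : ℕ, u = z ^ i ∨ u = - z ^ i

namespace Kum

section Basic

variable {R O : Type*} [CommRing R] [CommRing O] [Algebra R O] [IsDomain R] [IsDomain O]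
  (k : Kum R O)

local notation "ι" => algebraMap R O

/-- image of `z` -/
def Z : O := algebraMap R O k.z
/-- norm -/
def Nm (x : O) : O := x * k.σ x * k.σ (k.σ x)
/-- trace -/
def Tr (x : O) : O := x + k.σ x + k.σ (k.σ x)

theorem hZ : k.Z ^ 2 + k.Z + 1 = 0 := by
  have := congrArg ι k.hz
  simpa [Z] using this

theorem σZ : k.σ k.Z = k.Z := k.hσR _

theorem σα : k.σ k.α = k.Z ^ 2 * k.α := by rw [k.hσα, map_pow]; rfl

theorem Z3 : k.Z ^ 3 = 1 := by linear_combination (k.Z - 1) * k.hZ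

theorem z3 : k.z ^ 3 = 1 := by linear_combination (k.z - 1) * k.hz

theorem σσα : k.σ (k.σ k.α) = k.Z * k.α := by
  rw [k.σα, map_mul, map_pow, k.σZ, k.σα]
  linear_combination k.Z * k.α * k.Z3

theorem lam0 : k.Z - 1 ≠ 0 := by
  intro h
  apply k.h3
  have h1 : k.Z = 1 := by linear_combination h
  have := k.hZ
  rw [h1] at this
  linear_combination this

theorem hy' : (k.Z - 1) * k.y = k.α - 1 := by
  have := k.hy
  simpa [Z] using this

theorem α0 : k.α ≠ 0 := by
  intro h
  have h1 := k.hα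
  rw [h] at h1
  have h2 : ι (k.p * k.m) = ι 0 := by rw [← h1, map_zero]; ring
  have h3 := k.hinj h2
  rcases mul_eq_zero.1 h3 with h4 | h4
  · exact k.hp.ne_zero h4
  · rcases k.hm with h5 | h5
    · exact h5.ne_zero h4
    · rw [h5] at h4; exact one_ne_zero h4

theorem ι0 (k : Kum R O) {r : R} : ι r = 0 ↔ r = 0 := by
  constructor
  · intro h; exact k.hinj (by rw [h, map_zero])
  · rintro rfl; exact map_zero _

theorem Nm_mul (x w : O) : k.Nm (x * w) = k.Nm x * k.Nm w := by
  simp only [Nm, map_mul]; ring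

theorem Nm_pow (x : O) (n : ℕ) : k.Nm (x ^ n) = k.Nm x ^ n := by
  simp only [Nm, map_pow]; ring

theorem Nm_ι (r : R) : k.Nm (ι r) = ι r ^ 3 := by
  simp only [Nm, k.hσR]; ring

theorem Nm_α : k.Nm k.α = ι (k.p * k.m) := by
  rw [← k.hα, Nm, k.σσα, k.σα]; linear_combination k.α ^ 3 * k.Z3

theorem Nm_fix (x : O) : ∃ r, ι r = k.Nm x := by
  apply k.hfix
  simp only [Nm, map_mul, k.hσ3]; ring

theorem Tr_fix (x : O) : ∃ r, ι r = k.Tr x := by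
  apply k.hfix
  simp only [Tr, map_add, k.hσ3]; ring

theorem Nm_ne {x : O} (h : x ≠ 0) : k.Nm x ≠ 0 := by
  have h1 : k.σ x ≠ 0 := by rwa [Ne, EmbeddingLike.map_eq_zero_iff]
  have h2 : k.σ (k.σ x) ≠ 0 := by rwa [Ne, EmbeddingLike.map_eq_zero_iff]
  exact mul_ne_zero (mul_ne_zero h h1) h2

theorem σy : k.y - k.σ k.y = k.Z ^ 2 * k.α := by
  have h := congrArg k.σ k.hy'
  rw [map_mul, map_sub, map_sub, map_one, k.σZ, k.σα] at h
  apply mul_left_cancel₀ k.lam0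
  linear_combination k.hy' - h - k.α * k.Z3 + k.α * k.hZ * 0

theorem σσy : k.y - k.σ (k.σ k.y) = - k.α := by
  have h := congrArg k.σ (congrArg k.σ k.hy')
  simp only [map_mul, map_sub, map_one, k.σZ] at h
  rw [k.σσα] at h
  apply mul_left_cancel₀ k.lam0
  linear_combination k.hy' - h

theorem interp (w : O) : - k.Z ^ 2 * k.α ^ 2 * w =
    k.Tr w * k.y ^ 2 - k.Tr (w * (k.σ k.y + k.σ (k.σ k.y))) * k.y
      + k.Tr (w * (k.σ k.y * k.σ (k.σ k.y))) := by
  have h1 := k.σy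
  have h2 := k.σσy
  simp only [Tr, map_add, map_mul, k.hσ3]
  have e1 : k.σ k.y = k.y - k.Z ^ 2 * k.α := by linear_combination - h1
  have e2 : k.σ (k.σ k.y) = k.y + k.α := by linear_combination - h2
  rw [e2, e1]
  ring

theorem ι_dvd (k : Kum R O) {r t : R} (h : ι r ∣ ι t) : r ∣ t := by
  obtain ⟨x, hx⟩ := h
  by_cases hr : r = 0
  · subst hr
    rw [map_zero, zero_mul] at hx
    rw [k.ι0.1 hx]
  · have : k.σ x = x := by
      have h1 := congrArg k.σ hx
      rw [map_mul, k.hσR, k.hσR, hx] at h1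
      exact (mul_left_cancel₀ (fun h => hr (k.ι0.1 h)) h1).symm
    obtain ⟨s, rfl⟩ := k.hfix x this
    rw [← map_mul] at hx
    exact ⟨s, k.hinj hx⟩

theorem isUnit_of_ι (k : Kum R O) {r : R} (h : IsUnit (ι r)) : IsUnit r := by
  rw [isUnit_iff_dvd_one] at h ⊢
  rw [← map_one ι] at h
  exact k.ι_dvd h

theorem α_dvd {r : R} (h : k.α ∣ ι r) : k.p ∣ r := by
  have h1 : k.α ^ 3 ∣ ι r ^ 3 := pow_dvd_pow_of_dvd h 3
  rw [k.hα, ← map_pow] at h1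
  exact k.hp.dvd_of_dvd_pow ((dvd_mul_right _ _).trans (k.ι_dvd h1))

/-- each element is, up to `lam² m`, a scalar modulo `α`. -/
theorem scalar_mod (w : O) : ∃ (r : R) (v : O), (k.Z - 1) ^ 2 * ι k.m * w = ι r + k.α * v := by
  have h := k.interp w
  obtain ⟨t0, h0⟩ := k.Tr_fix w
  obtain ⟨t1, h1⟩ := k.Tr_fix (w * (k.σ k.y + k.σ (k.σ k.y)))
  obtain ⟨t2, h2⟩ := k.Tr_fix (w * (k.σ k.y * k.σ (k.σ k.y)))
  rw [← h0, ← h1, ← h2] at h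
  have hαn := k.hα
  have hy := k.hy'
  set c0 := t0 + t1 * (k.z - 1) + t2 * (k.z - 1) ^ 2 with hc0
  set c1 := - 2 * t0 - t1 * (k.z - 1) with hc1
  have key : - k.Z ^ 2 * (k.Z - 1) ^ 2 * k.α ^ 2 * w = ι c0 + ι c1 * k.α + ι t0 * k.α ^ 2 := by
    rw [hc0, hc1]
    simp only [map_add, map_mul, map_sub, map_one, map_neg, map_pow, map_ofNat]
    change _ = ι t0 + ι t1 * (k.Z - 1) + ι t2 * (k.Z - 1) ^ 2 +
      (-2 * ι t0 - ι t1 * (k.Z - 1)) * k.α + ι t0 * k.α ^ 2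
    linear_combination (k.Z - 1) ^ 2 * h + (ι t0 * ((k.Z - 1) * k.y + k.α - 1)
      - ι t1 * (k.Z - 1)) * hy
  have d0 : k.p ∣ c0 := by
    apply k.α_dvd
    exact ⟨- k.Z ^ 2 * (k.Z - 1) ^ 2 * k.α * w - ι c1 - ι t0 * k.α, by linear_combination - key⟩
  obtain ⟨c0', e0⟩ := d0
  rw [e0] at key
  rw [map_mul] at hαn key
  have d1 : k.p ∣ c1 := by
    have : k.p ∣ k.m * c1 := by
      apply k.α_dvd
      refine ⟨(- k.Z ^ 2 * (k.Z - 1) ^ 2 * w - ι t0) * ι k.m - k.α * ι c0', ?_⟩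
      rw [map_mul]
      apply mul_left_cancel₀ k.α0
      linear_combination - ι k.m * key + ι c0' * hαn
    exact (k.cop.dvd_of_dvd_mul_left this)
  obtain ⟨c1', e1⟩ := d1
  rw [e1, map_mul] at key
  refine ⟨- k.z * (k.m * t0), - k.Z * (ι c0' + k.α * ι c1'), ?_⟩
  rw [map_mul, map_mul, map_neg]
  change _ = - k.Z * _ + _
  apply mul_left_cancel₀ (pow_ne_zero 2 k.α0)
  linear_combination - k.Z * ι k.m * key + k.Z * (ι c0' + k.α * ι c1') * hαn
    - k.α ^ 2 * (k.Z - 1) ^ 2 * ι k.m * w * k.Z3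

/-- Hilbert 90 -/
theorem h90 {x w : O} (hw : w ≠ 0) (h : k.Nm x = k.Nm w) :
    ∃ g : O, g ≠ 0 ∧ x * k.σ g = w * g := by
  have hW := k.Nm_ne hw
  let G : O → O := fun c => k.Nm w * c + x * k.σ w * k.σ (k.σ w) * k.σ c +
    x * k.σ x * k.σ (k.σ w) * k.σ (k.σ c)
  have hG : ∀ c, x * k.σ (G c) = w * G c := by
    intro c
    simp only [G, map_add, map_mul, k.hσ3, Nm] at h ⊢
    linear_combination w * c * h
  by_cases g0 : G 1 = 0
  · by_cases g1 : G k.α = 0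
    · by_cases g2 : G (k.α ^ 2) = 0
      · exfalso
        simp only [G, map_one, map_pow, k.σα, k.σσα, map_mul, k.σZ] at g0 g1 g2
        have h1 := k.α0
        have g1' : k.Nm w + x * k.σ w * k.σ (k.σ w) * k.Z ^ 2 +
            x * k.σ x * k.σ (k.σ w) * k.Z = 0 := by
          apply mul_left_cancel₀ h1
          linear_combination g1 - x * k.σ x * k.σ (k.σ w) * k.α * k.Z * k.Z3
        have g2' : k.Nm w + x * k.σ w * k.σ (k.σ w) * k.Z +
            x * k.σ x * k.σ (k.σ w) * k.Z ^ 2 = 0 := by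
          apply mul_left_cancel₀ (pow_ne_zero 2 h1)
          linear_combination g2 - (x * k.σ w * k.σ (k.σ w) * k.Z * k.α ^ 2 +
            x * k.σ x * k.σ (k.σ w) * k.Z ^ 2 * k.α ^ 2 * (k.Z^3 + 1)) * k.Z3
        have : 3 * k.Nm w = 0 := by
          linear_combination g0 + g1' + g2' - (x * k.σ w * k.σ (k.σ w) +
            x * k.σ x * k.σ (k.σ w)) * k.hZ
        rcases mul_eq_zero.1 this with h | h
        · exact k.h3 h
        · exact hW h
      · exact ⟨_, g2, hG _⟩
    · exact ⟨_, g1, hG _⟩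
  · exact ⟨_, g0, hG _⟩

theorem lam_cop : IsCoprime (k.z - 1) k.p :=
  ⟨- ((k.z - 1) ^ 2 * k.e), k.m, by linear_combination k.hn⟩

/-- the same setup with the roles of `p` and `m` exchanged -/
def swap (hm : Prime k.m) : Kum R O :=
  { k with p := k.m, m := k.p, hp := hm, hm := Or.inl k.hp, cop := k.cop.symm,
           hn := by rw [mul_comm]; exact k.hn,
           hα := by rw [mul_comm k.m]; exact k.hα }

end Basic

end Kum

open UniqueFactorizationMonoid in
/-- valuation of an ideal at a prime ideal -/
noncomputable def vv {O : Type*} [CommRing O] [IsDedekindDomain O] (P I : Ideal O) : ℕ :=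
  by classical exact (normalizedFactors I).count P

section vv
open UniqueFactorizationMonoid
variable {O : Type*} [CommRing O] [IsDedekindDomain O]

theorem vv_mul {P I J : Ideal O} (hI : I ≠ 0) (hJ : J ≠ 0) : vv P (I * J) = vv P I + vv P J := by
  classical
  unfold vv
  rw [normalizedFactors_mul hI hJ, Multiset.count_add]

theorem vv_one {P : Ideal O} : vv P 1 = 0 := by
  classical
  unfold vv
  rw [normalizedFactors_one, Multiset.count_zero]

theorem vv_pow {P I : Ideal O} (hI : I ≠ 0) (n : ℕ) : vv P (I ^ n) = n * vv P I := by
  induction n with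
  | zero => rw [pow_zero, vv_one]; ring
  | succ n ih => rw [pow_succ, vv_mul (pow_ne_zero n hI) hI, ih]; ring

theorem vv_self {P : Ideal O} (hP : Prime P) : vv P P = 1 := by
  classical
  unfold vv
  rw [normalizedFactors_irreducible hP.irreducible, normalize_eq, Multiset.count_singleton_self]

theorem vv_eq_zero {P I : Ideal O} (hP : Prime P) (hI : I ≠ 0) : vv P I = 0 ↔ ¬ (I ≤ P) := by
  classical
  unfold vv
  rw [Multiset.count_eq_zero, not_iff_not, ← Ideal.dvd_iff_le]
  constructor
  · exact fun h => dvd_of_mem_normalizedFactors h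
  · intro h
    obtain ⟨q, hq, hqa⟩ := exists_mem_normalizedFactors_of_dvd hI hP.irreducible h
    rwa [associated_iff_eq.1 hqa]

end vv

/-- a cubing identity for ideals -/
theorem span_pair_cube {O : Type*} [CommRing O] {x a b : O} (h : x ^ 3 = a * b)
    (hc : IsCoprime a b) : Ideal.span {x, a} ^ 3 = Ideal.span {a} := by
  apply le_antisymm
  · rw [pow_succ, pow_two, Ideal.span_pair_mul_span_pair, Ideal.mul_le]
    intro r hr s hs
    rw [Ideal.mem_span_singleton]
    obtain ⟨u, v, rfl⟩ := Ideal.mem_span_pair.1 hs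
    have h2 : r ∈ Ideal.span {x * x, a} := by
      refine (Ideal.span_le.2 ?_) hr
      intro t ht
      simp only [Set.mem_insert_iff, Set.mem_singleton_iff] at ht
      rw [SetLike.mem_coe, Ideal.mem_span_pair]
      rcases ht with rfl | rfl | rfl | rfl
      · exact ⟨1, 0, by ring⟩
      · exact ⟨0, x, by ring⟩
      · exact ⟨0, x, by ring⟩
      · exact ⟨0, a, by ring⟩
    obtain ⟨s, t, rfl⟩ := Ideal.mem_span_pair.1 h2
    exact ⟨s * u * b + s * v * x * x + t * u * x + t * v * a, by linear_combination s * u * h⟩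
  · rw [Ideal.span_singleton_le_iff_mem]
    have hx : x ^ 3 ∈ Ideal.span {x, a} ^ 3 := Ideal.pow_mem_pow (Ideal.subset_span (by simp)) 3
    have ha : a ^ 3 ∈ Ideal.span {x, a} ^ 3 := Ideal.pow_mem_pow (Ideal.subset_span (by simp)) 3
    obtain ⟨u, v, huv⟩ := hc.pow_left (m := 2)
    have : a = u * a ^ 3 + v * x ^ 3 := by linear_combination - a * huv - v * h
    have h4 := Ideal.add_mem _ (Ideal.mul_mem_left _ u ha) (Ideal.mul_mem_left _ v hx)
    rwa [← this] at h4

namespace Kum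

section Ideals

variable {R O : Type*} [CommRing R] [CommRing O] [Algebra R O] [IsDomain R]
  [IsPrincipalIdealRing R] [IsDomain O] [IsDedekindDomain O]
  (k : Kum R O)

local notation "ι" => algebraMap R O

/-- the ramified ideal above `p` -/
def PP : Ideal O := Ideal.span {k.α, algebraMap R O k.p}
/-- the ramified ideal above `m` -/
def MM : Ideal O := Ideal.span {k.α, algebraMap R O k.m}

theorem PP3 : k.PP ^ 3 = Ideal.span {ι k.p} :=
  span_pair_cube (by rw [k.hα, map_mul]) (k.cop.map ι)

theorem MM3 : k.MM ^ 3 = Ideal.span {ι k.m} :=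
  span_pair_cube (by rw [k.hα, map_mul, mul_comm]) (k.cop.map ι).symm

theorem p0 : ι k.p ≠ 0 := fun h => k.hp.ne_zero (k.ι0.1 h)

theorem m0' : k.m ≠ 0 := by
  intro h4
  rcases k.hm with h5 | h5
  · exact h5.ne_zero h4
  · rw [h5] at h4; exact one_ne_zero h4

theorem m0 : ι k.m ≠ 0 := fun h => k.m0' (k.ι0.1 h)

theorem PP0 : k.PP ≠ 0 := by
  intro h
  have := k.PP3
  rw [h, eq_comm, zero_pow (by norm_num), Ideal.zero_eq_bot, Ideal.span_singleton_eq_bot] at this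
  exact k.p0 this

theorem MM0 : k.MM ≠ 0 := by
  intro h
  have := k.MM3
  rw [h, eq_comm, zero_pow (by norm_num), Ideal.zero_eq_bot, Ideal.span_singleton_eq_bot] at this
  exact k.m0 this

theorem PPMM : k.PP * k.MM = Ideal.span {k.α} := by
  have h3 := k.hα
  rw [map_mul] at h3
  apply le_antisymm
  · rw [PP, MM, Ideal.span_pair_mul_span_pair, Ideal.span_le]
    intro t ht
    simp only [Set.mem_insert_iff, Set.mem_singleton_iff] at ht
    rw [SetLike.mem_coe, Ideal.mem_span_singleton]
    rcases ht with rfl | rfl | rfl | rfl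
    · exact ⟨k.α, rfl⟩
    · exact ⟨_, rfl⟩
    · exact ⟨_, mul_comm _ _⟩
    · exact ⟨k.α ^ 2, by linear_combination - h3⟩
  · rw [Ideal.span_singleton_le_iff_mem]
    obtain ⟨u, v, huv⟩ := k.cop.map ι
    have ha : k.α ∈ k.PP := Ideal.subset_span (by simp)
    have hb : k.α ∈ k.MM := Ideal.subset_span (by simp)
    have hc : ι k.p ∈ k.PP := Ideal.subset_span (by simp)
    have hd : ι k.m ∈ k.MM := Ideal.subset_span (by simp)
    have : k.α = u * (ι k.p * k.α) + v * (k.α * ι k.m) := by linear_combination - k.α * huv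
    rw [this]
    exact Ideal.add_mem _ (Ideal.mul_mem_left _ _ (Ideal.mul_mem_mul hc hb))
      (Ideal.mul_mem_left _ _ (Ideal.mul_mem_mul ha hd))

theorem ι_mem_PP {r : R} : ι r ∈ k.PP ↔ k.p ∣ r := by
  constructor
  · intro h
    have := Ideal.pow_mem_pow h 3
    rw [k.PP3, Ideal.mem_span_singleton, ← map_pow] at this
    exact k.hp.dvd_of_dvd_pow (k.ι_dvd this)
  · rintro ⟨s, rfl⟩
    rw [map_mul]
    exact Ideal.mul_mem_right _ _ (Ideal.subset_span (by simp))

theorem α_mem_PP : k.α ∈ k.PP := Ideal.subset_span (by simp)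

/-- multiplication by a scalar prime to `p` is invertible modulo `PP`. -/
theorem mem_PP_of_mul {r : R} (hr : IsCoprime r k.p) {x : O} (h : ι r * x ∈ k.PP) : x ∈ k.PP := by
  obtain ⟨u, v, huv⟩ := hr.map ι
  have : x = u * (ι r * x) + v * x * ι k.p := by linear_combination - x * huv
  rw [this]
  exact Ideal.add_mem _ (Ideal.mul_mem_left _ _ h)
    (Ideal.mul_mem_left _ _ (Ideal.subset_span (by simp)))

theorem copc : IsCoprime ((k.z - 1) ^ 2 * k.m) k.p :=
  IsCoprime.mul_left (k.lam_cop.pow_left) k.cop.symm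

theorem scalar_mod' (w : O) : ∃ (r : R) (v : O),
    ι ((k.z - 1) ^ 2 * k.m) * w = ι r + k.α * v := by
  have := k.scalar_mod w
  simpa [Z] using this

theorem PP_isPrime : k.PP.IsPrime := by
  constructor
  · intro h
    have : ι 1 ∈ k.PP := by rw [h]; trivial
    exact k.hp.not_unit (isUnit_of_dvd_one (k.ι_mem_PP.1 this))
  · intro x w hxw
    obtain ⟨r, v, h1⟩ := k.scalar_mod' x
    obtain ⟨r', v', h2⟩ := k.scalar_mod' w
    have h3 : ι (r * r') ∈ k.PP := by
      have : ι (r * r') = ι ((k.z - 1) ^ 2 * k.m) ^ 2 * (x * w) +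
          (- v * (ι r' + k.α * v') - ι r * v') * k.α := by
        rw [map_mul]
        linear_combination (- ι ((k.z - 1) ^ 2 * k.m) * w) * h1 - (ι r + k.α * v) * h2
      rw [this]
      exact Ideal.add_mem _ (Ideal.mul_mem_left _ _ hxw) (Ideal.mul_mem_left _ _ k.α_mem_PP)
    rcases k.hp.dvd_or_dvd (k.ι_mem_PP.1 h3) with h | h
    · left
      apply k.mem_PP_of_mul k.copc
      rw [h1]
      exact Ideal.add_mem _ (k.ι_mem_PP.2 h) (Ideal.mul_mem_right _ _ k.α_mem_PP)
    · right
      apply k.mem_PP_of_mul k.copc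
      rw [h2]
      exact Ideal.add_mem _ (k.ι_mem_PP.2 h) (Ideal.mul_mem_right _ _ k.α_mem_PP)

theorem PP_prime : Prime k.PP := Ideal.prime_of_isPrime k.PP0 k.PP_isPrime

theorem MM_prime (hm : Prime k.m) : Prime k.MM := (k.swap hm).PP_prime

theorem MM_top (hm : k.m = 1) : k.MM = 1 := by
  rw [MM, hm, map_one, Ideal.one_eq_top, Ideal.eq_top_iff_one]
  exact Ideal.subset_span (by simp)

theorem PP_ne_MM : k.PP ≠ k.MM := by
  intro h
  have h1 : ι k.p ∈ k.PP := Ideal.subset_span (by simp)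
  have h2 : ι k.m ∈ k.PP := by rw [h]; exact Ideal.subset_span (by simp)
  obtain ⟨u, v, huv⟩ := k.cop
  have : ι 1 ∈ k.PP := by
    rw [← huv, map_add, map_mul, map_mul]
    exact Ideal.add_mem _ (Ideal.mul_mem_left _ _ h1) (Ideal.mul_mem_left _ _ h2)
  exact k.hp.not_unit (isUnit_of_dvd_one (k.ι_mem_PP.1 this))

theorem vvPM : vv k.PP k.MM = 0 := by
  rw [vv_eq_zero k.PP_prime k.MM0]
  intro h
  have h1 : ι k.p ∈ k.PP := Ideal.subset_span (by simp)
  have h2 : ι k.m ∈ k.PP := h (Ideal.subset_span (by simp))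
  obtain ⟨u, v, huv⟩ := k.cop
  have : ι 1 ∈ k.PP := by
    rw [← huv, map_add, map_mul, map_mul]
    exact Ideal.add_mem _ (Ideal.mul_mem_left _ _ h1) (Ideal.mul_mem_left _ _ h2)
  exact k.hp.not_unit (isUnit_of_dvd_one (k.ι_mem_PP.1 this))

theorem span0 {x : O} (hx : x ≠ 0) : Ideal.span {x} ≠ 0 := by
  rwa [Ne, Ideal.zero_eq_bot, Ideal.span_singleton_eq_bot]

/-- valuation of scalars is a multiple of 3 -/
theorem vv_ι {r : R} (hr : r ≠ 0) : 3 ∣ vv k.PP (Ideal.span {ι r}) := by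
  obtain ⟨n, c, hc, rfl⟩ := WfDvdMonoid.max_power_factor hr k.hp.irreducible
  have hc0 : c ≠ 0 := by rintro rfl; exact hc (dvd_zero _)
  have hc1 : ι c ≠ 0 := fun h => hc0 (k.ι0.1 h)
  rw [map_mul, map_pow, ← Ideal.span_singleton_mul_span_singleton, ← Ideal.span_singleton_pow,
    ← k.PP3, vv_mul (pow_ne_zero _ (pow_ne_zero _ k.PP0)) (span0 hc1), vv_pow (pow_ne_zero _ k.PP0),
    vv_pow k.PP0, vv_self k.PP_prime, (vv_eq_zero k.PP_prime (span0 hc1)).2]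
  · exact ⟨n, by ring⟩
  · rw [Ideal.span_singleton_le_iff_mem, k.ι_mem_PP]; exact hc

/-- action of `σ` on ideals -/
def S (I : Ideal O) : Ideal O := Ideal.map (k.σ : O →+* O) I

theorem mem_S {I : Ideal O} {x : O} : x ∈ k.S I ↔ ∃ w ∈ I, k.σ w = x := by
  rw [S]; exact Ideal.mem_map_iff_of_surjective (k.σ : O →+* O) k.σ.surjective

theorem S_mono {I J : Ideal O} (h : I ≤ J) : k.S I ≤ k.S J := Ideal.map_mono h

theorem S_mul (I J : Ideal O) : k.S (I * J) = k.S I * k.S J := Ideal.map_mul _ _ _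

theorem S_one : k.S 1 = 1 := by rw [S, Ideal.one_eq_top, Ideal.map_top]

theorem S_pow (I : Ideal O) (n : ℕ) : k.S (I ^ n) = k.S I ^ n := Ideal.map_pow _ _ _

theorem S_span (x : O) : k.S (Ideal.span {x}) = Ideal.span {k.σ x} := by
  rw [S, Ideal.map_span, Set.image_singleton]; rfl

theorem S3 (I : Ideal O) : k.S (k.S (k.S I)) = I := by
  ext x
  simp only [mem_S]
  constructor
  · rintro ⟨_, ⟨_, ⟨w, hw, rfl⟩, rfl⟩, rfl⟩
    rwa [k.hσ3]
  · intro h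
    exact ⟨_, ⟨_, ⟨x, h, rfl⟩, rfl⟩, k.hσ3 x⟩

theorem S0 {I : Ideal O} (h : I ≠ 0) : k.S I ≠ 0 := by
  intro h0
  apply h
  rw [← k.S3 I, h0, S, S, Ideal.zero_eq_bot, Ideal.map_bot, Ideal.map_bot]

theorem σmem {I : Ideal O} (h : k.S I = I) {x : O} (hx : x ∈ I) : k.σ x ∈ I := by
  rw [← h, mem_S]; exact ⟨x, hx, rfl⟩

theorem S_eq_of_le {I : Ideal O} (h : k.S I ≤ I) : k.S I = I := by
  apply le_antisymm h
  conv_lhs => rw [← k.S3 I]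
  exact k.S_mono ((k.S_mono h).trans h)

/-- `σ` fixes `PP` and `MM` -/
theorem S_PP : k.S k.PP = k.PP := by
  apply k.S_eq_of_le
  rw [S, PP, Ideal.map_span, Ideal.span_le]
  rintro _ ⟨t, ht, rfl⟩
  simp only [Set.mem_insert_iff, Set.mem_singleton_iff] at ht
  rcases ht with rfl | rfl
  · change k.σ k.α ∈ k.PP
    rw [k.σα]; exact Ideal.mul_mem_left _ _ k.α_mem_PP
  · change k.σ _ ∈ k.PP
    rw [k.hσR]; exact Ideal.subset_span (by simp)

theorem S_MM : k.S k.MM = k.MM := by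
  rcases k.hm with h | h
  · exact (k.swap h).S_PP
  · rw [k.MM_top h, S_one]

/-- structure of invariant ideals -/
theorem invariant {J : Ideal O} (hJ0 : J ≠ 0) (hJ : k.S J = J) :
    ∃ (g f : R) (i j : ℕ), g ≠ 0 ∧ f ≠ 0 ∧
      Ideal.span {ι g} * J = Ideal.span {ι f} * (k.PP ^ i * k.MM ^ j) := by
  obtain ⟨a, ha⟩ := (IsPrincipalIdealRing.principal (Ideal.comap ι J)).principal
  have hmem : ∀ r, ι r ∈ J ↔ a ∣ r := by
    intro r
    rw [← Ideal.mem_comap, ha, Submodule.mem_span_singleton]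
    constructor
    · rintro ⟨c, rfl⟩; exact ⟨c, mul_comm _ _⟩
    · rintro ⟨c, rfl⟩; exact ⟨c, mul_comm _ _⟩
  have ha0 : a ≠ 0 := by
    rintro rfl
    obtain ⟨x, hx, hx0⟩ := Submodule.exists_mem_ne_zero_of_ne_bot hJ0
    obtain ⟨r, hr⟩ := k.Nm_fix x
    have h1 : ι r ∈ J := by
      rw [hr, Nm, mul_assoc]; exact Ideal.mul_mem_right _ _ hx
    rw [hmem, zero_dvd_iff] at h1
    rw [h1, map_zero] at hr
    exact k.Nm_ne hx0 hr.symm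
  have hle : Ideal.span {ι a} ≤ J := by
    rw [Ideal.span_singleton_le_iff_mem, hmem]
  obtain ⟨J', hJ'⟩ := Ideal.dvd_iff_le.2 hle
  have hTr : ∀ x ∈ J, ι a ∣ k.Tr x := by
    intro x hx
    obtain ⟨r, hr⟩ := k.Tr_fix x
    have : ι r ∈ J := by
      rw [hr, Tr]
      have h1 := k.σmem hJ hx
      exact J.add_mem (J.add_mem hx h1) (k.σmem hJ h1)
    rw [hmem] at this
    rw [← hr]
    exact map_dvd ι this
  have h2 : Ideal.span {k.α ^ 2} * J ≤ Ideal.span {ι a} := by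
    rw [Ideal.span_singleton_mul_le_iff]
    intro w hw
    rw [Ideal.mem_span_singleton]
    have h3 : ι a ∣ - k.Z ^ 2 * k.α ^ 2 * w := by
      rw [k.interp]
      refine dvd_add (dvd_sub (Dvd.dvd.mul_right ?_ _) (Dvd.dvd.mul_right ?_ _)) ?_
      · exact hTr _ hw
      · exact hTr _ (J.mul_mem_right _ hw)
      · exact hTr _ (J.mul_mem_right _ hw)
    have h4 : k.α ^ 2 * w = - k.Z * (- k.Z ^ 2 * k.α ^ 2 * w) := by
      linear_combination - k.α ^ 2 * w * k.Z3
    rw [h4]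
    exact Dvd.dvd.mul_left h3 _
  have h5 : J' ∣ k.PP ^ 2 * k.MM ^ 2 := by
    rw [← mul_pow, k.PPMM, Ideal.span_singleton_pow]
    rw [hJ', ← Ideal.dvd_iff_le, mul_comm (Ideal.span _)] at h2
    exact (mul_dvd_mul_iff_left hJ0).1 h2
  obtain ⟨X, Y, hX, hY, rfl⟩ := exists_dvd_and_dvd_of_dvd_mul h5
  obtain ⟨i, hi, hXi⟩ := (dvd_prime_pow k.PP_prime 2).1 hX
  rw [associated_iff_eq] at hXi
  have hYj : ∃ j, Y = k.MM ^ j := by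
    rcases k.hm with h | h
    · obtain ⟨j, hj, hYj⟩ := (dvd_prime_pow (k.MM_prime h) 2).1 hY
      exact ⟨j, associated_iff_eq.1 hYj⟩
    · refine ⟨0, ?_⟩
      rw [k.MM_top h, one_pow] at hY
      rw [pow_zero]
      exact associated_iff_eq.1 (associated_one_iff_isUnit.2 (isUnit_of_dvd_one hY))
  obtain ⟨j, rfl⟩ := hYj
  subst hXi
  refine ⟨k.p ^ i * k.m ^ j, a, 2 * i, 2 * j, ?_, ha0, ?_⟩
  · exact mul_ne_zero (pow_ne_zero _ k.hp.ne_zero) (pow_ne_zero _ k.m0')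
  · rw [hJ', map_mul, map_pow, map_pow, ← Ideal.span_singleton_mul_span_singleton,
      ← Ideal.span_singleton_pow, ← Ideal.span_singleton_pow, ← k.PP3, ← k.MM3]
    ring

/-- unique factorisation obstruction -/
theorem no_scalar {i j : ℕ} {g f : R} (hg : g ≠ 0) (hf : f ≠ 0)
    (h : Ideal.span {ι g} = Ideal.span {ι f} * (k.PP ^ i * k.MM ^ j)) : 3 ∣ i := by
  have h1 := congrArg (vv k.PP) h
  have hg' : ι g ≠ 0 := fun h => hg (k.ι0.1 h)
  have hf' : ι f ≠ 0 := fun h => hf (k.ι0.1 h)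
  rw [vv_mul (span0 hf') (mul_ne_zero (pow_ne_zero _ k.PP0) (pow_ne_zero _ k.MM0)),
    vv_mul (pow_ne_zero _ k.PP0) (pow_ne_zero _ k.MM0), vv_pow k.PP0, vv_pow k.MM0, k.vvPM,
    vv_self k.PP_prime] at h1
  have h2 := k.vv_ι hg
  have h3 := k.vv_ι hf
  omega

/-- the key capitulation lemma -/
theorem keyK {I : Ideal O} (hI : I ≠ 0) {x w : O} (hx : x ≠ 0) (hw : w ≠ 0)
    (h : Ideal.span {x} * I = Ideal.span {w} * k.S I) (hN : k.Nm x = k.Nm w) :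
    ∃ (γ : O) (g f : R) (i j : ℕ), γ ≠ 0 ∧ g ≠ 0 ∧ f ≠ 0 ∧
      Ideal.span {ι g * γ} * I = Ideal.span {ι f} * (k.PP ^ i * k.MM ^ j) := by
  obtain ⟨γ, hγ0, hγ⟩ := k.h90 hw hN
  have hσγ : k.σ γ ≠ 0 := by rwa [Ne, EmbeddingLike.map_eq_zero_iff]
  have hinv : k.S (Ideal.span {γ} * I) = Ideal.span {γ} * I := by
    rw [S_mul, S_span]
    apply mul_left_cancel₀ (span0 hw)
    have h1 : Ideal.span {k.σ γ} * (Ideal.span {x} * I) =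
      Ideal.span {k.σ γ} * (Ideal.span {w} * k.S I) := by rw [h]
    simp only [← mul_assoc, Ideal.span_singleton_mul_span_singleton] at h1 ⊢
    rw [mul_comm w, ← h1, mul_comm (k.σ γ), hγ]
  obtain ⟨g, f, i, j, hg, hf, h2⟩ := k.invariant (mul_ne_zero (span0 hγ0) hI) hinv
  refine ⟨γ, g, f, i, j, hγ0, hg, hf, ?_⟩
  rw [← Ideal.span_singleton_mul_span_singleton, mul_assoc, h2]

end Ideals

end Kum

theorem det_card {M : Type*} [AddCommGroup M] [Module.Free ℤ M] [Module.Finite ℤ M]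
    (f : M →ₗ[ℤ] M) (hf : Function.Injective f) :
    Nat.card (M ⧸ LinearMap.range f) = (LinearMap.det f).natAbs := by
  have := Submodule.natAbs_det_equiv (LinearMap.range f) (LinearEquiv.ofInjective f hf)
  rw [← this]
  congr 1

theorem rank2_index {M : Type*} [AddCommGroup M] [Module.Free ℤ M] [Module.Finite ℤ M]
    (h2 : Module.finrank ℤ M = 2) (s : M →ₗ[ℤ] M) (hs : ∀ x, x + s x + s (s x) = 0) :
    Nat.card (M ⧸ LinearMap.range (LinearMap.id - s)) = 3 := by
  have hs3 : ∀ x, s (s (s x)) = x := by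
    intro x
    have h1 := hs x
    have h2 := hs (s x)
    have : s (s (s x)) - x = (s x + s (s x) + s (s (s x))) - (x + s x + s (s x)) := by abel
    rw [h1, h2, sub_zero, sub_eq_zero] at this
    exact this
  have hss : s ∘ₗ s ∘ₗ s = LinearMap.id := LinearMap.ext hs3
  have hdets : LinearMap.det s ^ 3 = 1 := by
    have := congrArg LinearMap.det hss
    rw [LinearMap.det_comp, LinearMap.det_comp, LinearMap.det_id] at this
    rw [← this]; ring
  have hdets1 : LinearMap.det s = 1 := by
    have h : (LinearMap.det s - 1) * (LinearMap.det s ^ 2 + LinearMap.det s + 1) = 0 := by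
      linear_combination hdets
    rcases mul_eq_zero.1 h with h | h
    · linarith
    · nlinarith [sq_nonneg (2 * LinearMap.det s + 1)]
  have hDD : (LinearMap.id - s) ∘ₗ (LinearMap.id - s) = (-3 : ℤ) • s := by
    ext x
    have h1 := hs x
    have h4 : s (s x) = - x - s x := by
      rw [← sub_eq_zero, ← h1]; abel
    simp only [LinearMap.comp_apply, LinearMap.sub_apply, LinearMap.id_apply, map_sub, h4,
      LinearMap.smul_apply]
    module
  have hd := congrArg LinearMap.det hDD
  rw [LinearMap.det_comp, LinearMap.det_smul, h2, hdets1] at hd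
  have hinj : Function.Injective (LinearMap.id - s : M →ₗ[ℤ] M) := by
    rw [← LinearMap.ker_eq_bot, LinearMap.ker_eq_bot']
    intro x hx
    have := congrArg (fun f : M →ₗ[ℤ] M => f x) hDD
    simp only [LinearMap.comp_apply, hx, map_zero, LinearMap.smul_apply] at this
    have h5 : s x = 0 := by
      rcases smul_eq_zero.1 this.symm with h | h
      · norm_num at h
      · exact h
    rw [← hs3 x, h5, map_zero, map_zero]
  rw [det_card _ hinj]
  have : (LinearMap.det (LinearMap.id - s : M →ₗ[ℤ] M)).natAbs * (LinearMap.det (LinearMap.id - s : M →ₗ[ℤ] M)).natAbs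
      = 3 * 3 := by
    rw [← Int.natAbs_mul, hd]; norm_num
  exact Nat.mul_self_inj.1 this

theorem units_index {E : Type*} [CommGroup E]
    [Module.Free ℤ (Additive (E ⧸ CommGroup.torsion E))]
    [Module.Finite ℤ (Additive (E ⧸ CommGroup.torsion E))]
    (h2 : Module.finrank ℤ (Additive (E ⧸ CommGroup.torsion E)) = 2)
    (s : E →* E) (hs : ∀ x, IsOfFinOrder (x * s x * s (s x))) :
    ∃ H : Subgroup E, H.index = 3 ∧
      ∀ u, u ∈ H ↔ ∃ t w, IsOfFinOrder t ∧ u * s w = t * w := by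
  let T := CommGroup.torsion E
  have hT : T ≤ T.comap s := by
    intro t ht
    exact MonoidHom.isOfFinOrder s ht
  let s' : E ⧸ T →* E ⧸ T := QuotientGroup.map T T s hT
  have hs' : ∀ x, x * s' x * s' (s' x) = 1 := by
    intro x
    obtain ⟨x, rfl⟩ := QuotientGroup.mk_surjective x
    simp only [s', QuotientGroup.map_mk]
    rw [← QuotientGroup.mk_mul, ← QuotientGroup.mk_mul, QuotientGroup.eq_one_iff]
    exact hs x
  let D' : E ⧸ T →* E ⧸ T := MonoidHom.id _ / s'
  let sl : Additive (E ⧸ T) →ₗ[ℤ] Additive (E ⧸ T) := (MonoidHom.toAdditive s').toIntLinearMap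
  have hidx := rank2_index h2 sl (fun x => hs' x.toMul)
  refine ⟨D'.range.comap (QuotientGroup.mk' T), ?_, ?_⟩
  · rw [Subgroup.index_comap_of_surjective _ (QuotientGroup.mk'_surjective T), ← hidx,
      ← Subgroup.index_toAddSubgroup]
    rfl
  · intro u
    rw [Subgroup.mem_comap]
    constructor
    · rintro ⟨w, hw⟩
      obtain ⟨w, rfl⟩ := QuotientGroup.mk_surjective w
      refine ⟨u * s w / w, w, ?_, by simp⟩
      have h3 : (QuotientGroup.mk w : E ⧸ T) / QuotientGroup.mk (s w) = QuotientGroup.mk u := hw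
      change u * s w / w ∈ T
      rw [← QuotientGroup.eq_one_iff, QuotientGroup.mk_div, QuotientGroup.mk_mul, ← h3,
        div_mul_cancel, div_self']
    · rintro ⟨t, w, ht, h⟩
      refine ⟨QuotientGroup.mk w, ?_⟩
      change (QuotientGroup.mk w : E ⧸ T) / QuotientGroup.mk (s w) = QuotientGroup.mk u
      have ht' : (QuotientGroup.mk t : E ⧸ T) = 1 := (QuotientGroup.eq_one_iff _).2 ht
      rw [div_eq_iff_eq_mul, ← QuotientGroup.mk_mul, h, QuotientGroup.mk_mul, ht', one_mul]

namespace Kum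

section UnitsPart

variable {R O : Type*} [CommRing R] [CommRing O] [Algebra R O] [IsDomain R]
  [IsPrincipalIdealRing R] [IsDomain O] [IsDedekindDomain O]
  (k : Kum R O)

local notation "ι" => algebraMap R O

theorem Zpow_mod (i : ℕ) : k.Z ^ i = k.Z ^ (i % 3) := by
  conv_lhs => rw [← Nat.div_add_mod i 3, pow_add, pow_mul, k.Z3, one_pow, one_mul]

theorem Z_ne_one : k.Z ≠ 1 := fun h => k.lam0 (by rw [h, sub_self])

theorem Zpow_eq_one {i : ℕ} (h : k.Z ^ i = 1) : 3 ∣ i := by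
  rw [k.Zpow_mod] at h
  have : i % 3 < 3 := Nat.mod_lt _ (by norm_num)
  interval_cases hi : i % 3
  · omega
  · rw [pow_one] at h; exact absurd h k.Z_ne_one
  · exfalso
    apply k.Z_ne_one
    have := k.Z3
    rw [pow_succ, h, one_mul] at this
    exact this

/-- elements with the same cube -/
theorem cube_eq {x w : O} (h : x ^ 3 = w ^ 3) : ∃ j : ℕ, x = k.Z ^ j * w := by
  have : (x - w) * ((x - k.Z * w) * (x - k.Z ^ 2 * w)) = 0 := by
    linear_combination h - x * (x - w) * w * k.hZ + w ^ 2 * (x - w) * k.Z3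
  rcases mul_eq_zero.1 this with h | h
  · exact ⟨0, by linear_combination h⟩
  · rcases mul_eq_zero.1 h with h | h
    · exact ⟨1, by linear_combination h⟩
    · exact ⟨2, by linear_combination h⟩

theorem fix_of_twist {x : O} {j : ℕ} (h : k.σ x = k.Z ^ j * x) : ∃ r, ι r = x * k.α ^ j := by
  apply k.hfix
  rw [map_mul, map_pow, h, k.σα, mul_pow, ← pow_mul]
  have : k.Z ^ j * k.Z ^ (2 * j) = 1 := by
    rw [← pow_add, show j + 2 * j = 3 * j by ring, pow_mul, k.Z3, one_pow]
  linear_combination x * k.α ^ j * this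

theorem unit_of_cube {x : O} {i : ℕ} (h : x ^ 3 = k.Z ^ i) : ∃ j : ℕ, x = k.Z ^ j := by
  have hxu : IsUnit x := by
    have h1 : x ^ 9 = 1 := by
      rw [show 9 = 3 * 3 by norm_num, pow_mul, h, ← pow_mul, mul_comm, pow_mul, k.Z3, one_pow]
    exact IsUnit.of_pow_eq_one h1 (by norm_num)
  have h1 : (k.σ x) ^ 3 = x ^ 3 := by
    rw [← map_pow, h, map_pow, k.σZ]
  obtain ⟨j, hj⟩ := k.cube_eq h1
  rw [k.Zpow_mod] at hj
  obtain ⟨r, hr⟩ := k.fix_of_twist hj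
  have hj3 : j % 3 < 3 := Nat.mod_lt _ (by norm_num)
  have hr0 : r ≠ 0 := by
    rintro rfl
    rw [map_zero] at hr
    exact mul_ne_zero hxu.ne_zero (pow_ne_zero _ k.α0) hr.symm
  have h3 : 3 ∣ j % 3 := by
    apply k.no_scalar (i := j % 3) (j := j % 3) hr0 (one_ne_zero)
    rw [map_one, Ideal.span_singleton_one, Ideal.top_mul, ← mul_pow, k.PPMM, hr,
      Ideal.span_singleton_pow, ← Ideal.span_singleton_mul_span_singleton,
      Ideal.span_singleton_eq_top.2 hxu, Ideal.top_mul]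
  have h4 : j % 3 = 0 := by omega
  rw [h4, pow_zero, mul_one] at hr
  have hru : IsUnit r := k.isUnit_of_ι (by rw [hr]; exact hxu)
  obtain ⟨b, hb | hb⟩ := k.hunits r hru
  · exact ⟨b, by rw [← hr, hb, map_pow]; rfl⟩
  · have hx : x = - k.Z ^ b := by rw [← hr, hb, map_neg, map_pow]; rfl
    have h5 : (-1 : O) = 1 := by
      have h6 : x ^ 9 = 1 := by
        rw [show 9 = 3 * 3 by norm_num, pow_mul, h, ← pow_mul, mul_comm, pow_mul, k.Z3, one_pow]
      rw [hx, neg_pow, ← pow_mul, show b * 9 = 3 * (b * 3) by ring, pow_mul, k.Z3, one_pow] at h6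
      linear_combination h6
    exact ⟨b, by rw [hx]; linear_combination k.Z ^ b * h5⟩

theorem torsion_pow (t : Oˣ) (ht : IsOfFinOrder t) :
    ∃ m : ℕ, ¬ 3 ∣ m ∧ ∃ i : ℕ, (t : O) ^ m = k.Z ^ i := by
  have hn : orderOf t ≠ 0 := ht.orderOf_pos.ne'
  obtain ⟨a, m, hm, hnm⟩ := Nat.exists_eq_pow_mul_and_not_dvd hn 3 (by norm_num)
  refine ⟨m, hm, ?_⟩
  have h1 : ((t : O) ^ m) ^ (3 ^ a) = 1 := by
    rw [← pow_mul, mul_comm, ← hnm, ← Units.val_pow_eq_pow_val, pow_orderOf_eq_one, Units.val_one]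
  generalize (t : O) ^ m = x at h1
  clear hnm
  induction a generalizing x with
  | zero => exact ⟨0, by simpa using h1⟩
  | succ a ih =>
    rw [pow_succ', pow_mul] at h1
    obtain ⟨i, hi⟩ := ih _ h1
    exact k.unit_of_cube hi

theorem Nm_neg (x : O) : k.Nm (-x) = - k.Nm x := by
  simp only [Nm, map_neg]; ring

theorem Nm_unit {u : O} (hu : IsUnit u) : IsUnit (k.Nm u) := by
  have h1 := hu.map k.σ
  exact (hu.mul h1).mul (h1.map k.σ)

/-- a fixed unit -/
theorem fixed_unit {u : O} (hu : IsUnit u) (h : k.σ u = u) :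
    ∃ i : ℕ, u = k.Z ^ i ∨ u = - k.Z ^ i := by
  obtain ⟨r, rfl⟩ := k.hfix u h
  obtain ⟨i, h | h⟩ := k.hunits r (k.isUnit_of_ι hu)
  · exact ⟨i, Or.inl (by rw [h, map_pow]; rfl)⟩
  · exact ⟨i, Or.inr (by rw [h, map_neg, map_pow]; rfl)⟩

theorem unit_norm {u : O} (hu : IsUnit u) :
    ∃ i : ℕ, k.Nm u = k.Z ^ i ∨ k.Nm (-u) = k.Z ^ i := by
  obtain ⟨r, hr⟩ := k.Nm_fix u
  obtain ⟨i, h⟩ := k.fixed_unit (k.Nm_unit hu) (by rw [← hr, k.hσR])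
  refine ⟨i, h.imp id fun h => ?_⟩
  rw [Nm_neg, h, neg_neg]

/-- existence of a unit of norm `z` -/
def CaseI : Prop := ∃ η : O, IsUnit η ∧ k.Nm η = k.Z

theorem not_caseI (h : ¬ k.CaseI) {u : O} (hu : IsUnit u) {i : ℕ} (hi : k.Nm u = k.Z ^ i) :
    k.Nm u = 1 := by
  rw [k.Zpow_mod] at hi
  have : i % 3 < 3 := Nat.mod_lt _ (by norm_num)
  interval_cases hh : i % 3
  · rw [hi, pow_zero]
  · exact absurd ⟨u, hu, by rw [hi, pow_one]⟩ h
  · refine absurd ⟨u ^ 2, hu.pow 2, ?_⟩ h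
    rw [Nm_pow, hi]; linear_combination k.Z * k.Z3

/-- hypothesis on units coming from Dirichlet's theorem -/
def UH : Prop := ∃ H : Subgroup Oˣ, H.index = 3 ∧
      ∀ u, u ∈ H ↔ ∃ t w, IsOfFinOrder t ∧ u * Units.map (k.σ : O →* O) w = t * w

theorem Nm_torsion (t : Oˣ) (ht : IsOfFinOrder t) (i : ℕ) (h : k.Nm t = k.Z ^ i) : 3 ∣ i := by
  obtain ⟨m, hm, l, hl⟩ := k.torsion_pow t ht
  have h1 : k.Nm ((t : O) ^ m) = 1 := by
    rw [hl, Nm_pow, Z, Nm_ι, ← pow_mul, mul_comm, pow_mul]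
    have := k.Z3
    rw [Z] at this
    rw [← pow_mul, mul_comm, pow_mul, this, one_pow]
  rw [Nm_pow, h, ← pow_mul] at h1
  exact (Nat.prime_three.dvd_mul.1 (k.Zpow_eq_one h1)).resolve_right hm

theorem index3_pow {E : Type*} [CommGroup E] (H : Subgroup E) (h : H.index = 3) (u : E) :
    u ^ 3 ∈ H := by
  rw [← h]; exact H.pow_index_mem u

theorem index3_gen {E : Type*} [CommGroup E] (H : Subgroup E) (h : H.index = 3) {η : E}
    (hη : η ∉ H) (u : E) : ∃ i : ℕ, u * η ^ i ∈ H := by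
  have : Fact (Nat.Prime 3) := ⟨Nat.prime_three⟩
  have hc : Nat.card (E ⧸ H) = 3 := h
  have h1 : (QuotientGroup.mk η : E ⧸ H) ≠ 1 := by
    rwa [Ne, QuotientGroup.eq_one_iff]
  have h2 := mem_powers_of_prime_card hc h1 (g' := (QuotientGroup.mk u)⁻¹)
  obtain ⟨i, hi⟩ := h2
  refine ⟨i, ?_⟩
  rw [← QuotientGroup.eq_one_iff, QuotientGroup.mk_mul, QuotientGroup.mk_pow]
  have hi' : (QuotientGroup.mk η : E ⧸ H) ^ i = (QuotientGroup.mk u)⁻¹ := hi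
  rw [hi', mul_inv_cancel]

theorem unit_σ_Nm (w : Oˣ) : k.Nm (Units.map (k.σ : O →* O) w : Oˣ) = k.Nm w := by
  change k.Nm (k.σ (w : O)) = _
  simp only [Nm, k.hσ3]; ring

theorem H_norm {H : Subgroup Oˣ}
    (hH : ∀ u, u ∈ H ↔ ∃ t w, IsOfFinOrder t ∧ u * Units.map (k.σ : O →* O) w = t * w)
    {u : Oˣ} (hu : u ∈ H) {i : ℕ} (hi : k.Nm u = k.Z ^ i) : 3 ∣ i := by
  obtain ⟨t, w, ht, h⟩ := (hH u).1 hu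
  have h1 := congrArg (fun x : Oˣ => k.Nm (x : O)) h
  simp only [Units.val_mul, Nm_mul] at h1
  rw [k.unit_σ_Nm] at h1
  have h2 := mul_right_cancel₀ (k.Nm_unit w.isUnit).ne_zero h1
  exact k.Nm_torsion t ht i (by rw [← h2, hi])

/-- in case I the ideal `PP` is not principal (if `m` is prime) -/
theorem caseI_nonprincipal (hU : k.UH) (hm : Prime k.m) (hI : k.CaseI) (γ : O) :
    Ideal.span {γ} ≠ k.PP := by
  intro hγ
  obtain ⟨H, hidx, hH⟩ := hU
  obtain ⟨η, hη, hNη⟩ := hI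
  have hηH : hη.unit ∉ H := by
    intro h
    have := k.H_norm hH h (i := 1) (by rw [pow_one]; exact hNη)
    omega
  have hγ0 : γ ≠ 0 := by
    rintro rfl
    apply k.PP0
    rw [← hγ, Ideal.span_singleton_eq_bot.2 rfl]; rfl
  -- γ = u σ γ
  have h1 : Associated γ (k.σ γ) := by
    rw [← Ideal.span_singleton_eq_span_singleton, ← S_span, hγ, S_PP]
  obtain ⟨u, hu⟩ := h1
  have hNu : k.Nm (u : O) = 1 := by
    have := congrArg k.Nm hu
    rw [Nm_mul] at this
    have h2 : k.Nm (k.σ γ) = k.Nm γ := by simp only [Nm, k.hσ3]; ring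
    rw [h2] at this
    exact mul_left_cancel₀ (k.Nm_ne hγ0) (by rw [this, mul_one])
  -- u ∈ H
  have huH : u ∈ H := by
    obtain ⟨i, hi⟩ := index3_gen H hidx hηH u
    have h3 : 3 ∣ i := by
      apply k.H_norm hH hi
      rw [Units.val_mul, Nm_mul, hNu, one_mul, Units.val_pow_eq_pow_val, Nm_pow]
      change k.Nm η ^ i = _
      rw [hNη]
    obtain ⟨c, rfl⟩ := h3
    have h4 : hη.unit ^ (3 * c) ∈ H := by
      rw [pow_mul]; exact H.pow_mem (index3_pow H hidx _) c
    exact (Subgroup.mul_mem_cancel_right H h4).1 hi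
  obtain ⟨t, w, ht, hw⟩ := (hH u).1 huH
  have hw' : (u : O) * k.σ w = t * w := congrArg (fun x : Oˣ => (x : O)) hw
  obtain ⟨m, hm3, i, hi⟩ := k.torsion_pow t ht
  -- δ = γ w
  have h5 : k.σ (γ * w) = t * (γ * w) := by
    rw [map_mul, ← hu]; linear_combination γ * hw'
  have h6 : k.σ ((γ * w) ^ m) = k.Z ^ i * (γ * w) ^ m := by
    rw [map_pow, h5, mul_pow, hi]
  obtain ⟨r, hr⟩ := k.fix_of_twist h6
  have hr0 : r ≠ 0 := by
    rintro rfl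
    rw [map_zero] at hr
    exact mul_ne_zero (pow_ne_zero _ (mul_ne_zero hγ0 w.ne_zero)) (pow_ne_zero _ k.α0) hr.symm
  have h7 : Ideal.span {ι r} = Ideal.span {ι 1} * (k.PP ^ (m + i) * k.MM ^ i) := by
    rw [map_one, Ideal.span_singleton_one, Ideal.top_mul, hr,
      ← Ideal.span_singleton_mul_span_singleton, ← Ideal.span_singleton_pow,
      ← Ideal.span_singleton_pow, ← Ideal.span_singleton_mul_span_singleton,
      Ideal.span_singleton_eq_top.2 w.isUnit, Ideal.mul_top, hγ, ← k.PPMM]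
    ring
  have h8 : 3 ∣ m + i := k.no_scalar hr0 one_ne_zero h7
  have h9 : 3 ∣ i := by
    apply (k.swap hm).no_scalar (i := i) (j := m + i) hr0 one_ne_zero
    rw [h7, mul_comm (k.PP ^ _)]; rfl
  omega

/-- an element whose twist is `η` cannot be elementary -/
theorem bad {H : Subgroup Oˣ}
    (hH : ∀ u, u ∈ H ↔ ∃ t w, IsOfFinOrder t ∧ u * Units.map (k.σ : O →* O) w = t * w)
    {η : Oˣ} {γ : O} (hγ0 : γ ≠ 0) (hγ : (η : O) * k.σ γ = γ) {g f : R} {l : ℕ}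
    (hg : g ≠ 0) (hf : f ≠ 0)
    (h : Ideal.span {ι g * γ} = Ideal.span {ι f * k.α ^ l}) : η ∈ H := by
  rw [Ideal.span_singleton_eq_span_singleton] at h
  obtain ⟨w, hw⟩ := h
  have hg' : ι g ≠ 0 := fun h => hg (k.ι0.1 h)
  have hf' : ι f ≠ 0 := fun h => hf (k.ι0.1 h)
  have hw2 := congrArg k.σ hw
  rw [map_mul, map_mul, map_mul, map_pow, k.hσR, k.hσR, k.σα, mul_pow, ← pow_mul] at hw2
  have hZu : IsUnit k.Z := IsUnit.of_pow_eq_one k.Z3 (by norm_num)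
  have hZ1 : IsOfFinOrder hZu.unit := by
    rw [isOfFinOrder_iff_pow_eq_one]
    refine ⟨3, by norm_num, ?_⟩
    ext
    exact k.Z3
  refine (hH η).2 ⟨hZu.unit ^ l, w⁻¹, hZ1.pow, ?_⟩
  rw [map_inv, mul_inv_eq_iff_eq_mul, mul_assoc, mul_comm w⁻¹, ← mul_assoc, eq_mul_inv_iff_mul_eq]
  ext
  rw [Units.val_mul, Units.val_mul, Units.val_pow_eq_pow_val]
  change (η : O) * w = k.Z ^ l * k.σ w
  have hσγ : k.σ γ ≠ 0 := by rwa [Ne, EmbeddingLike.map_eq_zero_iff]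
  apply mul_left_cancel₀ (mul_ne_zero hg' hσγ)
  have h3 : k.Z ^ (2 * l) * k.Z ^ l = 1 := by
    rw [← pow_add, show 2 * l + l = 3 * l by ring, pow_mul, k.Z3, one_pow]
  linear_combination ι g * w * hγ + hw - k.Z ^ l * hw2 - ι f * k.α ^ l * h3

theorem caseII (hU : k.UH) (hII : ¬ k.CaseI) :
    Prime k.m ∧ ∃ (c : ℕ) (x w : O), ¬ 3 ∣ c ∧ x ≠ 0 ∧ w ≠ 0 ∧
      Ideal.span {x} = Ideal.span {w} * k.PP ^ c := by
  obtain ⟨H, hidx, hH⟩ := hU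
  have hex : ∃ η : Oˣ, η ∉ H := by
    by_contra hcon
    push Not at hcon
    have : H = ⊤ := by ext x; simp [hcon x]
    rw [this, Subgroup.index_top] at hidx
    norm_num at hidx
  have hneg : ∀ u : Oˣ, u ∉ H → -u ∉ H := by
    intro u hu h
    apply hu
    have h1 : (-1 : Oˣ) ∈ H := by
      have := index3_pow H hidx (-1)
      simpa [pow_succ] using this
    have := H.mul_mem h1 h
    simpa using this
  obtain ⟨η, hη⟩ := hex
  have hex2 : ∃ η : Oˣ, η ∉ H ∧ k.Nm η = 1 := by
    obtain ⟨i, hi | hi⟩ := k.unit_norm η.isUnit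
    · exact ⟨η, hη, k.not_caseI hII η.isUnit hi⟩
    · exact ⟨-η, hneg η hη, by
        rw [Units.val_neg]; exact k.not_caseI hII η.isUnit.neg hi⟩
  obtain ⟨η, hη, hNη⟩ := hex2
  obtain ⟨γ, hγ0, hγ⟩ := k.h90 (x := (η : O)) (w := 1) one_ne_zero (by rw [hNη]; simp [Nm])
  rw [one_mul] at hγ
  have hσγ : k.σ γ ≠ 0 := by rwa [Ne, EmbeddingLike.map_eq_zero_iff]
  have hinv : k.S (Ideal.span {γ}) = Ideal.span {γ} := by
    rw [S_span, Ideal.span_singleton_eq_span_singleton]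
    exact ⟨η, by rw [mul_comm]; exact hγ⟩
  obtain ⟨g, f, i, j, hg, hf, h⟩ := k.invariant (span0 hγ0) hinv
  have hg' : ι g ≠ 0 := fun h => hg (k.ι0.1 h)
  have hf' : ι f ≠ 0 := fun h => hf (k.ι0.1 h)
  rw [Ideal.span_singleton_mul_span_singleton] at h
  rcases k.hm with hm | hm
  · refine ⟨hm, i + 2 * j, ι (k.p ^ j * g) * γ, ι f * k.α ^ j, ?_, ?_, ?_, ?_⟩
    rotate_left
    · refine mul_ne_zero (fun h => ?_) hγ0
      exact mul_ne_zero (pow_ne_zero _ k.hp.ne_zero) hg (k.ι0.1 h)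
    · exact mul_ne_zero hf' (pow_ne_zero _ k.α0)
    · rw [map_mul, mul_assoc, ← Ideal.span_singleton_mul_span_singleton, h, map_pow,
        ← Ideal.span_singleton_pow, ← k.PP3, ← Ideal.span_singleton_mul_span_singleton,
        ← Ideal.span_singleton_pow, ← k.PPMM]
      ring
    · rintro ⟨c, hc⟩
      apply hη
      apply k.bad hH hγ0 hγ (g := k.p ^ j * g) (f := f * k.p ^ c) (l := j)
      · exact mul_ne_zero (pow_ne_zero _ k.hp.ne_zero) hg
      · exact mul_ne_zero hf (pow_ne_zero _ k.hp.ne_zero)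
      · rw [map_mul, mul_assoc, ← Ideal.span_singleton_mul_span_singleton, h, map_pow,
          ← Ideal.span_singleton_pow, ← k.PP3, ← Ideal.span_singleton_mul_span_singleton,
          map_mul, map_pow, ← Ideal.span_singleton_mul_span_singleton, ← Ideal.span_singleton_pow,
          ← k.PP3, ← Ideal.span_singleton_pow, ← k.PPMM]
        have : (k.PP ^ 3) ^ c = k.PP ^ (i + 2 * j) := by rw [← pow_mul, hc]
        rw [this]
        ring
  · exfalso
    apply hη
    apply k.bad hH hγ0 hγ hg hf (l := i)
    rw [h, k.MM_top hm, one_pow, mul_one, ← Ideal.span_singleton_mul_span_singleton,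
      ← Ideal.span_singleton_pow, ← k.PPMM, k.MM_top hm, mul_one]

end UnitsPart

end Kum

section ClassHom
open nonZeroDivisors
variable {O : Type*} [CommRing O] [IsDomain O] [IsDedekindDomain O]

theorem exists_classHom {M : Type*} [CommMonoid M] (f : (Ideal O)⁰ →* M)
    (hf : ∀ I : (Ideal O)⁰, (∃ x : O, x ≠ 0 ∧ (I : Ideal O) = Ideal.span {x}) → f I = 1) :
    ∃ χ : ClassGroup O →* M, ∀ I, χ (ClassGroup.mk0 I) = f I := by
  have key : ∀ I J : (Ideal O)⁰, ClassGroup.mk0 I = ClassGroup.mk0 J → f I = f J := by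
    intro I J h
    obtain ⟨x, y, hx, hy, h⟩ := (ClassGroup.mk0_eq_mk0_iff).1 h
    have hx' : Ideal.span {x} ∈ (Ideal O)⁰ := mem_nonZeroDivisors_of_ne_zero (by simpa using hx)
    have hy' : Ideal.span {y} ∈ (Ideal O)⁰ := mem_nonZeroDivisors_of_ne_zero (by simpa using hy)
    have e : (⟨_, hx'⟩ : (Ideal O)⁰) * I = ⟨_, hy'⟩ * J := Subtype.ext h
    have := congrArg f e
    rwa [map_mul, map_mul, hf ⟨_, hx'⟩ ⟨x, hx, rfl⟩, hf ⟨_, hy'⟩ ⟨y, hy, rfl⟩, one_mul, one_mul] at this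
  let r := Function.surjInv (ClassGroup.mk0_surjective (R := O))
  have hr : ∀ c, ClassGroup.mk0 (r c) = c := Function.surjInv_eq _
  refine ⟨⟨⟨fun c => f (r c), ?_⟩, ?_⟩, ?_⟩
  · rw [key (r 1) 1 (by rw [hr, map_one]), map_one]
  · intro a b
    show f (r (a * b)) = f (r a) * f (r b)
    rw [key (r (a * b)) (r a * r b) (by rw [hr, map_mul, hr, hr]), map_mul]
  · intro I
    exact key _ _ (hr _)

/-- class of an ideal, `1` for zero ideal -/
noncomputable def cls (I : Ideal O) : ClassGroup O := by
  classical
  exact if h : I ≠ 0 then ClassGroup.mk0 ⟨I, mem_nonZeroDivisors_of_ne_zero h⟩ else 1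

theorem cls_of {I : Ideal O} (h : I ≠ 0) :
    cls I = ClassGroup.mk0 ⟨I, mem_nonZeroDivisors_of_ne_zero h⟩ := by unfold cls; rw [dif_pos h]

theorem cls_mul {I J : Ideal O} (hI : I ≠ 0) (hJ : J ≠ 0) : cls (I * J) = cls I * cls J := by
  rw [cls_of hI, cls_of hJ, cls_of (mul_ne_zero hI hJ), ← map_mul]; rfl

theorem cls_span {x : O} (hx : x ≠ 0) : cls (Ideal.span {x}) = 1 := by
  have : Ideal.span {x} ≠ 0 := by simpa using hx
  rw [cls_of this, ClassGroup.mk0_eq_one_iff]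
  exact ⟨⟨x, rfl⟩⟩

theorem cls_one : cls (1 : Ideal O) = 1 := by
  rw [Ideal.one_eq_top, ← Ideal.span_singleton_one]; exact cls_span one_ne_zero

theorem cls_pow {I : Ideal O} (hI : I ≠ 0) (n : ℕ) : cls (I ^ n) = cls I ^ n := by
  induction n with
  | zero => rw [pow_zero, pow_zero, cls_one]
  | succ n ih => rw [pow_succ, cls_mul (pow_ne_zero _ hI) hI, ih, pow_succ]

theorem cls_eq_one {I : Ideal O} (hI : I ≠ 0) (h : cls I = 1) : ∃ x, x ≠ 0 ∧ I = Ideal.span {x} := by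
  rw [cls_of hI, ClassGroup.mk0_eq_one_iff] at h
  obtain ⟨⟨x, hx⟩⟩ := h
  refine ⟨x, ?_, hx⟩
  rintro rfl
  apply hI
  have hx' : I = Ideal.span {0} := hx
  rw [hx']; simp

theorem cls_eq {I J : Ideal O} (hI : I ≠ 0) (hJ : J ≠ 0) (h : cls I = cls J) :
    ∃ x y, x ≠ 0 ∧ y ≠ 0 ∧ Ideal.span {x} * I = Ideal.span {y} * J := by
  rw [cls_of hI, cls_of hJ, ClassGroup.mk0_eq_mk0_iff] at h
  obtain ⟨x, y, hx, hy, h⟩ := h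
  exact ⟨x, y, hx, hy, h⟩

theorem cls_surj (c : ClassGroup O) : ∃ I : Ideal O, I ≠ 0 ∧ cls I = c := by
  obtain ⟨I, rfl⟩ := ClassGroup.mk0_surjective c
  have : (I : Ideal O) ≠ 0 := nonZeroDivisors.coe_ne_zero I
  exact ⟨I, this, by rw [cls_of this]⟩

theorem exists_classHom' {M : Type*} [CommMonoid M] (f : Ideal O → M)
    (h1 : f 1 = 1) (hmul : ∀ I J, I ≠ 0 → J ≠ 0 → f (I * J) = f I * f J)
    (hf : ∀ x : O, x ≠ 0 → f (Ideal.span {x}) = 1) :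
    ∃ χ : ClassGroup O →* M, ∀ I, I ≠ 0 → χ (cls I) = f I := by
  obtain ⟨χ, hχ⟩ := exists_classHom (O := O) (M := M)
    ⟨⟨fun I => f I, h1⟩, fun I J => hmul _ _ (nonZeroDivisors.coe_ne_zero I) (nonZeroDivisors.coe_ne_zero J)⟩
    (by rintro I ⟨x, hx, h⟩
        show f I = 1
        rw [h, hf x hx])
  exact ⟨χ, fun I hI => by rw [cls_of hI, hχ]; rfl⟩

end ClassHom

namespace Kum
section ClassPart

variable {R O : Type*} [CommRing R] [CommRing O] [Algebra R O] [IsDomain R]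
  [IsPrincipalIdealRing R] [IsDomain O] [IsDedekindDomain O] (k : Kum R O)

local notation "ι" => algebraMap R O

theorem exists_s : ∃ s : ClassGroup O →* ClassGroup O, ∀ I, I ≠ 0 → s (cls I) = cls (k.S I) := by
  apply exists_classHom' (fun I => cls (k.S I))
  · show cls (k.S 1) = 1
    rw [k.S_one, cls_one]
  · intro I J hI hJ
    show cls (k.S (I * J)) = cls (k.S I) * cls (k.S J)
    rw [k.S_mul, cls_mul (k.S0 hI) (k.S0 hJ)]
  · intro x hx
    show cls (k.S _) = 1
    rw [k.S_span, cls_span (by simpa using hx)]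

theorem vv_S_zero {Q : Ideal O} (hQ : Prime Q) (h : Q ≠ k.PP) : vv k.PP Q = 0 := by
  rw [vv_eq_zero k.PP_prime hQ.ne_zero]
  intro hle
  apply h
  have hQp := Ideal.isPrime_of_prime hQ
  exact (hQp.isMaximal hQ.ne_zero).eq_of_le k.PP_isPrime.ne_top hle

theorem S_prime {Q : Ideal O} (hQ : Prime Q) : Prime (k.S Q) := by
  have hQp := Ideal.isPrime_of_prime hQ
  have : (k.S Q).IsPrime := by
    unfold S
    exact Ideal.map_isPrime_of_equiv k.σ
  exact Ideal.prime_of_isPrime (k.S0 hQ.ne_zero) this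

theorem norm_prime_aux {Q : Ideal O} (hQ : Prime Q) (h : Q ≠ k.PP) :
    vv k.PP (Q * k.S Q * k.S (k.S Q)) = 0 := by
  have hS : ∀ I : Ideal O, I ≠ k.PP → k.S I ≠ k.PP := by
    intro I hI h'
    apply hI
    rw [← k.S3 I, h', k.S_PP, k.S_PP]
  rw [vv_mul (mul_ne_zero hQ.ne_zero (k.S0 hQ.ne_zero)) (k.S0 (k.S0 hQ.ne_zero)),
    vv_mul hQ.ne_zero (k.S0 hQ.ne_zero), k.vv_S_zero hQ h, k.vv_S_zero (k.S_prime hQ) (hS _ h),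
    k.vv_S_zero (k.S_prime (k.S_prime hQ)) (hS _ (hS _ h))]

theorem norm_prime_dvd {J : Ideal O} (hJ0 : J ≠ 0) (hv : vv k.PP J = 0) {g f : R} {i j : ℕ} (hg : g ≠ 0) (hf : f ≠ 0)
    (h : Ideal.span {ι g} * J = Ideal.span {ι f} * (k.PP ^ i * k.MM ^ j)) : 3 ∣ i := by
  have hg' : ι g ≠ 0 := fun h => hg (k.ι0.1 h)
  have hf' : ι f ≠ 0 := fun h => hf (k.ι0.1 h)
  have e := congrArg (vv k.PP) h
  rw [vv_mul (span0 hg') hJ0, hv, vv_mul (span0 hf') (mul_ne_zero (pow_ne_zero _ k.PP0) (pow_ne_zero _ k.MM0)),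
    vv_mul (pow_ne_zero _ k.PP0) (pow_ne_zero _ k.MM0), vv_pow k.PP0, vv_pow k.MM0, k.vvPM,
    vv_self k.PP_prime] at e
  have h1 := k.vv_ι hg
  have h2 := k.vv_ι hf
  omega

theorem norm_scalar {I : Ideal O} (hI : I ≠ 0) : ∃ g f : R, g ≠ 0 ∧ f ≠ 0 ∧
    Ideal.span {ι g} * (I * k.S I * k.S (k.S I)) = Ideal.span {ι f} := by
  induction I using UniqueFactorizationMonoid.induction_on_prime with
  | h₁ => exact absurd rfl hI
  | h₂ I h =>
    have : I = 1 := by simpa using h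
    subst this
    exact ⟨1, 1, one_ne_zero, one_ne_zero, by rw [k.S_one, k.S_one]; simp⟩
  | h₃ I Q hI0 hQ ih =>
    obtain ⟨g, f, hg, hf, h⟩ := ih hI0
    have : ∃ g f : R, g ≠ 0 ∧ f ≠ 0 ∧
        Ideal.span {ι g} * (Q * k.S Q * k.S (k.S Q)) = Ideal.span {ι f} := by
      by_cases hP : Q = k.PP
      · subst hP
        refine ⟨1, k.p, one_ne_zero, k.hp.ne_zero, ?_⟩
        rw [k.S_PP, k.S_PP, ← k.PP3, map_one, Ideal.span_singleton_one, ← Ideal.one_eq_top]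
        ring
      by_cases hM : Q = k.MM
      · subst hM
        refine ⟨1, k.m, one_ne_zero, k.m0', ?_⟩
        rw [k.S_MM, k.S_MM, ← k.MM3, map_one, Ideal.span_singleton_one, ← Ideal.one_eq_top]
        ring
      have hJ0 : Q * k.S Q * k.S (k.S Q) ≠ 0 :=
        mul_ne_zero (mul_ne_zero hQ.ne_zero (k.S0 hQ.ne_zero)) (k.S0 (k.S0 hQ.ne_zero))
      have hJS : k.S (Q * k.S Q * k.S (k.S Q)) = Q * k.S Q * k.S (k.S Q) := by
        rw [k.S_mul, k.S_mul, k.S3]; ring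
      obtain ⟨g, f, i, j, hg, hf, h⟩ := k.invariant hJ0 hJS
      have hi : 3 ∣ i := k.norm_prime_dvd hJ0 (k.norm_prime_aux hQ hP) hg hf h
      have hj : ∃ b : R, b ≠ 0 ∧ k.MM ^ j = Ideal.span {ι b} := by
        rcases k.hm with hm | hm
        · have hj : 3 ∣ j := by
            refine (k.swap hm).norm_prime_dvd hJ0 ?_ hg hf ?_ (i := j) (j := i)
            · exact (k.swap hm).norm_prime_aux hQ hM
            · rw [h, mul_comm (k.PP ^ i)]; rfl
          obtain ⟨j, rfl⟩ := hj
          exact ⟨k.m ^ j, pow_ne_zero _ k.m0', by rw [pow_mul, k.MM3, map_pow, Ideal.span_singleton_pow]⟩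
        · exact ⟨1, one_ne_zero, by rw [k.MM_top hm]; simp⟩
      obtain ⟨b, hb, hj⟩ := hj
      obtain ⟨i, rfl⟩ := hi
      refine ⟨g, f * (k.p ^ i * b), hg, mul_ne_zero hf (mul_ne_zero (pow_ne_zero _ k.hp.ne_zero) hb), ?_⟩
      rw [h, hj, pow_mul, k.PP3, Ideal.span_singleton_pow, Ideal.span_singleton_mul_span_singleton,
        Ideal.span_singleton_mul_span_singleton, map_mul, map_mul, map_pow]
    obtain ⟨g', f', hg', hf', h'⟩ := this
    refine ⟨g' * g, f' * f, mul_ne_zero hg' hg, mul_ne_zero hf' hf, ?_⟩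
    rw [k.S_mul, k.S_mul, map_mul, map_mul, ← Ideal.span_singleton_mul_span_singleton,
      ← Ideal.span_singleton_mul_span_singleton, ← h, ← h']
    ring

theorem ιne {r : R} (h : r ≠ 0) : (fun _ : Kum R O => ι r ≠ 0) k := fun h' => h (k.ι0.1 h')

theorem s_norm {s : ClassGroup O →* ClassGroup O} (hs : ∀ I, I ≠ 0 → s (cls I) = cls (k.S I))
    (c : ClassGroup O) : c * s c * s (s c) = 1 := by
  obtain ⟨I, hI, rfl⟩ := cls_surj c
  rw [hs I hI, hs _ (k.S0 hI), ← cls_mul hI (k.S0 hI), ← cls_mul (mul_ne_zero hI (k.S0 hI)) (k.S0 (k.S0 hI))]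
  obtain ⟨g, f, hg, hf, h⟩ := k.norm_scalar hI
  have e := congrArg cls h
  rwa [cls_mul (span0 (k.ιne hg)) (mul_ne_zero (mul_ne_zero hI (k.S0 hI)) (k.S0 (k.S0 hI))),
    cls_span (k.ιne hg), cls_span (k.ιne hf), one_mul] at e

theorem Nm_ideal {I : Ideal O} (hI : I ≠ 0) {x w : O}
    (h : Ideal.span {x} * I = Ideal.span {w} * k.S I) : Ideal.span {k.Nm x} = Ideal.span {k.Nm w} := by
  have h1 := congrArg k.S h
  have h2 := congrArg k.S h1
  simp only [k.S_mul, k.S_span, k.S3] at h1 h2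
  have h0 : I * k.S I * k.S (k.S I) ≠ 0 := mul_ne_zero (mul_ne_zero hI (k.S0 hI)) (k.S0 (k.S0 hI))
  apply mul_right_cancel₀ h0
  unfold Nm
  simp only [← Ideal.span_singleton_mul_span_singleton]
  calc _ = (Ideal.span {x} * I) * (Ideal.span {k.σ x} * k.S I) * (Ideal.span {k.σ (k.σ x)} * k.S (k.S I)) := by ring
    _ = _ := by rw [h, h1, h2]; ring

theorem fixrel {I : Ideal O} (hI : I ≠ 0) (h : cls I = cls (k.S I)) :
    ∃ (x w : O) (i : ℕ), x ≠ 0 ∧ w ≠ 0 ∧ Ideal.span {x} * I = Ideal.span {w} * k.S I ∧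
      k.Nm x = k.Z ^ i * k.Nm w := by
  obtain ⟨x, w, hx, hw, h⟩ := cls_eq hI (k.S0 hI) h
  have hN := k.Nm_ideal hI h
  rw [Ideal.span_singleton_eq_span_singleton] at hN
  obtain ⟨u, hu⟩ := hN.symm
  have hu' : k.σ (u : O) = u := by
    have e := congrArg k.σ hu
    have f1 : ∀ x, k.σ (k.Nm x) = k.Nm x := by
      intro x; unfold Nm; rw [map_mul, map_mul, k.hσ3]; ring
    rw [map_mul, f1, f1, ← hu] at e
    exact mul_left_cancel₀ (k.Nm_ne hw) e
  obtain ⟨i, hi | hi⟩ := k.fixed_unit u.isUnit hu'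
  · exact ⟨x, w, i, hx, hw, h, by rw [← hu, hi]; ring⟩
  · refine ⟨-x, w, i, neg_ne_zero.2 hx, hw, by rwa [Ideal.span_singleton_neg], ?_⟩
    rw [k.Nm_neg, ← hu, hi]; ring

/-- keyK in class form -/
theorem keyK_cls {I : Ideal O} (hI : I ≠ 0) {x w : O} (hx : x ≠ 0) (hw : w ≠ 0)
    (h : Ideal.span {x} * I = Ideal.span {w} * k.S I) (hN : k.Nm x = k.Nm w) :
    ∃ i : ℕ, cls I = cls k.PP ^ i := by
  obtain ⟨γ, g, f, i, j, hγ, hg, hf, e⟩ := k.keyK hI hx hw h hN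
  have e := congrArg cls e
  rw [cls_mul (span0 (mul_ne_zero (k.ιne hg) hγ)) hI, cls_span (mul_ne_zero (k.ιne hg) hγ),
    cls_mul (span0 (k.ιne hf)) (mul_ne_zero (pow_ne_zero _ k.PP0) (pow_ne_zero _ k.MM0)), cls_span (k.ιne hf),
    cls_mul (pow_ne_zero _ k.PP0) (pow_ne_zero _ k.MM0), cls_pow k.PP0, cls_pow k.MM0, one_mul, one_mul] at e
  have h1 : cls k.PP * cls k.MM = 1 := by rw [← cls_mul k.PP0 k.MM0, k.PPMM, cls_span k.α0]
  have h3 : cls k.PP ^ 3 = 1 := by rw [← cls_pow k.PP0, k.PP3, cls_span k.p0]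
  have h2 : cls k.MM = cls k.PP ^ 2 := by
    apply mul_left_cancel (a := cls k.PP)
    rw [h1, ← h3, pow_succ']
  exact ⟨i + 2 * j, by rw [e, h2, pow_add, pow_mul]⟩

theorem PP_cls3 : cls k.PP ^ 3 = 1 := by rw [← cls_pow k.PP0, k.PP3, cls_span k.p0]

theorem fix_caseI (hI : k.CaseI) {I : Ideal O} (hI0 : I ≠ 0) (h : cls I = cls (k.S I)) :
    ∃ i : ℕ, cls I = cls k.PP ^ i := by
  obtain ⟨η, hη, hN⟩ := hI
  obtain ⟨x, w, i, hx, hw, e, hN'⟩ := k.fixrel hI0 h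
  have hηi := hη.pow i
  refine k.keyK_cls hI0 hx (mul_ne_zero hw hηi.ne_zero) (w := w * η ^ i) ?_ ?_
  · rw [e, Ideal.span_singleton_mul_right_unit hηi]
  · rw [hN', k.Nm_mul, k.Nm_pow, hN, mul_comm]

theorem fix_caseI' (hI : k.CaseI) (hm : k.m = 1) {I : Ideal O} (hI0 : I ≠ 0) (h : cls I = cls (k.S I)) :
    ∃ x, x ≠ 0 ∧ I = Ideal.span {x} := by
  apply cls_eq_one hI0
  obtain ⟨i, e⟩ := k.fix_caseI hI hI0 h
  have : k.PP = Ideal.span {k.α} := by rw [← k.PPMM, k.MM_top hm, mul_one]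
  rw [e, this, cls_span k.α0, one_pow]

/-- order-3 cyclic subgroup -/
theorem card_zp {G : Type*} [CommGroup G] (P : G → Prop) (g : G) (hg : g ≠ 1) (hg3 : g ^ 3 = 1)
    (h : ∀ c, P c ↔ ∃ i : ℕ, c = g ^ i) : Nat.card {c // P c} = 3 := by
  classical
  have ho : orderOf g = 3 := orderOf_eq_prime hg3 hg
  have hfin : IsOfFinOrder g := isOfFinOrder_iff_pow_eq_one.2 ⟨3, by norm_num, hg3⟩
  rw [← ho, ← Nat.card_zpowers]
  apply Nat.card_congr
  refine Equiv.subtypeEquivRight ?_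
  intro c
  rw [h, hfin.mem_zpowers_iff_mem_range_orderOf, ho]
  constructor
  · rintro ⟨i, rfl⟩
    rw [Finset.mem_image]
    exact ⟨i % 3, Finset.mem_range.2 (Nat.mod_lt _ (by norm_num)), by rw [← ho, pow_mod_orderOf]⟩
  · intro hc
    obtain ⟨i, _, rfl⟩ := Finset.mem_image.1 hc
    exact ⟨i, rfl⟩

/-- Fix analysis -/
theorem fix_main (hU : k.UH) (hm : Prime k.m) {s : ClassGroup O →* ClassGroup O}
    (hs : ∀ I, I ≠ 0 → s (cls I) = cls (k.S I))
    {I0 : Ideal O} (h0 : I0 ≠ 0) {d b : O} (hd : d ≠ 0) (hb : b ≠ 0)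
    (hr : Ideal.span {d} * I0 = Ideal.span {b} * k.S I0) (hN : k.Nm b = k.Z * k.Nm d)
    {T : Type*} [CommMonoid T] (χ : ClassGroup O →* T) (hχ : χ (cls k.PP) = 1) :
    Nat.card {c : ClassGroup O // s c = c} = 3 ∧
      ((∀ c, s c = c → χ c = 1) ↔ χ (cls I0) = 1) := by
  have hfix0 : s (cls I0) = cls I0 := by
    rw [hs _ h0]
    have e := congrArg cls hr
    rw [cls_mul (span0 hd) h0, cls_mul (span0 hb) (k.S0 h0), cls_span hd, cls_span hb, one_mul, one_mul] at e
    exact e.symm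
  by_cases hI : k.CaseI
  · have hP : cls k.PP ≠ 1 := by
      intro h
      obtain ⟨x, _, h⟩ := cls_eq_one k.PP0 h
      exact k.caseI_nonprincipal hU hm hI x h.symm
    have hF : ∀ c, s c = c ↔ ∃ i : ℕ, c = cls k.PP ^ i := by
      intro c
      constructor
      · intro h
        obtain ⟨I, hI0, rfl⟩ := cls_surj c
        exact k.fix_caseI hI hI0 (by rw [← hs I hI0, h])
      · rintro ⟨i, rfl⟩
        rw [map_pow, hs _ k.PP0, k.S_PP]
    have hall : ∀ c, s c = c → χ c = 1 := by
      intro c hc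
      obtain ⟨i, rfl⟩ := (hF c).1 hc
      rw [map_pow, hχ, one_pow]
    exact ⟨card_zp _ _ hP k.PP_cls3 hF, fun h => h _ hfix0, fun _ => hall⟩
  · have hP : cls k.PP = 1 := by
      obtain ⟨_, c, x, w, hc, hx, hw, e⟩ := k.caseII hU hI
      have e := congrArg cls e
      rw [cls_span hx, cls_mul (span0 hw) (pow_ne_zero _ k.PP0), cls_span hw, one_mul, cls_pow k.PP0] at e
      have h3 := k.PP_cls3
      have hd3 := orderOf_dvd_of_pow_eq_one h3
      have hdc := orderOf_dvd_of_pow_eq_one e.symm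
      rcases (Nat.dvd_prime Nat.prime_three).1 hd3 with h | h
      · exact orderOf_eq_one_iff.1 h
      · rw [h] at hdc; exact absurd hdc hc
    have hpow : ∀ i : ℕ, Ideal.span {d ^ i} * I0 ^ i = Ideal.span {b ^ i} * k.S (I0 ^ i) := by
      intro i
      rw [k.S_pow, ← Ideal.span_singleton_pow, ← Ideal.span_singleton_pow, ← mul_pow, ← mul_pow, hr]
    have h3 : cls I0 ^ 3 = 1 := by
      obtain ⟨i, e⟩ := k.keyK_cls (pow_ne_zero 3 h0) (pow_ne_zero 3 hd) (pow_ne_zero 3 hb) (hpow 3)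
        (by rw [k.Nm_pow, k.Nm_pow, hN, mul_pow, k.Z3, one_mul])
      rw [← cls_pow h0, e, hP, one_pow]
    have hne : cls I0 ≠ 1 := by
      intro h
      obtain ⟨γ, hγ, h⟩ := cls_eq_one h0 h
      rw [h, k.S_span, Ideal.span_singleton_mul_span_singleton, Ideal.span_singleton_mul_span_singleton,
        Ideal.span_singleton_eq_span_singleton] at hr
      obtain ⟨u, hu⟩ := hr.symm
      have e := congrArg k.Nm hu
      have f1 : ∀ x, k.Nm (k.σ x) = k.Nm x := by
        intro x; unfold Nm; rw [k.hσ3]; ring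
      rw [k.Nm_mul, k.Nm_mul, k.Nm_mul, f1, hN] at e
      have e2 : k.Z * k.Nm u = 1 := by
        apply mul_left_cancel₀ (mul_ne_zero (k.Nm_ne hd) (k.Nm_ne hγ))
        linear_combination e
      have e3 : k.Nm (u : O) = k.Z ^ 2 := by
        linear_combination k.Z ^ 2 * e2 - k.Nm u * k.Z3
      have e4 := k.not_caseI hI u.isUnit e3
      rw [e4] at e3
      have := k.Zpow_eq_one e3.symm
      omega
    have hF : ∀ c, s c = c ↔ ∃ i : ℕ, c = cls I0 ^ i := by
      intro c
      constructor
      · intro h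
        obtain ⟨I, hI0, rfl⟩ := cls_surj c
        obtain ⟨x, w, i, hx, hw, e, hN'⟩ := k.fixrel hI0 (by rw [← hs I hI0, h])
        obtain ⟨l, e⟩ := k.keyK_cls (mul_ne_zero hI0 (pow_ne_zero i h0)) (mul_ne_zero hx (pow_ne_zero i hd))
          (mul_ne_zero hw (pow_ne_zero i hb)) (by
            rw [k.S_mul, ← Ideal.span_singleton_mul_span_singleton, ← Ideal.span_singleton_mul_span_singleton]
            have := hpow i
            calc _ = (Ideal.span {x} * I) * (Ideal.span {d ^ i} * I0 ^ i) := by ring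
              _ = _ := by rw [e, this]; ring) (by
            rw [k.Nm_mul, k.Nm_mul, k.Nm_pow, k.Nm_pow, hN, hN']; ring)
        rw [hP, one_pow, cls_mul hI0 (pow_ne_zero _ h0), cls_pow h0] at e
        refine ⟨2 * i, ?_⟩
        calc cls I = (cls I * cls I0 ^ i) * cls I0 ^ (2 * i) * ((cls I0 ^ 3) ^ i)⁻¹ := by
                rw [← pow_mul, show 3 * i = i + 2 * i by ring, pow_add]; group
          _ = _ := by rw [e, h3]; simp
      · rintro ⟨i, rfl⟩
        rw [map_pow, hfix0]
    refine ⟨card_zp _ _ hne h3 hF, fun h => h _ hfix0, fun h c hc => ?_⟩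
    obtain ⟨i, rfl⟩ := (hF c).1 hc
    rw [map_pow, h, one_pow]

end ClassPart
end Kum

section Poly
variable {O : Type*} [CommRing O]

/-- the polynomial `d` -/
def dpoly (z a b c : O) : O := z*b^3-c^3+a*b*c*(z^2-z)
/-- the polynomial `B1` -/
def B1poly (z a b c A : O) : O := z*(b^2-a*c)*(A-a)-c*(A^2-a^2+z*b*c)
/-- the polynomial `B2` -/
def B2poly (z a b c A : O) : O := b*(A^2-a^2+z*b*c)-(c^2-z^2*a*b)*(A-a)
/-- the polynomial `n` -/
def npoly (z a b c : O) : O := a^3+z*b^3+z^2*c^3-3*z*a*b*c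

variable {z a b c A : O} (hz : z ^ 2 + z + 1 = 0) (hA : A ^ 3 = npoly z a b c)

theorem poly_d : A * dpoly z a b c = a * dpoly z a b c + b * B1poly z a b c A + c * B2poly z a b c A := by
  unfold dpoly B1poly B2poly; ring

theorem poly_B1 (hz : z ^ 2 + z + 1 = 0) (hA : A ^ 3 = npoly z a b c) :
    A * B1poly z a b c A = z^2*c*dpoly z a b c + z*a*B1poly z a b c A + z*b*B2poly z a b c A := by
  unfold npoly at hA
  unfold dpoly B1poly B2poly
  linear_combination (- c) * hA + (- A * z * a * b^2 + A * a^2 * c - z^2 * a * b * c^2 + z * a^2 * b^2 + 2 * z * a * b * c^2 - z * b^3 * c - a^3 * c) * hz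

theorem poly_B2 (hz : z ^ 2 + z + 1 = 0) (hA : A ^ 3 = npoly z a b c) :
    A * B2poly z a b c A = b*dpoly z a b c + c*B1poly z a b c A + z^2*a*B2poly z a b c A := by
  unfold npoly at hA
  unfold dpoly B1poly B2poly
  linear_combination (b) * hA + (- A * z^2 * a^2 * b + A * z * a^2 * b - A * a^2 * b + A * a * c^2 + z^2 * a^3 * b - z * a^3 * b - z * a * b^2 * c + a^3 * b - a^2 * c^2 + b * c^3) * hz

theorem poly_BsB (hz : z ^ 2 + z + 1 = 0) (hA : A ^ 3 = npoly z a b c) :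
    B1poly z a b c A * B1poly z a b c (z^2*A) = dpoly z a b c * B2poly z a b c A := by
  unfold npoly at hA
  unfold dpoly B1poly B2poly
  linear_combination (A * z^4 * c^2 + z^5 * a * c^2 - z^5 * b^2 * c + z^3 * a * c^2 - z^3 * b^2 * c) * hA + (- A^2 * z^3 * a^2 * c^2 + A^2 * z^3 * a * b^2 * c + A^2 * z^3 * b * c^3 + A^2 * z^2 * a^2 * c^2 - 3 * A^2 * z^2 * a * b^2 * c + A^2 * z^2 * b^4 - A^2 * z^2 * b * c^3 + 2 * A^2 * z * a * b^2 * c - A^2 * z * b^4 - A^2 * a^2 * c^2 + A^2 * b * c^3 + A * z^4 * c^5 - 3 * A * z^3 * a * b * c^3 + A * z^3 * b^3 * c^2 - A * z^3 * c^5 + A * z^2 * a^2 * b^2 * c - A * z^2 * a * b^4 + 4 * A * z^2 * a * b * c^3 - 2 * A * z^2 * b^3 * c^2 - A * z * a^3 * c^2 + A * z * a^2 * b^2 * c - A * z * a * b * c^3 + A * z * b^3 * c^2 + A * z * c^5 - A * c^5 + z^5 * a * c^5 - z^5 * b^2 * c^4 - 3 * z^4 * a^2 * b * c^3 + 4 *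 z^4 * a * b^3 * c^2 - z^4 * a * c^5 - z^4 * b^5 * c + z^4 * b^2 * c^4 + z^3 * a^4 * c^2 - z^3 * a^3 * b^2 * c + 3 * z^3 * a^2 * b * c^3 - 4 * z^3 * a * b^3 * c^2 + z^3 * a * c^5 + z^3 * b^5 * c - z^3 * b^2 * c^4 - z^2 * a^4 * c^2 + 2 * z^2 * a^3 * b^2 * c - 3 * z^2 * a^2 * b * c^3 + 4 * z^2 * a * b^3 * c^2 - z^2 * b^5 * c + z * a^4 * c^2 - 3 * z * a^3 * b^2 * c + z * a^2 * b^4 - z * a * b^3 * c^2 - z * a * c^5 + z * b^2 * c^4 + a^4 * c^2 - a^2 * b * c^3 + a * c^5) * hz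

theorem poly_BsB2 (hz : z ^ 2 + z + 1 = 0) (hA : A ^ 3 = npoly z a b c) :
    B1poly z a b c A * B2poly z a b c (z^2*A) = z * dpoly z a b c ^ 2 := by
  unfold npoly at hA
  unfold dpoly B1poly B2poly
  linear_combination (- A * z^4 * b * c - z^5 * a * b * c + z^5 * b^3 - z^4 * a * b * c + z^2 * c^3) * hA + (- A^2 * z^3 * b^2 * c^2 + A^2 * z^2 * a^2 * b * c + A^2 * z^2 * b^2 * c^2 - A^2 * z * a^2 * b * c + A^2 * z * a * c^3 - A^2 * z * b^2 * c^2 + A^2 * a^2 * b * c - A^2 * a * c^3 - A * z^4 * b * c^4 + A * z^3 * a^3 * b * c - A * z^3 * a^2 * b^3 + 2 * A * z^3 * a * b^2 * c^2 - A * z^3 * b^4 * c + A * z^3 * b * c^4 - A * z^2 * a^3 * b * c + A * z^2 * a^2 * b^3 - 2 * A * z^2 * a * b^2 * c^2 + A * z^2 * b^4 * c + A * z * a^3 * b * c - A * z * a^2 * b^3 - A * z * a^2 * c^3 + A * z * a * b^2 * c^2 - z^5 * a * b * c^4 + z^5 * b^3 * c^3 + 3 * z^4 * a^2 * b^2 *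 c^2 - 4 * z^4 * a * b^4 * c + z^4 * b^6 - z^4 * b^3 * c^3 - z^3 * a^4 * b * c + z^3 * a^3 * b^3 - z^3 * a^2 * b^2 * c^2 + 3 * z^3 * a * b^4 * c + z^3 * a * b * c^4 - z^3 * b^6 - z^2 * a^3 * b^3 - z^2 * a * b^4 * c - z^2 * a * b * c^4 + z^2 * b^3 * c^3 + z^2 * c^6 + z * a^3 * b^3 + z * a^2 * b^2 * c^2 - z * a * b * c^4 - z * c^6 - a^4 * b * c + a^3 * c^3) * hz

end Poly

namespace Kum

/-- the data `a,b,c` -/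
structure Beta {R O : Type*} [CommRing R] [CommRing O] [Algebra R O] (k : Kum R O) where
  a1 : R
  b1 : R
  c1 : R
  hn : npoly k.z (1 + (k.z - 1) * a1) ((k.z - 1) * b1) ((k.z - 1) * c1) = k.p * k.m
  hd : dpoly k.z (1 + (k.z - 1) * a1) ((k.z - 1) * b1) ((k.z - 1) * c1) ≠ 0

section BetaPart

variable {R O : Type*} [CommRing R] [CommRing O] [Algebra R O] [IsDomain R]
  [IsPrincipalIdealRing R] [IsDomain O] [IsDedekindDomain O] {k : Kum R O} (β : Beta k)

local notation "ι" => algebraMap R O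

namespace Beta

/-- a -/
def a : R := 1 + (k.z - 1) * β.a1
/-- b -/
def b : R := (k.z - 1) * β.b1
/-- c -/
def c : R := (k.z - 1) * β.c1
/-- d -/
def d : R := dpoly k.z β.a β.b β.c
/-- B1 -/
def B1 : O := B1poly k.Z (ι β.a) (ι β.b) (ι β.c) k.α
/-- B2 -/
def B2 : O := B2poly k.Z (ι β.a) (ι β.b) (ι β.c) k.α
/-- the ideal -/
def I0 : Ideal O := Ideal.span {ι β.d, β.B1, β.B2}

theorem d_ne : β.d ≠ 0 := β.hd

theorem ιd : ι β.d = dpoly k.Z (ι β.a) (ι β.b) (ι β.c) := by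
  unfold d dpoly Z; simp

theorem hA : k.α ^ 3 = npoly k.Z (ι β.a) (ι β.b) (ι β.c) := by
  rw [k.hα, ← β.hn]
  unfold npoly Z a b c
  simp only [map_sub, map_add, map_mul, map_pow, map_one, map_ofNat]

theorem σB1 : k.σ β.B1 = B1poly k.Z (ι β.a) (ι β.b) (ι β.c) (k.Z ^ 2 * k.α) := by
  unfold B1 B1poly
  simp only [map_sub, map_add, map_mul, map_pow, k.σZ, k.hσR, k.σα]

theorem σB2 : k.σ β.B2 = B2poly k.Z (ι β.a) (ι β.b) (ι β.c) (k.Z ^ 2 * k.α) := by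
  unfold B2 B2poly
  simp only [map_sub, map_add, map_mul, map_pow, k.σZ, k.hσR, k.σα]

theorem αd : k.α * ι β.d = ι β.a * ι β.d + ι β.b * β.B1 + ι β.c * β.B2 := by
  rw [β.ιd]; exact poly_d
theorem αB1 : k.α * β.B1 = k.Z ^ 2 * ι β.c * ι β.d + k.Z * ι β.a * β.B1 + k.Z * ι β.b * β.B2 := by
  rw [β.ιd]; exact poly_B1 k.hZ β.hA
theorem αB2 : k.α * β.B2 = ι β.b * ι β.d + ι β.c * β.B1 + k.Z ^ 2 * ι β.a * β.B2 := by
  rw [β.ιd]; exact poly_B2 k.hZ β.hA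
theorem BsB : β.B1 * k.σ β.B1 = ι β.d * β.B2 := by
  rw [β.ιd, β.σB1]; exact poly_BsB k.hZ β.hA
theorem BsB2 : β.B1 * k.σ β.B2 = k.Z * ι β.d ^ 2 := by
  rw [β.ιd, β.σB2]; exact poly_BsB2 k.hZ β.hA

theorem ιa : ι β.a = 1 + (k.Z - 1) * ι β.a1 := by simp [a, Z]
theorem ιb : ι β.b = (k.Z - 1) * ι β.b1 := by simp [b, Z]
theorem ιc : ι β.c = (k.Z - 1) * ι β.c1 := by simp [c, Z]

theorem yd : k.y * ι β.d = ι β.a1 * ι β.d + ι β.b1 * β.B1 + ι β.c1 * β.B2 := by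
  apply mul_left_cancel₀ k.lam0
  have h := β.αd
  rw [β.ιa, β.ιb, β.ιc] at h
  linear_combination h + ι β.d * k.hy'
theorem yB1 : k.y * β.B1 = ι (k.z ^ 2 * β.c1) * ι β.d + ι (1 + k.z * β.a1) * β.B1 + ι (k.z * β.b1) * β.B2 := by
  apply mul_left_cancel₀ k.lam0
  have h := β.αB1
  rw [β.ιa, β.ιb, β.ιc] at h
  simp only [map_mul, map_add, map_one, map_pow]
  change _ = (k.Z - 1) * (k.Z ^ 2 * _ * _ + (1 + k.Z * _) * _ + k.Z * _ * _)
  linear_combination h + β.B1 * k.hy'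
theorem yB2 : k.y * β.B2 = ι β.b1 * ι β.d + ι β.c1 * β.B1 + ι (k.z + 1 + k.z ^ 2 * β.a1) * β.B2 := by
  apply mul_left_cancel₀ k.lam0
  have h := β.αB2
  rw [β.ιa, β.ιb, β.ιc] at h
  simp only [map_mul, map_add, map_one, map_pow]
  change _ = (k.Z - 1) * (_ + _ + (k.Z + 1 + k.Z ^ 2 * _) * _)
  linear_combination h + β.B2 * k.hy'

theorem ιd_ne : ι β.d ≠ 0 := k.ιne β.d_ne

theorem NmB1 : k.Nm β.B1 = k.Z * k.Nm (ι β.d) := by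
  have h1 := β.BsB
  have h2 := congrArg k.σ β.BsB
  have h3 := β.BsB2
  rw [map_mul, map_mul, k.hσR] at h2
  apply mul_left_cancel₀ β.ιd_ne
  have h4 : ι β.d * (β.B1 * k.σ β.B2) = ι β.d * (k.Z * ι β.d ^ 2) := by rw [h3]
  rw [k.Nm_ι]
  by_cases hB : k.σ β.B1 = 0
  · rw [hB, mul_zero] at h1
    have hB2 : β.B2 = 0 := by
      rcases mul_eq_zero.1 h1.symm with h | h
      · exact absurd h β.ιd_ne
      · exact h
    rw [hB2, map_zero, mul_zero] at h3
    have : k.Z * ι β.d ^ 2 ≠ 0 := mul_ne_zero (fun h => by have := k.Z3; rw [h] at this; norm_num at this) (pow_ne_zero _ β.ιd_ne)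
    exact absurd h3.symm this
  · unfold Nm
    linear_combination ι β.d * β.B1 * h2 + ι β.d ^ 2 * h3

theorem B1_ne : β.B1 ≠ 0 := by
  intro h
  have := β.NmB1
  rw [h] at this
  have h0 : k.Nm (0 : O) = 0 := by simp [Nm]
  rw [h0] at this
  have hZ0 : k.Z ≠ 0 := fun h => by have := k.Z3; rw [h] at this; norm_num at this
  exact mul_ne_zero hZ0 (k.Nm_ne β.ιd_ne) this.symm

theorem I0_ne : β.I0 ≠ 0 := by
  intro h
  have : ι β.d ∈ β.I0 := Ideal.subset_span (by simp)
  rw [h] at this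
  exact β.ιd_ne (by simpa using this)

theorem I0_rel : Ideal.span {ι β.d} * β.I0 = Ideal.span {β.B1} * k.S β.I0 := by
  have hS : k.S β.I0 = Ideal.span {ι β.d, k.σ β.B1, k.σ β.B2} := by
    unfold S I0
    rw [Ideal.map_span]
    congr 1
    simp [Set.image_insert_eq, k.hσR]
  rw [hS, I0, Ideal.span_mul_span', Ideal.span_mul_span']
  simp only [Set.singleton_mul, Set.image_insert_eq, Set.image_singleton]
  rw [β.BsB, β.BsB2]
  apply le_antisymm
  · rw [Ideal.span_le]
    rintro x (rfl | rfl | rfl)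
    · have : ι β.d * ι β.d = k.Z ^ 2 * (k.Z * ι β.d ^ 2) := by linear_combination - ι β.d ^ 2 * k.Z3
      rw [this]
      exact Ideal.mul_mem_left _ _ (Ideal.subset_span (by simp))
    · rw [mul_comm]; exact Ideal.subset_span (by simp)
    · exact Ideal.subset_span (by simp)
  · rw [Ideal.span_le]
    rintro x (rfl | rfl | rfl)
    · rw [mul_comm β.B1 (ι β.d)]; exact Ideal.subset_span (by simp)
    · exact Ideal.subset_span (by simp)
    · have : k.Z * ι β.d ^ 2 = k.Z * (ι β.d * ι β.d) := by ring
      rw [this]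
      exact Ideal.mul_mem_left _ _ (Ideal.subset_span (by simp))

theorem Nm_σ_mem_PP {x : O} (h : k.Nm x ∈ k.PP) : x ∈ k.PP := by
  have := k.PP_isPrime
  have hS : ∀ x, k.σ x ∈ k.PP → x ∈ k.PP := by
    intro x hx
    have h1 := k.σmem k.S_PP (k.σmem k.S_PP hx)
    rwa [k.hσ3] at h1
  unfold Nm at h
  rcases this.mem_or_mem h with h | h
  · rcases this.mem_or_mem h with h | h
    · exact h
    · exact hS _ h
  · exact hS _ (hS _ h)

/-- norms are cubes modulo `p` -/
theorem cube_mod (k : Kum R O) {w : O} (hw : w ∉ k.PP) {g : R} (hg : ι g = k.Nm w) :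
    ¬ k.p ∣ g ∧ ∃ c r : R, ¬ k.p ∣ c ∧ k.p ∣ c ^ 3 * g - r ^ 3 := by
  have hg' : ¬ k.p ∣ g := by
    intro h
    rw [← k.ι_mem_PP, hg] at h
    exact hw (Nm_σ_mem_PP h)
  refine ⟨hg', ?_⟩
  obtain ⟨r, v, h⟩ := k.scalar_mod' w
  refine ⟨(k.z - 1) ^ 2 * k.m, r, ?_, ?_⟩
  · intro h'
    obtain ⟨x, y, e⟩ := k.copc
    exact k.hp.not_unit (isUnit_of_dvd_one (e ▸ dvd_add (Dvd.dvd.mul_left h' _) (Dvd.intro_left _ rfl)))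
  · rw [← k.ι_mem_PP, map_sub, map_mul, map_pow, map_pow, hg, ← k.Nm_ι, ← k.Nm_mul, h]
    unfold Nm
    simp only [map_add, map_mul, k.hσR, k.σα, k.σZ, map_pow]
    have : (ι r + k.α * v) * (ι r + k.Z ^ 2 * k.α * k.σ v) * (ι r + k.Z ^ 2 * (k.Z ^ 2 * k.α) * k.σ (k.σ v)) - ι r ^ 3
      = k.α * (v * (ι r + k.Z ^ 2 * k.α * k.σ v) * (ι r + k.Z ^ 2 * (k.Z ^ 2 * k.α) * k.σ (k.σ v))
        + ι r * (k.Z ^ 2 * k.σ v) * (ι r + k.Z ^ 2 * (k.Z ^ 2 * k.α) * k.σ (k.σ v))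
        + ι r ^ 2 * (k.Z ^ 2 * k.Z ^ 2 * k.σ (k.σ v))) := by ring
    rw [this]
    exact Ideal.mul_mem_right _ _ k.α_mem_PP

/-- elements of `R[y]` -/
theorem α2O (k : Kum R O) (w : O) : ∃ v : Fin 3 → R, k.α ^ 2 * w = ι (v 0) + ι (v 1) * k.y + ι (v 2) * k.y ^ 2 := by
  have h := k.interp w
  obtain ⟨t0, h0⟩ := k.Tr_fix w
  obtain ⟨t1, h1⟩ := k.Tr_fix (w * (k.σ k.y + k.σ (k.σ k.y)))
  obtain ⟨t2, h2⟩ := k.Tr_fix (w * (k.σ k.y * k.σ (k.σ k.y)))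
  rw [← h0, ← h1, ← h2] at h
  refine ⟨![-k.z * t2, k.z * t1, - k.z * t0], ?_⟩
  simp only [Matrix.cons_val, map_mul, map_neg]
  change _ = - k.Z * _ + k.Z * _ * _ + - k.Z * _ * _
  linear_combination - k.Z * h - k.α ^ 2 * w * k.Z3

/-- the vector `(d, B1, B2)` -/
def Bv : Fin 3 → O := ![ι β.d, β.B1, β.B2]
/-- the vector `(1, y, y²)` -/
def Yv (k : Kum R O) : Fin 3 → O := ![1, k.y, k.y ^ 2]

/-- R-span of a vector -/
def InSpan (v : Fin 3 → O) (x : O) : Prop := ∃ r : Fin 3 → R, x = ι (r 0) * v 0 + ι (r 1) * v 1 + ι (r 2) * v 2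

theorem InSpan.add {v : Fin 3 → O} {x w : O} (hx : InSpan (R := R) v x) (hw : InSpan (R := R) v w) :
    InSpan (R := R) v (x + w) := by
  obtain ⟨r, rfl⟩ := hx
  obtain ⟨t, rfl⟩ := hw
  exact ⟨r + t, by simp only [Pi.add_apply, map_add]; ring⟩
theorem InSpan.smul {v : Fin 3 → O} {x : O} (hx : InSpan (R := R) v x) (t : R) :
    InSpan (R := R) v (ι t * x) := by
  obtain ⟨r, rfl⟩ := hx
  exact ⟨fun i => t * r i, by simp only [map_mul]; ring⟩
theorem InSpan.self {v : Fin 3 → O} (i : Fin 3) : InSpan (R := R) v (v i) := by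
  refine ⟨Pi.single i 1, ?_⟩
  fin_cases i <;> simp

theorem InSpan_y {x : O} (hx : InSpan (R := R) β.Bv x) : InSpan (R := R) β.Bv (k.y * x) := by
  obtain ⟨r, rfl⟩ := hx
  have h0 : InSpan (R := R) β.Bv (k.y * ι β.d) := ⟨![_, _, _], β.yd⟩
  have h1 : InSpan (R := R) β.Bv (k.y * β.B1) := ⟨![_, _, _], β.yB1⟩
  have h2 : InSpan (R := R) β.Bv (k.y * β.B2) := ⟨![_, _, _], β.yB2⟩
  have := ((h0.smul (r 0)).add (h1.smul (r 1))).add (h2.smul (r 2))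
  convert this using 1
  simp only [Bv, Matrix.cons_val]
  ring

/-- `α² I0 ⊆ Λ0` -/
theorem α2I0 {x : O} (hx : x ∈ β.I0) : InSpan (R := R) β.Bv (k.α ^ 2 * x) := by
  have key : ∀ w v : O, InSpan (R := R) β.Bv v → InSpan (R := R) β.Bv (k.α ^ 2 * w * v) := by
    intro w v hv
    obtain ⟨r, hr⟩ := α2O k w
    have := ((hv.smul (r 0)).add ((β.InSpan_y hv).smul (r 1))).add ((β.InSpan_y (β.InSpan_y hv)).smul (r 2))
    convert this using 1
    rw [hr]; ring
  rw [I0, Ideal.mem_span_insert] at hx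
  obtain ⟨u0, v, hv, rfl⟩ := hx
  rw [Ideal.mem_span_pair] at hv
  obtain ⟨u1, u2, rfl⟩ := hv
  have := ((key u0 _ (InSpan.self 0)).add (key u1 _ (InSpan.self 1))).add (key u2 _ (InSpan.self 2))
  convert this using 1
  simp only [Bv, Matrix.cons_val]
  ring

theorem Λ_le_I0 {x : O} (hx : InSpan (R := R) β.Bv x) : x ∈ β.I0 := by
  obtain ⟨r, rfl⟩ := hx
  refine Ideal.add_mem _ (Ideal.add_mem _ ?_ ?_) ?_ <;>
  exact Ideal.mul_mem_left _ _ (Ideal.subset_span (by simp [Bv]))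

/-- matrix of `Bv` with respect to `Yv` -/
def QQ : Matrix (Fin 3) (Fin 3) R :=
  !![β.d, k.z*(β.b^2-β.a*β.c)*(1-β.a)-β.c*(1-β.a^2+k.z*β.b*β.c), β.b*(1-β.a^2+k.z*β.b*β.c)-(β.c^2-k.z^2*β.a*β.b)*(1-β.a);
     0, (k.z-1)*(k.z*(β.b^2-β.a*β.c)-2*β.c), (k.z-1)*(2*β.b-(β.c^2-k.z^2*β.a*β.b));
     0, -β.c*(k.z-1)^2, β.b*(k.z-1)^2]

theorem det_QQ : β.QQ.det = (k.z - 1) ^ 3 * β.d ^ 2 := by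
  unfold QQ
  rw [Matrix.det_fin_three]
  simp only [Matrix.of_apply, Matrix.cons_val', Matrix.cons_val, Matrix.cons_val_zero, Matrix.cons_val_one, Matrix.cons_val_fin_one]
  unfold d dpoly
  ring

/-- conjugate matrix -/
def VV (k : Kum R O) (v : Fin 3 → O) : Matrix (Fin 3) (Fin 3) O :=
  !![v 0, v 1, v 2; k.σ (v 0), k.σ (v 1), k.σ (v 2); k.σ (k.σ (v 0)), k.σ (k.σ (v 1)), k.σ (k.σ (v 2))]

theorem Bv_QQ (j : Fin 3) : β.Bv j = ∑ i, ι (β.QQ i j) * Yv k i := by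
  have hy : k.α = 1 + (k.Z - 1) * k.y := by linear_combination - k.hy'
  fin_cases j
  · simp [Bv, Fin.sum_univ_three, QQ, Yv]
  · simp only [Bv, Fin.sum_univ_three, QQ, Yv, Matrix.of_apply, Matrix.cons_val', Matrix.cons_val, Matrix.cons_val_zero, Matrix.cons_val_one, Matrix.cons_val_fin_one, Fin.mk_one, Fin.isValue, B1, B1poly]
    simp only [map_sub, map_add, map_mul, map_pow, map_one, map_neg, map_ofNat]
    rw [hy]
    change _ = (k.Z * _ * _ - _ * (_ + k.Z * _ * _)) * _ + (k.Z - 1) * (k.Z * _ - _) * _ + - _ * (k.Z - 1) ^ 2 * _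
    ring
  · simp only [Bv, Fin.sum_univ_three, QQ, Yv, Matrix.of_apply, Matrix.cons_val', Matrix.cons_val, Matrix.cons_val_zero, Matrix.cons_val_one, Matrix.cons_val_fin_one, Fin.reduceFinMk, Fin.isValue, B2, B2poly]
    simp only [map_sub, map_add, map_mul, map_pow, map_one, map_neg, map_ofNat]
    rw [hy]
    change _ = (_ * (_ + k.Z * _ * _) - (_ - k.Z ^ 2 * _ * _) * _) * _ + (k.Z - 1) * (_ - (_ - k.Z ^ 2 * _ * _)) * _ + _ * (k.Z - 1) ^ 2 * _
    ring

theorem VV_mul (k : Kum R O) {v w : Fin 3 → O} (M : Matrix (Fin 3) (Fin 3) R)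
    (h : ∀ j, w j = ∑ i, ι (M i j) * v i) : (VV k w).det = (VV k v).det * ι M.det := by
  have : VV k w = VV k v * M.map ι := by
    ext i j
    rw [Matrix.mul_apply, Fin.sum_univ_three]
    fin_cases i <;> fin_cases j <;>
      simp [VV, h, Fin.sum_univ_three, k.hσR] <;> ring
  rw [this, Matrix.det_mul]
  congr 1
  exact (RingHom.map_det ι M).symm

theorem VV_smul (k : Kum R O) (γ : O) (v : Fin 3 → O) : (VV k (fun i => γ * v i)).det = k.Nm γ * (VV k v).det := by
  rw [Matrix.det_fin_three, Matrix.det_fin_three]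
  simp [VV, Nm]
  ring

theorem VV_Y (k : Kum R O) : (VV k (Yv k)).det ≠ 0 := by
  have h1 := k.σy
  have h2 := k.σσy
  have : (VV k (Yv k)).det = (k.y - k.σ k.y) * (k.y - k.σ (k.σ k.y)) * (k.σ k.y - k.σ (k.σ k.y)) * (-1) := by
    rw [Matrix.det_fin_three]
    simp [VV, Yv]
    ring
  have h3 : k.σ k.y - k.σ (k.σ k.y) = k.Z * k.α := by linear_combination h2 - h1 - k.α * k.hZ
  rw [this, h1, h2, h3]
  have hZ0 : k.Z ≠ 0 := fun h => by have := k.Z3; rw [h] at this; norm_num at this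
  have := k.α0
  simp [hZ0, this]

theorem InSpan.mat {v w : Fin 3 → O} (h : ∀ j, InSpan (R := R) v (w j)) :
    ∃ M : Matrix (Fin 3) (Fin 3) R, ∀ j, w j = ∑ i, ι (M i j) * v i := by
  choose r hr using h
  exact ⟨fun i j => r j i, fun j => by rw [hr j, Fin.sum_univ_three]⟩

/-- principal `I0` forces a norm relation -/
theorem norm_rel {γ : O} (h : β.I0 = Ideal.span {γ}) : ∃ g e1 e2 : R, ι g = k.Nm γ ∧
    (k.p * k.m) ^ 2 * ((k.z - 1) ^ 3 * β.d ^ 2) = g * e1 ∧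
    (k.p * k.m) ^ 2 * g = ((k.z - 1) ^ 3 * β.d ^ 2) * e2 := by
  obtain ⟨g, hg⟩ := k.Nm_fix γ
  have hVB := VV_mul k β.QQ β.Bv_QQ
  rw [β.det_QQ] at hVB
  have hY := VV_Y k
  have hα2 : k.Nm (k.α ^ 2) = ι ((k.p * k.m) ^ 2) := by rw [k.Nm_pow, k.Nm_α, map_pow]
  -- first
  have A1 : ∃ M : Matrix (Fin 3) (Fin 3) R, ∀ j, (fun i => k.α ^ 2 * β.Bv i) j = ∑ i, ι (M i j) * (fun i => γ * Yv k i) i := by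
    apply InSpan.mat
    intro j
    have hj : β.Bv j ∈ β.I0 := β.Λ_le_I0 (InSpan.self j)
    rw [h, Ideal.mem_span_singleton'] at hj
    obtain ⟨w, hw⟩ := hj
    obtain ⟨v, hv⟩ := α2O k w
    refine ⟨v, ?_⟩
    rw [← hw, ← mul_assoc, hv]
    simp [Yv]
    ring
  have A2 : ∃ M : Matrix (Fin 3) (Fin 3) R, ∀ j, (fun i => (k.α ^ 2 * γ) * Yv k i) j = ∑ i, ι (M i j) * β.Bv i := by
    apply InSpan.mat
    intro j
    rw [mul_assoc]
    apply β.α2I0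
    rw [h]
    exact Ideal.mul_mem_right _ _ (Ideal.mem_span_singleton_self _)
  obtain ⟨M1, h1⟩ := A1
  obtain ⟨M2, h2⟩ := A2
  have e1 := VV_mul k M1 h1
  have e2 := VV_mul k M2 h2
  rw [VV_smul, VV_smul, hVB, hα2, ← hg] at e1
  rw [VV_smul, k.Nm_mul, hVB, hα2, ← hg] at e2
  refine ⟨g, M1.det, M2.det, hg, ?_, ?_⟩
  · apply k.hinj
    apply mul_left_cancel₀ hY
    rw [map_mul _ _ ((k.z - 1) ^ 3 * β.d ^ 2), map_mul _ g]
    linear_combination e1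
  · apply k.hinj
    apply mul_left_cancel₀ hY
    rw [map_mul _ _ g, map_mul _ _ M2.det]
    linear_combination e2

/-- in the case `m = 1`: `d² λ³` is a norm up to unit -/
theorem L'_result (hU : k.UH) (hm : k.m = 1) (hpd : ¬ k.p ∣ β.d) :
    ∃ c r u : R, ¬ k.p ∣ c ∧ IsUnit u ∧ k.p ∣ c ^ 3 * ((k.z - 1) ^ 3 * β.d ^ 2 * u) - r ^ 3 := by
  have hI : k.CaseI := by
    by_contra hI
    have := (k.caseII hU hI).1
    rw [hm] at this
    exact this.not_unit isUnit_one
  have hfix : cls β.I0 = cls (k.S β.I0) := by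
    have e := congrArg cls β.I0_rel
    rwa [cls_mul (span0 β.ιd_ne) β.I0_ne, cls_mul (span0 β.B1_ne) (k.S0 β.I0_ne), cls_span β.ιd_ne,
      cls_span β.B1_ne, one_mul, one_mul] at e
  obtain ⟨γ, hγ, h⟩ := k.fix_caseI' hI hm β.I0_ne hfix
  obtain ⟨g, e1, e2, hg, h1, h2⟩ := β.norm_rel h
  rw [hm, mul_one] at h1 h2
  have hg0 : g ≠ 0 := by
    rintro rfl
    rw [map_zero] at hg
    exact k.Nm_ne hγ hg.symm
  have hp2 : k.p ^ 4 = e1 * e2 := by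
    apply mul_left_cancel₀ hg0
    apply mul_left_cancel₀ (mul_ne_zero (pow_ne_zero 3 (show k.z - 1 ≠ 0 from ?_)) (pow_ne_zero 2 β.d_ne))
    · linear_combination k.p ^ 2 * g * h1 + g * e1 * h2
    · intro h
      apply k.lam0
      have := congrArg ι h
      simpa [Z] using this
  have : e2 ∣ k.p ^ 4 := ⟨e1, by rw [hp2]; ring⟩
  obtain ⟨j, _, hj⟩ := (dvd_prime_pow k.hp _).1 this
  obtain ⟨u, hu⟩ := hj.symm
  -- γ = α^i γ1
  have hPP : k.PP = Ideal.span {k.α} := by rw [← k.PPMM, k.MM_top hm, mul_one]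
  have hfin : FiniteMultiplicity k.α γ := by
    apply FiniteMultiplicity.of_not_isUnit _ hγ
    intro hu
    have := k.PP_isPrime.ne_top
    rw [hPP, Ne, Ideal.span_singleton_eq_top] at this
    exact this hu
  obtain ⟨γ1, hγ1, hn⟩ := hfin.exists_eq_pow_mul_and_not_dvd
  set i := multiplicity k.α γ
  have hγ1' : γ1 ∉ k.PP := by rwa [hPP, Ideal.mem_span_singleton]
  obtain ⟨g1, hg1⟩ := k.Nm_fix γ1
  obtain ⟨hg1p, c, r, hc, hcr⟩ := cube_mod k hγ1' hg1
  have hgg : g = k.p ^ i * g1 := by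
    apply k.hinj
    rw [hg, hγ1, k.Nm_mul, k.Nm_pow, k.Nm_α, hm, mul_one, map_mul, map_pow, hg1]
  rw [hgg, ← hu] at h2
  have hlam : ¬ k.p ∣ (k.z - 1) ^ 3 * β.d ^ 2 * (u : R) := by
    intro h
    rcases k.hp.dvd_or_dvd h with h | h
    · rcases k.hp.dvd_or_dvd h with h | h
      · have h' := k.hp.dvd_of_dvd_pow h
        obtain ⟨x, y, e⟩ := k.copc
        exact k.hp.not_unit (isUnit_of_dvd_one (e ▸ dvd_add (Dvd.dvd.mul_left (Dvd.dvd.mul_right (dvd_pow h' (by norm_num)) _) _) (Dvd.intro_left _ rfl)))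
      · exact hpd (k.hp.dvd_of_dvd_pow h)
    · exact k.hp.not_unit (isUnit_of_dvd_unit h u.isUnit)
  have h3 : k.p ^ (2 + i) * g1 = k.p ^ j * ((k.z - 1) ^ 3 * β.d ^ 2 * (u : R)) := by
    rw [pow_add]; linear_combination h2
  have hij : 2 + i = j := by
    have m1 := k.hp.1
    rcases lt_trichotomy (2 + i) j with hl | hl | hl
    · exfalso
      obtain ⟨t, rfl⟩ := Nat.exists_eq_add_of_lt hl
      apply hg1p
      refine ⟨k.p ^ t * ((k.z - 1) ^ 3 * β.d ^ 2 * (u : R)), ?_⟩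
      apply mul_left_cancel₀ (pow_ne_zero (2 + i) m1)
      rw [h3]; ring
    · exact hl
    · exfalso
      obtain ⟨t, ht⟩ := Nat.exists_eq_add_of_lt hl
      apply hlam
      refine ⟨k.p ^ t * g1, ?_⟩
      apply mul_left_cancel₀ (pow_ne_zero j m1)
      rw [← h3, ht]; ring
  rw [hij] at h3
  have h4 := mul_left_cancel₀ (pow_ne_zero j k.hp.1) h3
  exact ⟨c, r, u, hc, u.isUnit, by rw [← h4]; exact hcr⟩

end Beta
end BetaPart
end Kum

namespace Kum

/-- data for the character -/
structure Chr {R O : Type*} [CommRing R] [CommRing O] [Algebra R O] [IsDomain R]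
    [IsPrincipalIdealRing R] [IsDomain O] [IsDedekindDomain O]
    [Module.Free ℤ R] [Module.Free ℤ O] (k : Kum R O) (N : ℕ) where
  hN : N.Prime
  hmod : 3 ∣ N - 1
  hm : Prime k.m
  φ : R →+* ZMod N
  φ' : R →+* ZMod N
  hk : ∀ a, φ a = 0 ↔ k.p ∣ a
  hk' : ∀ a, φ' a = 0 ↔ k.m ∣ a
  hsw : φ k.m = φ' k.p
  hφ : ∀ a, φ a * φ' a = (Ideal.absNorm (Ideal.span {a}) : ZMod N)
  hpN : Ideal.absNorm (Ideal.span {k.p}) = N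
  hmN : Ideal.absNorm (Ideal.span {k.m}) = N
  hO : ∀ a, Ideal.absNorm (Ideal.span {algebraMap R O a}) = Ideal.absNorm (Ideal.span {a}) ^ 3

section ChrPart

variable {R O : Type*} [CommRing R] [CommRing O] [Algebra R O] [IsDomain R]
  [IsPrincipalIdealRing R] [IsDomain O] [IsDedekindDomain O]
  [Module.Free ℤ R] [Module.Free ℤ O] [Module.Finite ℤ R] [Module.Finite ℤ O] {k : Kum R O}

local notation "ι" => algebraMap R O

theorem desc (k : Kum R O) {γ : O} (hγ : γ ≠ 0) : ∃ (i : ℕ) (w : O), w ∉ k.PP ∧ ι (k.p ^ i) * w = γ * k.α ^ (2 * i) := by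
  have hfin : FiniteMultiplicity k.PP (Ideal.span {γ}) :=
    FiniteMultiplicity.of_not_isUnit k.PP_prime.not_unit (span0 hγ)
  obtain ⟨J, hJ, hn⟩ := hfin.exists_eq_pow_mul_and_not_dvd
  set i := multiplicity k.PP (Ideal.span {γ})
  have h1 : Ideal.span {γ * k.α ^ (2 * i)} = Ideal.span {ι (k.p ^ i)} * (J * k.MM ^ (2 * i)) := by
    rw [← Ideal.span_singleton_mul_span_singleton, ← Ideal.span_singleton_pow, ← k.PPMM, hJ, map_pow,
      ← Ideal.span_singleton_pow, ← k.PP3]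
    ring
  have h2 : Ideal.span {γ * k.α ^ (2 * i)} ≤ Ideal.span {ι (k.p ^ i)} := by
    rw [h1]; exact Ideal.dvd_iff_le.1 (Dvd.intro _ rfl)
  rw [Ideal.span_singleton_le_span_singleton] at h2
  obtain ⟨w, hw⟩ := h2
  refine ⟨i, w, ?_, hw.symm⟩
  rw [hw, ← Ideal.span_singleton_mul_span_singleton] at h1
  have h3 := mul_left_cancel₀ (span0 (k.ιne (pow_ne_zero _ k.hp.ne_zero))) h1
  intro hwP
  have h4 : k.PP ∣ J * k.MM ^ (2 * i) := by
    rw [← h3, Ideal.dvd_span_singleton]; exact hwP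
  rcases k.PP_prime.dvd_or_dvd h4 with h | h
  · exact hn h
  · have h5 := k.PP_prime.dvd_of_dvd_pow h
    exact (vv_eq_zero k.PP_prime k.MM0).1 k.vvPM (Ideal.dvd_iff_le.1 h5)

theorem desc_norm (k : Kum R O) {γ : O} (hγ : γ ≠ 0) {a : R} (ha : ι a = k.Nm γ) :
    ∃ (i : ℕ) (g : R), k.p ^ i * g = a * k.m ^ (2 * i) ∧ ¬ k.p ∣ g ∧ ∃ c r : R, ¬ k.p ∣ c ∧ k.p ∣ c ^ 3 * g - r ^ 3 := by
  obtain ⟨i, w, hw, h⟩ := k.desc hγ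
  obtain ⟨g, hg⟩ := k.Nm_fix w
  obtain ⟨h1, h2⟩ := Beta.cube_mod k hw hg
  refine ⟨i, g, ?_, h1, h2⟩
  apply mul_left_cancel₀ (pow_ne_zero (2 * i) k.hp.ne_zero)
  have e := congrArg k.Nm h
  rw [k.Nm_mul, k.Nm_mul, k.Nm_pow, k.Nm_α, k.Nm_ι, ← ha, ← hg, ← map_pow, ← map_pow, ← map_mul, ← map_mul] at e
  have e := k.hinj e
  rw [mul_pow] at e
  linear_combination e

theorem absNorm_S (k : Kum R O) (I : Ideal O) : Ideal.absNorm (k.S I) = Ideal.absNorm I := by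
  rw [Ideal.absNorm_apply, Ideal.absNorm_apply, Submodule.cardQuot_apply, Submodule.cardQuot_apply]
  exact (Nat.card_congr (Ideal.quotientEquiv I (k.S I) k.σ rfl).toEquiv).symm

namespace Chr

variable {N : ℕ} (X : Chr k N)

/-- cubic residue symbol -/
def κ (N : ℕ) (x : ZMod N) : ZMod N := x ^ ((N - 1) / 3)

theorem κ_cube (X : Chr k N) {x c r : ZMod N} (hx : x ≠ 0) (hc : c ≠ 0) (h : c ^ 3 * x = r ^ 3) : κ N x = 1 := by
  haveI := Fact.mk X.hN
  obtain ⟨t, ht⟩ := X.hmod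
  have h3 : (N - 1) / 3 = t := by omega
  have hr : r ≠ 0 := by
    rintro rfl
    have : c ^ 3 * x ≠ 0 := mul_ne_zero (pow_ne_zero _ hc) hx
    apply this; rw [h]; ring
  have e := congrArg (· ^ t) h
  simp only [mul_pow, ← pow_mul] at e
  rw [← ht, ZMod.pow_card_sub_one_eq_one hc, ZMod.pow_card_sub_one_eq_one hr, one_mul] at e
  rw [κ, h3, e]

theorem κ_three (X : Chr k N) {x : ZMod N} (hx : x ≠ 0) : κ N x ^ 3 = 1 := by
  haveI := Fact.mk X.hN
  obtain ⟨t, ht⟩ := X.hmod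
  have h3 : (N - 1) / 3 = t := by omega
  rw [κ, h3, ← pow_mul, mul_comm, ← ht, ZMod.pow_card_sub_one_eq_one hx]

theorem κ_mul (x w : ZMod N) : κ N (x * w) = κ N x * κ N w := mul_pow _ _ _
theorem κ_pow (x : ZMod N) (n : ℕ) : κ N (x ^ n) = κ N x ^ n := by
  rw [κ, κ, ← pow_mul, ← pow_mul, mul_comm]
theorem κ_one : κ N 1 = 1 := one_pow _

/-- the function on ideals -/
noncomputable def h (N : ℕ) (I : Ideal O) : ZMod N := κ N ((ordCompl[N] (Ideal.absNorm I) : ℕ) : ZMod N)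

theorem h_mul (I J : Ideal O) : h N (I * J) = h N I * h N J := by
  unfold h
  rw [map_mul, Nat.ordCompl_mul, Nat.cast_mul, κ_mul]

theorem h_one : h N (1 : Ideal O) = 1 := by
  unfold h
  rw [map_one]
  simp [κ_one]

theorem absNorm_span (X : Chr k N) {γ : O} {a : R} (ha : ι a = k.Nm γ) :
    Ideal.absNorm (Ideal.span {γ}) = Ideal.absNorm (Ideal.span {a}) := by
  apply Nat.pow_left_injective (show 3 ≠ 0 by norm_num)
  show _ ^ 3 = _ ^ 3
  rw [← X.hO, ha]
  unfold Nm
  rw [← Ideal.span_singleton_mul_span_singleton, ← Ideal.span_singleton_mul_span_singleton, map_mul, map_mul,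
    ← k.S_span, ← k.S_span, ← k.S_span, absNorm_S, absNorm_S, absNorm_S]
  ring

theorem κφ {g c r : R} (hg : ¬ k.p ∣ g) (hc : ¬ k.p ∣ c) (h : k.p ∣ c ^ 3 * g - r ^ 3) : κ N (X.φ g) = 1 := by
  apply X.κ_cube (c := X.φ c) (r := X.φ r)
  · rwa [Ne, X.hk]
  · rwa [Ne, X.hk]
  · rw [← X.hk, map_sub, map_mul, map_pow, map_pow, sub_eq_zero] at h
    exact h

theorem κφ' {g c r : R} (hg : ¬ k.m ∣ g) (hc : ¬ k.m ∣ c) (h : k.m ∣ c ^ 3 * g - r ^ 3) : κ N (X.φ' g) = 1 := by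
  apply X.κ_cube (c := X.φ' c) (r := X.φ' r)
  · rwa [Ne, X.hk']
  · rwa [Ne, X.hk']
  · rw [← X.hk', map_sub, map_mul, map_pow, map_pow, sub_eq_zero] at h
    exact h

theorem h_principal (X : Chr k N) {γ : O} (hγ : γ ≠ 0) : h N (Ideal.span {γ}) = 1 := by
  haveI := Fact.mk X.hN
  obtain ⟨a, ha⟩ := k.Nm_fix γ
  obtain ⟨i, g, e1, hg, c, r, hc, hcr⟩ := k.desc_norm hγ ha
  obtain ⟨j, g', e2, hg', c', r', hc', hcr'⟩ := (k.swap X.hm).desc_norm hγ ha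
  change k.m ^ j * g' = a * k.p ^ (2 * j) at e2
  have K1 := X.κφ hg hc hcr
  have K2 := X.κφ' hg' hc' hcr'
  have d1 : k.p ^ i ∣ a := (k.cop.pow (n := 2 * i)).dvd_of_dvd_mul_right (Dvd.intro _ e1)
  have d2 : k.m ^ j ∣ a := (k.cop.symm.pow (n := 2 * j)).dvd_of_dvd_mul_right (Dvd.intro _ e2)
  obtain ⟨a', ha'⟩ := (k.cop.pow (m := i) (n := j)).mul_dvd d1 d2
  have E1 : g = a' * k.m ^ (j + 2 * i) := by
    apply mul_left_cancel₀ (pow_ne_zero i k.hp.ne_zero)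
    rw [e1, ha', pow_add]; ring
  have E2 : g' = a' * k.p ^ (i + 2 * j) := by
    apply mul_left_cancel₀ (pow_ne_zero j X.hm.ne_zero)
    rw [e2, ha', pow_add]; ring
  have n1 : X.φ a' ≠ 0 := by
    rw [Ne, X.hk]; intro h; exact hg (E1 ▸ Dvd.dvd.mul_right h _)
  have n2 : X.φ' a' ≠ 0 := by
    rw [Ne, X.hk']; intro h; exact hg' (E2 ▸ Dvd.dvd.mul_right h _)
  have n3 : X.φ k.m ≠ 0 := by
    rw [Ne, X.hk]; intro h
    obtain ⟨x, y, e⟩ := k.cop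
    exact k.hp.not_unit (isUnit_of_dvd_one (e ▸ dvd_add (Dvd.intro_left _ rfl) (Dvd.dvd.mul_left h _)))
  rw [E1, map_mul, map_pow, κ_mul, κ_pow] at K1
  rw [E2, map_mul, map_pow, κ_mul, κ_pow, ← X.hsw] at K2
  have nd : ¬ N ∣ Ideal.absNorm (Ideal.span {a'}) := by
    rw [← ZMod.natCast_eq_zero_iff, ← X.hφ]
    exact mul_ne_zero n1 n2
  unfold h
  rw [X.absNorm_span ha, ha', ← Ideal.span_singleton_mul_span_singleton, ← Ideal.span_singleton_mul_span_singleton,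
    ← Ideal.span_singleton_pow, ← Ideal.span_singleton_pow, map_mul, map_mul, map_pow, map_pow, X.hpN, X.hmN,
    ← pow_add, Nat.ordCompl_pow_mul_of_not_dvd _ X.hN nd, ← X.hφ, κ_mul]
  have K3 := X.κ_three n3
  calc κ N (X.φ a') * κ N (X.φ' a') = κ N (X.φ a') * κ N (X.φ' a') * (κ N (X.φ k.m) ^ 3) ^ (i + j) := by
        rw [K3, one_pow, mul_one]
    _ = (κ N (X.φ a') * κ N (X.φ k.m) ^ (j + 2 * i)) * (κ N (X.φ' a') * κ N (X.φ k.m) ^ (i + 2 * j)) := by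
        rw [← pow_mul, show 3 * (i + j) = (j + 2 * i) + (i + 2 * j) by ring, pow_add]; ring
    _ = 1 := by rw [K1, K2, one_mul]

theorem absNorm_PP (X : Chr k N) : Ideal.absNorm k.PP = N := by
  apply Nat.pow_left_injective (show 3 ≠ 0 by norm_num)
  show _ ^ 3 = _ ^ 3
  rw [← map_pow, k.PP3, X.hO, X.hpN]

theorem exists_χ (X : Chr k N) : ∃ χ : ClassGroup O →* ZMod N, (∀ I, I ≠ 0 → χ (cls I) = h N I) ∧ χ (cls k.PP) = 1 := by
  obtain ⟨χ, hχ⟩ := exists_classHom' (O := O) (h N) h_one (fun I J _ _ => h_mul I J) (fun x hx => X.h_principal hx)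
  refine ⟨χ, hχ, ?_⟩
  rw [hχ _ k.PP0, h, X.absNorm_PP]
  have := Nat.ordCompl_self_pow (k := 1) X.hN
  rw [pow_one] at this
  rw [this]; simp [κ_one]

/-- embedding of `R³` -/
def emb (k : Kum R O) : (Fin 3 → R) →ₗ[R] O where
  toFun v := ∑ i, ι (v i) * Beta.Yv k i
  map_add' v w := by simp [add_mul, Finset.sum_add_distrib]
  map_smul' r v := by simp [Finset.mul_sum, mul_assoc, Algebra.smul_def]

theorem emb_inj : Function.Injective (emb k) := by
  rw [← LinearMap.ker_eq_bot, LinearMap.ker_eq_bot']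
  intro v hv
  have hv : ∑ i, ι (v i) * Beta.Yv k i = 0 := hv
  have h1 := congrArg k.σ hv
  have h2 := congrArg k.σ h1
  have : (Beta.VV k (Beta.Yv k)).mulVec (fun i => ι (v i)) = 0 := by
    ext j
    rw [Fin.sum_univ_three] at hv h1 h2
    simp only [map_add, map_mul, k.hσR, map_zero] at h1 h2
    fin_cases j <;> simp [Matrix.mulVec, dotProduct, Fin.sum_univ_three, Beta.VV]
    · linear_combination hv
    · linear_combination h1
    · linear_combination h2
  have := Matrix.eq_zero_of_mulVec_eq_zero (Beta.VV_Y k) this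
  ext i
  have := congrFun this i
  exact k.ι0.1 this

theorem index_QQ (β : Beta k) :
    Nat.card ((Fin 3 → R) ⧸ LinearMap.range ((Matrix.toLin' β.QQ).restrictScalars ℤ)) =
      Ideal.absNorm (Ideal.span {(k.z - 1) ^ 3 * β.d ^ 2}) := by
  have hlam : k.z - 1 ≠ 0 := by
    intro h
    apply k.lam0
    have := congrArg ι h
    simpa [Z] using this
  have hd0 : β.QQ.det ≠ 0 := by
    rw [β.det_QQ]
    exact mul_ne_zero (pow_ne_zero _ hlam) (pow_ne_zero _ β.d_ne)
  rw [det_card, LinearMap.det_restrictScalars, LinearMap.det_toLin', β.det_QQ, Ideal.absNorm_span_singleton]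
  intro v w hvw
  have : β.QQ.mulVec (v - w) = 0 := by
    rw [Matrix.mulVec_sub, sub_eq_zero]; exact hvw
  exact sub_eq_zero.1 (Matrix.eq_zero_of_mulVec_eq_zero hd0 this)

theorem absNorm_I0 (X : Chr k N) (β : Beta k) : ∃ i j : ℕ, Ideal.absNorm β.I0 * N ^ i =
    Ideal.absNorm (Ideal.span {(k.z - 1) ^ 3 * β.d ^ 2}) * N ^ j := by
  let E : (Fin 3 → R) →+ O := (emb k).toAddMonoidHom
  let T : AddSubgroup O := E.range
  let Q : AddSubgroup (Fin 3 → R) := (LinearMap.range ((Matrix.toLin' β.QQ).restrictScalars ℤ)).toAddSubgroup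
  let Λ : AddSubgroup O := Q.map E
  have hΛ : ∀ x, x ∈ Λ ↔ Beta.InSpan (R := R) β.Bv x := by
    intro x
    have hE : ∀ v, E (β.QQ.mulVec v) = ι (v 0) * β.Bv 0 + ι (v 1) * β.Bv 1 + ι (v 2) * β.Bv 2 := by
      intro v
      show ∑ i, ι ((β.QQ.mulVec v) i) * Beta.Yv k i = _
      rw [β.Bv_QQ 0, β.Bv_QQ 1, β.Bv_QQ 2]
      simp only [Fin.sum_univ_three, Matrix.mulVec, dotProduct, map_add, map_mul]
      ring
    constructor
    · rintro ⟨_, ⟨v, rfl⟩, rfl⟩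
      exact ⟨v, hE v⟩
    · rintro ⟨v, rfl⟩
      exact ⟨β.QQ.mulVec v, ⟨v, rfl⟩, hE v⟩
  have hΛT : Λ ≤ T := by
    rintro _ ⟨v, _, rfl⟩
    exact ⟨v, rfl⟩
  have i1 : Λ.relIndex T = Ideal.absNorm (Ideal.span {(k.z - 1) ^ 3 * β.d ^ 2}) := by
    have : T = (⊤ : AddSubgroup (Fin 3 → R)).map E := by rw [← AddMonoidHom.range_eq_map]
    rw [this, AddSubgroup.relIndex_map_map_of_injective _ _ emb_inj, AddSubgroup.relIndex_top_right, ← index_QQ β]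
    rfl
  have hΛI : Λ ≤ β.I0.toAddSubgroup := fun x hx => β.Λ_le_I0 ((hΛ x).1 hx)
  have hα : Ideal.absNorm (Ideal.span {k.α ^ 2}) = N ^ 4 := by
    rw [← Ideal.span_singleton_pow, map_pow, X.absNorm_span k.Nm_α.symm, ← Ideal.span_singleton_mul_span_singleton, map_mul,
      X.hpN, X.hmN]; ring
  have hαT : (Ideal.span {k.α ^ 2}).toAddSubgroup ≤ T := by
    intro x hx
    obtain ⟨w, rfl⟩ := Ideal.mem_span_singleton.1 hx
    obtain ⟨v, hv⟩ := Beta.α2O k w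
    refine ⟨v, ?_⟩
    show ∑ i, ι (v i) * Beta.Yv k i = _
    rw [hv, Fin.sum_univ_three]; simp [Beta.Yv]
  have hαΛ : (Ideal.span {k.α ^ 2} * β.I0).toAddSubgroup ≤ Λ := by
    intro x hx
    obtain ⟨w, hw, rfl⟩ := Ideal.mem_span_singleton_mul.1 hx
    exact (hΛ _).2 (β.α2I0 hw)
  have hT : T.index ∣ N ^ 4 := by
    rw [← hα]; exact AddSubgroup.index_dvd_of_le hαT
  have e1 := AddSubgroup.relIndex_mul_index hΛT
  have e2 := AddSubgroup.relIndex_mul_index hΛI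
  have e3 := AddSubgroup.index_dvd_of_le hαΛ
  rw [← Ideal.absNorm_eq_index, map_mul, hα, ← e2, ← Ideal.absNorm_eq_index] at e3
  have hI0 : Ideal.absNorm β.I0 ≠ 0 := by
    rw [Ne, Ideal.absNorm_eq_zero_iff]; exact β.I0_ne
  have e4 := Nat.dvd_of_mul_dvd_mul_right (Nat.pos_of_ne_zero hI0) e3
  obtain ⟨i, _, hi⟩ := (Nat.dvd_prime_pow X.hN).1 e4
  obtain ⟨j, _, hj⟩ := (Nat.dvd_prime_pow X.hN).1 hT
  refine ⟨i, j, ?_⟩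
  rw [← hi, ← hj, mul_comm, ← i1, e1, ← e2, Ideal.absNorm_eq_index]

end Chr
end ChrPart
end Kum

namespace Kum
namespace Chr

section LPart

variable {R O : Type*} [CommRing R] [CommRing O] [Algebra R O] [IsDomain R]
  [IsPrincipalIdealRing R] [IsDomain O] [IsDedekindDomain O]
  [Module.Free ℤ R] [Module.Free ℤ O] [Module.Finite ℤ R] [Module.Finite ℤ O] {k : Kum R O}

local notation "ι" => algebraMap R O

variable {N : ℕ} (X : Chr k N)

theorem split_ideal (k : Kum R O) (q : ℕ) (r : ℤ) (hqr : (q : ℤ) ∣ r ^ 3 - N) (hcop : IsCoprime (q : ℤ) (3 * r))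
    (hn : k.p * k.m = (N : R)) :
    Ideal.span {(q : O), k.α - (r : O)} * k.S (Ideal.span {(q : O), k.α - (r : O)}) *
      k.S (k.S (Ideal.span {(q : O), k.α - (r : O)})) = Ideal.span {(q : O)} := by
  set I := Ideal.span {(q : O), k.α - (r : O)} with hI
  have e1 : k.S I = Ideal.span {(q : O), k.Z ^ 2 * k.α - (r : O)} := by
    rw [hI, S, Ideal.map_span]
    congr 1
    simp [Set.image_insert_eq, k.σα]
  have e2 : k.S (k.S I) = Ideal.span {(q : O), k.Z * k.α - (r : O)} := by
    rw [e1, S, Ideal.map_span]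
    congr 1
    have := k.σσα
    rw [k.σα] at this
    simp only [map_mul, map_pow] at this
    simp [Set.image_insert_eq, this]
  have hα3 : k.α ^ 3 = (N : O) := by rw [k.hα, hn]; simp
  have q1 : (q : O) ∈ I := Ideal.subset_span (by simp)
  have q2 : (q : O) ∈ k.S I := by rw [e1]; exact Ideal.subset_span (by simp)
  have q3 : (q : O) ∈ k.S (k.S I) := by rw [e2]; exact Ideal.subset_span (by simp)
  have u1 : k.α - (r : O) ∈ I := Ideal.subset_span (by simp)
  have u2 : k.Z ^ 2 * k.α - (r : O) ∈ k.S I := by rw [e1]; exact Ideal.subset_span (by simp)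
  have u3 : k.Z * k.α - (r : O) ∈ k.S (k.S I) := by rw [e2]; exact Ideal.subset_span (by simp)
  obtain ⟨x, y, hxy⟩ := hcop
  have hxy : (x : O) * q + y * (3 * r) = 1 := by exact_mod_cast congrArg (Int.cast : ℤ → O) hxy
  have key : ∀ A B : Ideal O, (q : O) ∈ A → (3 : O) * r ∈ A ⊔ B → IsCoprime A B := by
    intro A B hA hB
    rw [Ideal.isCoprime_iff_sup_eq, Ideal.eq_top_iff_one, ← hxy]
    exact Ideal.add_mem _ (Ideal.mul_mem_left _ _ (Ideal.mem_sup_left hA)) (Ideal.mul_mem_left _ _ hB)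
  have c12 : IsCoprime I (k.S I) := by
    apply key _ _ q1
    have : (3 : O) * r = (1 - k.Z) * (k.Z ^ 2 * (k.α - r)) + -(1 - k.Z) * (k.Z ^ 2 * k.α - r) := by
      linear_combination (-(k.Z-2)*r) * k.hZ
    rw [this]
    exact Ideal.add_mem _ (Ideal.mul_mem_left _ _ (Ideal.mem_sup_left (Ideal.mul_mem_left _ _ u1)))
      (Ideal.mul_mem_left _ _ (Ideal.mem_sup_right u2))
  have c13 : IsCoprime I (k.S (k.S I)) := by
    apply key _ _ q1
    have : (3 : O) * r = (1 - k.Z ^ 2) * (k.Z * (k.α - r)) + -(1 - k.Z ^ 2) * (k.Z * k.α - r) := by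
      linear_combination (-(k.Z-2)*r) * k.hZ
    rw [this]
    exact Ideal.add_mem _ (Ideal.mul_mem_left _ _ (Ideal.mem_sup_left (Ideal.mul_mem_left _ _ u1)))
      (Ideal.mul_mem_left _ _ (Ideal.mem_sup_right u3))
  have c23 : IsCoprime (k.S I) (k.S (k.S I)) := by
    apply key _ _ q2
    have : (3 : O) * r = (k.Z ^ 2 - 1) * (k.Z ^ 2 * k.α - r) + -(k.Z ^ 2 - 1) * (k.Z * (k.Z * k.α - r)) := by
      linear_combination (-(k.Z-2)*r) * k.hZ
    rw [this]
    exact Ideal.add_mem _ (Ideal.mul_mem_left _ _ (Ideal.mem_sup_left u2))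
      (Ideal.mul_mem_left _ _ (Ideal.mem_sup_right (Ideal.mul_mem_left _ _ u3)))
  apply le_antisymm
  · obtain ⟨t, ht⟩ := hqr
    have ht : (r : O) ^ 3 - N = q * t := by exact_mod_cast congrArg (Int.cast : ℤ → O) ht
    rw [e2, e1, hI, Ideal.mul_le]
    intro a ha b hb
    have ha : a ∈ Ideal.span {(q : O), (k.α - r) * (k.Z ^ 2 * k.α - r)} := by
      refine Ideal.mul_le.2 ?_ ha
      intro a ha b hb
      obtain ⟨a1, a2, rfl⟩ := Ideal.mem_span_pair.1 ha
      obtain ⟨b1, b2, rfl⟩ := Ideal.mem_span_pair.1 hb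
      rw [Ideal.mem_span_pair]
      exact ⟨a1 * (b1 * q + b2 * (k.Z ^ 2 * k.α - r)) + a2 * (k.α - r) * b1, a2 * b2, by ring⟩
    obtain ⟨a1, a2, rfl⟩ := Ideal.mem_span_pair.1 ha
    obtain ⟨b1, b2, rfl⟩ := Ideal.mem_span_pair.1 hb
    rw [Ideal.mem_span_singleton]
    have : (k.α - r) * (k.Z ^ 2 * k.α - r) * (k.Z * k.α - r) = - (q * t) := by
      rw [← ht, ← hα3]
      linear_combination k.α ^ 3 * k.Z3 + (r * (r-k.Z*k.α) * k.α) * k.hZ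
    refine ⟨a1 * (b1 * q + b2 * (k.Z * k.α - r)) + a2 * ((k.α - r) * (k.Z ^ 2 * k.α - r)) * b1 - a2 * b2 * t, ?_⟩
    linear_combination a2 * b2 * this
  · rw [Ideal.span_singleton_le_iff_mem, ← Ideal.inf_eq_mul_of_isCoprime (c13.mul_left c23),
      ← Ideal.inf_eq_mul_of_isCoprime c12]
    exact ⟨⟨q1, q2⟩, q3⟩

theorem ordc {n N : ℕ} (h : ¬ N ∣ n) : ordCompl[N] n = n := by
  rw [Nat.factorization_eq_zero_of_not_dvd h, pow_zero, Nat.div_one]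

theorem N_cop3 (X : Chr k N) : Nat.Coprime 3 N := by
  have h1 := X.hmod
  have h2 := X.hN.two_le
  rw [Nat.coprime_primes Nat.prime_three X.hN]
  rintro rfl
  omega

theorem exists_q (X : Chr k N) : ∃ q : ℕ, q.Prime ∧ q > N ∧ q % 3 = 2 ∧ κ N (q : ZMod N) ≠ 1 := by
  haveI := Fact.mk X.hN
  obtain ⟨g, hg⟩ := IsCyclic.exists_generator (α := (ZMod N)ˣ)
  have ho : orderOf g = N - 1 := by
    rw [orderOf_eq_card_of_forall_mem_zpowers hg, Nat.card_eq_fintype_card, ZMod.card_units]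
  have hgκ : κ N (g : ZMod N) ≠ 1 := by
    rw [κ]
    intro h
    have h' : g ^ ((N - 1) / 3) = 1 := by
      ext; simpa using h
    have := Nat.le_of_dvd (by have := X.hN.two_le; have := X.hmod; omega) (orderOf_dvd_of_pow_eq_one h')
    have := X.hN.two_le
    omega
  let a := Nat.chineseRemainder X.N_cop3 2 (g : ZMod N).val
  have ha1 := a.2.1
  have ha2 := a.2.2
  have hN3 : NeZero (3 * N) := ⟨by have := X.hN.pos; omega⟩
  have hcop : Nat.Coprime (a : ℕ) (3 * N) := by
    apply Nat.Coprime.mul_right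
    · rw [Nat.coprime_comm, Nat.Prime.coprime_iff_not_dvd Nat.prime_three]
      have : (a : ℕ) % 3 = 2 := ha1
      omega
    · rw [Nat.coprime_comm, Nat.Prime.coprime_iff_not_dvd X.hN, ← ZMod.natCast_eq_zero_iff,
        (ZMod.natCast_eq_natCast_iff _ _ _).2 ha2]
      simp
  obtain ⟨q, hq1, hq2, hq3⟩ := Nat.forall_exists_prime_gt_and_eq_mod (q := 3 * N) (a := ((a : ℕ) : ZMod (3 * N)))
    ((ZMod.isUnit_iff_coprime _ _).2 hcop) N
  rw [ZMod.natCast_eq_natCast_iff] at hq3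
  have hqa : q ≡ a [MOD 3] := Nat.ModEq.of_mul_right _ hq3
  have hqb : q ≡ a [MOD N] := Nat.ModEq.of_mul_left _ hq3
  refine ⟨q, hq2, hq1, ?_, ?_⟩
  · exact (hqa.trans ha1)
  · have : (q : ZMod N) = g := by
      have := (ZMod.natCast_eq_natCast_iff _ _ _).2 (hqb.trans ha2)
      rw [this]; simp
    rwa [this]

theorem κ_sq (X : Chr k N) {x : ZMod N} (hx : x ≠ 0) (h : κ N x ^ 2 = 1) : κ N x = 1 := by
  have := X.κ_three hx
  rw [pow_succ, h, one_mul] at this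
  exact this

theorem χ_nontriv (X : Chr k N) (hn : k.p * k.m = (N : R)) : ∃ I : Ideal O, I ≠ 0 ∧ h N I ≠ 1 := by
  haveI := Fact.mk X.hN
  obtain ⟨q, hq, hqN, hq3, hκ⟩ := X.exists_q
  haveI := Fact.mk hq
  set r : ℤ := (N : ℤ) ^ (2 * (q / 3) + 1) with hr
  have hNq : ((N : ℕ) : ZMod q) ≠ 0 := by
    rw [Ne, ZMod.natCast_eq_zero_iff]
    intro h
    have := Nat.le_of_dvd X.hN.pos h
    omega
  have hqr : (q : ℤ) ∣ r ^ 3 - N := by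
    rw [← ZMod.intCast_zmod_eq_zero_iff_dvd]
    push_cast [hr]
    rw [← pow_mul, show (2 * (q / 3) + 1) * 3 = (q - 1) * 2 + 1 by omega, pow_succ, pow_mul,
      ZMod.pow_card_sub_one_eq_one hNq]
    simp
  have hcop : IsCoprime (q : ℤ) (3 * r) := by
    rw [hr]
    apply IsCoprime.mul_right
    · have : Nat.Coprime q 3 := by
        rw [Nat.coprime_comm, Nat.Prime.coprime_iff_not_dvd Nat.prime_three]; omega
      exact_mod_cast Nat.isCoprime_iff_coprime.2 this
    · apply IsCoprime.pow_right
      apply Nat.isCoprime_iff_coprime.2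
      rw [Nat.coprime_primes hq X.hN]; omega
  have hq0 : (q : O) ≠ 0 := by
    intro h
    have := X.hO (q : R)
    rw [map_natCast, h] at this
    simp only [Ideal.span_singleton_zero, Ideal.absNorm_bot] at this
    have h2 := pow_eq_zero_iff (three_ne_zero) |>.1 this.symm
    have h3 := X.hφ (q : R)
    rw [h2, map_natCast, map_natCast] at h3
    have h4 : (q : ZMod N) = 0 := by simpa using h3
    rw [ZMod.natCast_eq_zero_iff, Nat.prime_dvd_prime_iff_eq X.hN hq] at h4
    omega
  have key := split_ideal k q r hqr hcop hn
  set I := Ideal.span {(q : O), k.α - (r : O)} with hI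
  refine ⟨I, ?_, ?_⟩
  · intro h0
    rw [h0, zero_mul, zero_mul] at key
    exact hq0 (Ideal.span_singleton_eq_bot.1 key.symm)
  · have e := congrArg Ideal.absNorm key
    rw [map_mul, map_mul, absNorm_S, absNorm_S, absNorm_S, ← map_natCast (algebraMap R O), X.hO] at e
    have e' : Ideal.absNorm I = Ideal.absNorm (Ideal.span {(q : R)}) := by
      apply Nat.pow_left_injective (show 3 ≠ 0 by norm_num)
      show _ ^ 3 = _ ^ 3
      rw [← e]; ring
    have hx : ((Ideal.absNorm I : ℕ) : ZMod N) = (q : ZMod N) ^ 2 := by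
      rw [e', ← X.hφ]; simp [sq]
    have hqN' : (q : ZMod N) ≠ 0 := by
      rw [Ne, ZMod.natCast_eq_zero_iff, Nat.prime_dvd_prime_iff_eq X.hN hq]; omega
    have nd : ¬ N ∣ Ideal.absNorm I := by
      rw [← ZMod.natCast_eq_zero_iff, hx]
      exact pow_ne_zero _ hqN'
    unfold h
    rw [ordc nd, hx, κ_pow]
    exact fun h => hκ (X.κ_sq hqN' h)

theorem φlam : X.φ (k.z - 1) ≠ 0 := by
  rw [Ne, X.hk]
  intro h
  apply k.hp.not_unit
  apply isUnit_of_dvd_one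
  have h1 := k.hn
  have : (1 : R) = k.p * k.m - (k.z - 1) * ((k.z - 1) ^ 2 * k.e) := by rw [h1]; ring
  rw [this]
  exact dvd_sub (Dvd.intro _ rfl) (Dvd.dvd.mul_right h _)

theorem φ'lam : X.φ' (k.z - 1) ≠ 0 := by
  rw [Ne, X.hk']
  intro h
  apply X.hm.not_unit
  apply isUnit_of_dvd_one
  have h1 := k.hn
  have : (1 : R) = k.p * k.m - (k.z - 1) * ((k.z - 1) ^ 2 * k.e) := by rw [h1]; ring
  rw [this]
  exact dvd_sub (Dvd.intro_left _ rfl) (Dvd.dvd.mul_right h _)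

theorem h_I0 (β : Beta k) (hd : X.φ β.d ≠ 0) (hd' : X.φ' β.d ≠ 0) :
    h N β.I0 = κ N (X.φ β.d * X.φ' β.d) ^ 2 := by
  haveI := Fact.mk X.hN
  obtain ⟨i, j, hij⟩ := X.absNorm_I0 β
  have hx : ((Ideal.absNorm (Ideal.span {(k.z - 1) ^ 3 * β.d ^ 2}) : ℕ) : ZMod N) =
      (X.φ (k.z - 1) * X.φ' (k.z - 1)) ^ 3 * (X.φ β.d * X.φ' β.d) ^ 2 := by
    rw [← X.hφ]; simp only [map_mul, map_pow]; ring
  have hn0 : X.φ (k.z - 1) * X.φ' (k.z - 1) ≠ 0 := mul_ne_zero X.φlam X.φ'lam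
  have nd : ¬ N ∣ Ideal.absNorm (Ideal.span {(k.z - 1) ^ 3 * β.d ^ 2}) := by
    rw [← ZMod.natCast_eq_zero_iff, hx]
    exact mul_ne_zero (pow_ne_zero _ hn0) (pow_ne_zero _ (mul_ne_zero hd hd'))
  have e := congrArg (fun n => ordCompl[N] n) hij
  beta_reduce at e
  rw [Nat.ordCompl_mul, Nat.ordCompl_mul, Nat.ordCompl_self_pow X.hN, Nat.ordCompl_self_pow X.hN, mul_one, mul_one,
    ordc nd] at e
  unfold h
  rw [e, hx, κ_mul, κ_pow, κ_pow, X.κ_three hn0, one_mul]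

/-- the class group of `L` -/
theorem Lmain [Finite (ClassGroup O)] (hn : k.p * k.m = (N : R)) (hU : k.UH) (β : Beta k)
    (hd : X.φ β.d ≠ 0) (hd' : X.φ' β.d ≠ 0) :
    (κ N (X.φ β.d * X.φ' β.d) = 1 → Nat.card {g : ClassGroup O // g ^ 3 = 1} = 9) ∧
    (κ N (X.φ β.d * X.φ' β.d) ≠ 1 → Nat.card {g : ClassGroup O // g ^ 3 = 1} = 3) := by
  haveI := Fact.mk X.hN
  obtain ⟨s, hs⟩ := k.exists_s
  obtain ⟨χ, hχ, hχP⟩ := X.exists_χ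
  obtain ⟨f1, f2⟩ := k.fix_main hU X.hm hs β.I0_ne β.ιd_ne β.B1_ne β.I0_rel β.NmB1 χ hχP
  have hχs : ∀ c, χ (s c) = χ c := by
    intro c
    obtain ⟨I, hI, rfl⟩ := cls_surj c
    rw [hs I hI, hχ _ (k.S0 hI), hχ _ hI, h, h, absNorm_S]
  have hnt : ∃ c, χ c ≠ 1 := by
    obtain ⟨I, hI, hI1⟩ := X.χ_nontriv hn
    exact ⟨cls I, by rwa [hχ I hI]⟩
  have := abstract_rank s (k.s_norm hs) f1 χ hχs hnt
  rw [f2, hχ _ β.I0_ne, X.h_I0 β hd hd'] at this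
  refine ⟨fun h => this.1 (by rw [h, one_pow]), fun h => this.2 fun h2 => h (X.κ_sq (mul_ne_zero hd hd') h2)⟩

end LPart
end Chr
end Kum

section Build

variable {F : Type*} [Field F] [NumberField F] [IsCyclotomicExtension {3} ℚ F]
  {L : Type*} [Field L] [NumberField L] [Algebra F L]

theorem build_notcube {R : Type*} [CommRing R] [IsDomain R] {p m b : R} (hp : Prime p) (hpm : IsCoprime p m)
    (h : b ^ 3 = p * m) : False := by
  have h1 : p ∣ b := hp.dvd_of_dvd_pow (h ▸ Dvd.intro _ rfl)
  obtain ⟨c, rfl⟩ := h1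
  have h2 : m = p * (p * c ^ 3) := by
    apply mul_left_cancel₀ hp.ne_zero
    rw [← h]; ring
  have h3 : p ∣ m := Dvd.intro _ h2.symm
  exact hp.not_unit (hpm.isUnit_of_dvd' dvd_rfl h3)

theorem build_minpoly {n : 𝓞 F} (hn : ∀ b : 𝓞 F, b ^ 3 ≠ n) {α : L} (hα : α ^ 3 = algebraMap F L (n : F)) :
    minpoly F α = X ^ 3 - C (n : F) := by
  symm
  apply minpoly.eq_of_irreducible_of_monic
  · apply X_pow_sub_C_irreducible_of_prime Nat.prime_three
    intro b hb
    have hi : IsIntegral ℤ b := by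
      apply IsIntegral.of_pow (n := 3) (by norm_num)
      rw [hb]; exact n.isIntegral_coe
    obtain ⟨b, rfl⟩ : ∃ x : 𝓞 F, (x : F) = b := ⟨⟨b, hi⟩, rfl⟩
    exact hn b (FaithfulSMul.algebraMap_injective (𝓞 F) F (by rw [map_pow]; exact hb))
  · simp [hα]
  · exact monic_X_pow_sub_C _ (by norm_num)

theorem build_finrank {n : 𝓞 F} (hn : ∀ b : 𝓞 F, b ^ 3 ≠ n) {α : L} (hα : α ^ 3 = algebraMap F L (n : F))
    (hgen : Algebra.adjoin F {α} = ⊤) : Module.finrank F L = 3 := by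
  have hintegral : IsIntegral F α := Algebra.IsIntegral.isIntegral α
  rw [(PowerBasis.ofAdjoinEqTop hintegral hgen).finrank, PowerBasis.ofAdjoinEqTop_dim, build_minpoly hn hα]
  compute_degree!

theorem build_aut {n : 𝓞 F} (hn : ∀ b : 𝓞 F, b ^ 3 ≠ n) {α : L} (hα : α ^ 3 = algebraMap F L (n : F))
    (hgen : Algebra.adjoin F {α} = ⊤) {z : F} (hz : z ^ 2 + z + 1 = 0) :
    ∃ σ : L ≃ₐ[F] L, σ α = algebraMap F L (z ^ 2) * α ∧ (∀ x, σ (σ (σ x)) = x) ∧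
      ∀ x, ∃ r, algebraMap F L r = x + σ x + σ (σ x) := by
  have hintegral : IsIntegral F α := Algebra.IsIntegral.isIntegral α
  have hz3 : z ^ 3 = 1 := by linear_combination (z - 1) * hz
  let pb := PowerBasis.ofAdjoinEqTop hintegral hgen
  have hg : pb.gen = α := PowerBasis.ofAdjoinEqTop_gen hintegral hgen
  have hroot : aeval (algebraMap F L (z ^ 2) * α) (minpoly F pb.gen) = 0 := by
    rw [hg, build_minpoly hn hα]
    simp only [map_sub, map_pow, aeval_X, aeval_C]
    rw [mul_pow, hα, ← map_pow, ← map_pow,  ← map_mul, ← map_sub]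
    rw [show (z ^ 2) ^ 3 = 1 by rw [← pow_mul, mul_comm, pow_mul, hz3, one_pow], one_mul, sub_self, map_zero]
  let f : L →ₐ[F] L := pb.lift (algebraMap F L (z ^ 2) * α) hroot
  have hfα : f α = algebraMap F L (z ^ 2) * α := by
    have h1 : f pb.gen = algebraMap F L (z ^ 2) * α := pb.lift_gen _ hroot
    rwa [hg] at h1
  have hbij : Function.Bijective f := Algebra.IsAlgebraic.algHom_bijective f
  let σ := AlgEquiv.ofBijective f hbij
  have hσα : σ α = algebraMap F L (z ^ 2) * α := hfα
  have hσσα : σ (σ α) = algebraMap F L z * α := by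
    rw [hσα, map_mul, hσα, AlgEquiv.commutes, ← mul_assoc, ← map_mul]
    congr 2
    linear_combination z * hz3
  have hσσσα : σ (σ (σ α)) = α := by
    rw [hσσα, map_mul, hσα, AlgEquiv.commutes, ← mul_assoc, ← map_mul, ← pow_succ', hz3]; simp
  refine ⟨σ, hσα, ?_, ?_⟩
  · have : (σ.toAlgHom.comp (σ.toAlgHom.comp σ.toAlgHom)) = AlgHom.id F L := by
      apply pb.algHom_ext
      rw [hg]
      exact hσσσα
    intro x
    exact DFunLike.congr_fun this x
  · let T : L →ₗ[F] L := LinearMap.id + σ.toLinearMap + σ.toLinearMap.comp σ.toLinearMap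
    suffices h : LinearMap.range T ≤ LinearMap.range (Algebra.linearMap F L) by
      intro x
      exact h ⟨x, rfl⟩
    rw [LinearMap.range_eq_map, ← pb.basis.span_eq, LinearMap.map_span, Submodule.span_le]
    rintro _ ⟨_, ⟨i, rfl⟩, rfl⟩
    have hdim : pb.dim = 3 := by
      rw [PowerBasis.ofAdjoinEqTop_dim, build_minpoly hn hα]
      compute_degree!
    have hi : (i : ℕ) < 3 := hdim ▸ i.2
    rw [pb.basis_eq_pow, hg]
    generalize (i : ℕ) = j at hi
    have e : T (α ^ j) = α ^ j + (σ α) ^ j + (σ (σ α)) ^ j := by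
      simp [T]
    rw [e, hσσα, hσα]
    have hZ : (algebraMap F L z) ^ 2 + algebraMap F L z + 1 = 0 := by
      rw [← map_pow, ← map_add, ← map_one (algebraMap F L), ← map_add, hz, map_zero]
    interval_cases j
    · exact ⟨3, by rw [Algebra.linearMap_apply, map_ofNat]; norm_num⟩
    · refine ⟨0, ?_⟩
      rw [map_zero, map_pow]
      linear_combination (-α) * hZ
    · refine ⟨0, ?_⟩
      rw [map_zero, map_pow]
      linear_combination (-α^2 * ((algebraMap F L z)^2 - algebraMap F L z + 1)) * hZ

theorem build_hO (h3 : Module.finrank F L = 3) (a : 𝓞 F) :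
    Ideal.absNorm (Ideal.span {algebraMap (𝓞 F) (𝓞 L) a}) = Ideal.absNorm (Ideal.span {a}) ^ 3 := by
  rw [Ideal.absNorm_span_singleton, Ideal.absNorm_span_singleton, ← Int.natAbs_pow]
  congr 1
  have : Function.Injective (Int.cast : ℤ → ℚ) := Int.cast_injective
  apply this
  rw [Algebra.coe_norm_int]
  push_cast
  rw [Algebra.coe_norm_int, ← map_pow, ← h3, ← Algebra.norm_algebraMap (S := L), Algebra.norm_norm]
  rfl

theorem build_rank (h3 : Module.finrank F L = 3) : NumberField.Units.rank L = 2 := by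
  haveI : NumberField.IsTotallyComplex F := IsCyclotomicExtension.Rat.isTotallyComplex (n := 3) F (by norm_num)
  haveI : NumberField.IsTotallyComplex L := NumberField.isTotallyComplex_of_algebra F L
  have h6 : Module.finrank ℚ L = 6 := by
    rw [← Module.finrank_mul_finrank ℚ F L, h3, IsCyclotomicExtension.finrank (n := 3) F (Polynomial.cyclotomic.irreducible_rat (by norm_num))]
    decide
  rw [NumberField.Units.rank, NumberField.InfinitePlace.card_eq_nrRealPlaces_add_nrComplexPlaces, NumberField.IsTotallyComplex.nrRealPlaces_eq_zero]
  have := NumberField.IsTotallyComplex.finrank L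
  omega

theorem build_Kum {ζ : F} (hζ : IsPrimitiveRoot ζ 3) {p m e : 𝓞 F} (hp : Prime p) (hm : Prime m ∨ m = 1)
    (cop : IsCoprime p m) (hn : p * m = 1 + (hζ.toInteger - 1) ^ 3 * e) {α : L}
    (hα : α ^ 3 = algebraMap F L ((p * m : 𝓞 F) : F)) (hgen : Algebra.adjoin F {α} = ⊤) :
    ∃ k : Kum (𝓞 F) (𝓞 L), k.z = hζ.toInteger ∧ k.p = p ∧ k.m = m ∧ k.UH ∧
     ∀ a, Ideal.absNorm (Ideal.span {algebraMap (𝓞 F) (𝓞 L) a}) = Ideal.absNorm (Ideal.span {a}) ^ 3 := by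
  set z := hζ.toInteger with hzdef
  have hz' : z ^ 2 + z + 1 = 0 := by
    have h1 : z ^ 3 = 1 := hζ.toInteger_isPrimitiveRoot.pow_eq_one
    have h2 : z - 1 ≠ 0 := sub_ne_zero.2 (hζ.toInteger_isPrimitiveRoot.ne_one (by norm_num))
    apply mul_left_cancel₀ h2
    linear_combination h1
  have hzF : (z : F) ^ 2 + (z : F) + 1 = 0 := by
    have := congrArg (algebraMap (𝓞 F) F) hz'
    simpa using this
  have hnc : ∀ b : 𝓞 F, b ^ 3 ≠ p * m := fun b hb => build_notcube hp cop hb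
  have h3 := build_finrank hnc hα hgen
  obtain ⟨σ, hσα, hσ3, hσT⟩ := build_aut hnc hα hgen hzF
  have hαi : IsIntegral ℤ α := by
    apply IsIntegral.of_pow (n := 3) (by norm_num)
    rw [hα]
    exact map_isIntegral_int (algebraMap F L) (p * m).isIntegral_coe
  set lam : L := algebraMap F L ((z : F) - 1) with hlam
  have hlam0 : lam ≠ 0 := by
    rw [hlam, Ne, map_eq_zero, sub_eq_zero]
    intro h
    rw [h] at hzF
    norm_num at hzF
  set Z : L := algebraMap F L (z : F) with hZ
  have hZ2 : Z ^ 2 + Z + 1 = 0 := by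
    have := congrArg (algebraMap F L) hzF
    simpa using this
  have hlamZ : lam = Z - 1 := by rw [hlam, map_sub, map_one]
  have hαe : α ^ 3 = 1 + lam ^ 3 * algebraMap F L (e : F) := by
    rw [hα, hn]
    simp [hlam]
  set y : L := (α - 1) / lam with hydef
  have hly : lam * y = α - 1 := by rw [hydef]; field_simp
  have hy3 : y ^ 3 - Z ^ 2 * lam * y ^ 2 - Z ^ 2 * y - algebraMap F L (e : F) = 0 := by
    apply (mul_eq_zero.1 _).resolve_left (pow_ne_zero 3 hlam0)
    have e1 : α = 1 + lam * y := by rw [hly]; ring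
    have e2 := hαe
    rw [e1] at e2
    have e3 : (3 : L) = - Z ^ 2 * lam ^ 2 := by
      rw [hlamZ]
      linear_combination ((Z^2-3*Z+3)) * hZ2
    linear_combination e2 - (lam * y + lam ^ 2 * y ^ 2) * e3
  have hyi : IsIntegral ℤ y := by
    have : IsIntegral (𝓞 F) y := by
      refine ⟨X ^ 3 - C (z ^ 2 * (z - 1)) * X ^ 2 - C (z ^ 2) * X - C e, ?_, ?_⟩
      · monicity!
      · rw [← hy3]
        simp only [eval₂_sub, eval₂_mul, eval₂_pow, eval₂_X, eval₂_C, eval₂_one, map_mul, map_pow, map_sub, map_one]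
        rw [hlamZ, hZ]
        rfl
    exact isIntegral_trans (R := ℤ) (A := 𝓞 F) y this
  obtain ⟨αO, hαO⟩ : ∃ x : 𝓞 L, algebraMap (𝓞 L) L x = α := ⟨⟨α, hαi⟩, rfl⟩
  obtain ⟨yO, hyO⟩ : ∃ x : 𝓞 L, algebraMap (𝓞 L) L x = y := ⟨⟨y, hyi⟩, rfl⟩
  let σO : 𝓞 L ≃+* 𝓞 L := NumberField.RingOfIntegers.mapRingEquiv (σ : L ≃+* L)
  have hσO : ∀ x, algebraMap (𝓞 L) L (σO x) = σ (algebraMap (𝓞 L) L x) := fun x => rfl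
  let k : Kum (𝓞 F) (𝓞 L) :=
   { z := z
     hz := hz'
     p := p
     m := m
     e := e
     α := αO
     y := yO
     σ := σO
     hp := hp
     hm := hm
     cop := cop
     hn := hn
     hα := by
       apply FaithfulSMul.algebraMap_injective (𝓞 L) L
       rw [map_pow, hαO]
       exact hα
     hy := by
       apply FaithfulSMul.algebraMap_injective (𝓞 L) L
       rw [map_mul, map_sub (algebraMap (𝓞 L) L), map_one, hαO, hyO, ← hly, hlamZ, map_sub (algebraMap (𝓞 F) (𝓞 L)), map_sub, map_one, map_one]
       rfl
     hσR := by
       intro r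
       apply FaithfulSMul.algebraMap_injective (𝓞 L) L
       rw [hσO]
       exact σ.commutes (r : F)
     hσα := by
       apply FaithfulSMul.algebraMap_injective (𝓞 L) L
       rw [hσO, map_mul, hαO, hσα, map_pow, map_pow, map_pow]
       rfl
     hσ3 := by
       intro x
       apply FaithfulSMul.algebraMap_injective (𝓞 L) L
       rw [hσO, hσO, hσO]
       exact hσ3 x
     hfix := by
       intro x hx
       have hx' : σ (algebraMap (𝓞 L) L x) = algebraMap (𝓞 L) L x := by rw [← hσO, hx]
       obtain ⟨r, hr⟩ := hσT (algebraMap (𝓞 L) L x)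
       rw [hx', hx'] at hr
       have hr3 : algebraMap F L (r / 3) = algebraMap (𝓞 L) L x := by
         rw [map_div₀, hr, map_ofNat]; ring
       have hri : IsIntegral ℤ (r / 3) := by
         rw [← isIntegral_algebraMap_iff (algebraMap F L).injective, hr3]
         exact x.isIntegral_coe
       obtain ⟨r', hr'⟩ : ∃ x : 𝓞 F, algebraMap (𝓞 F) F x = r / 3 := ⟨⟨r / 3, hri⟩, rfl⟩
       refine ⟨r', ?_⟩
       apply FaithfulSMul.algebraMap_injective (𝓞 L) L
       rw [← hr3, ← hr']
       rfl
     hinj := FaithfulSMul.algebraMap_injective _ _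
     h3 := by norm_num
     hunits := by
       intro u hu
       have := IsCyclotomicExtension.Rat.Three.Units.mem hζ hu.unit
       simp only [List.mem_cons, List.not_mem_nil, or_false] at this
       have hu' : (hu.unit : 𝓞 F) = u := rfl
       rcases this with h | h | h | h | h | h
       · exact ⟨0, Or.inl (by rw [← hu', h]; simp)⟩
       · exact ⟨0, Or.inr (by rw [← hu', h]; simp)⟩
       · exact ⟨1, Or.inl (by rw [← hu', h]; simp [hzdef])⟩
       · exact ⟨1, Or.inr (by rw [← hu', h]; simp [hzdef])⟩
       · exact ⟨2, Or.inl (by rw [← hu', h]; simp [hzdef])⟩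
       · exact ⟨2, Or.inr (by rw [← hu', h]; simp [hzdef])⟩ }
  refine ⟨k, rfl, rfl, rfl, ?_, build_hO h3⟩
  have h2 : Module.finrank ℤ (Additive ((𝓞 L)ˣ ⧸ CommGroup.torsion (𝓞 L)ˣ)) = 2 := by
    rw [← build_rank h3]
    exact NumberField.Units.finrank_modTorsion L
  haveI : Module.Free ℤ (Additive ((𝓞 L)ˣ ⧸ CommGroup.torsion (𝓞 L)ˣ)) := 
    NumberField.Units.instFreeIntAdditiveQuotientUnitsRingOfIntegersSubgroupTorsion L
  haveI : Module.Finite ℤ (Additive ((𝓞 L)ˣ ⧸ CommGroup.torsion (𝓞 L)ˣ)) := 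
    NumberField.Units.instFiniteIntAdditiveQuotientUnitsRingOfIntegersSubgroupTorsion L
  refine units_index h2 (Units.map (k.σ : 𝓞 L →* 𝓞 L)) ?_
  intro x
  obtain ⟨r, hr⟩ := k.Nm_fix (x : 𝓞 L)
  have hun : IsUnit (algebraMap (𝓞 F) (𝓞 L) r) := by
    rw [hr]
    have : ((x * Units.map (k.σ : 𝓞 L →* 𝓞 L) x * Units.map (k.σ : 𝓞 L →* 𝓞 L) (Units.map (k.σ : 𝓞 L →* 𝓞 L) x) : (𝓞 L)ˣ) : 𝓞 L) = k.Nm x := rfl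
    rw [← this]; exact Units.isUnit _
  have hur : IsUnit r := by
    obtain ⟨s, hs⟩ := k.Nm_fix ((x⁻¹ : (𝓞 L)ˣ) : 𝓞 L)
    apply IsUnit.of_mul_eq_one s
    apply k.hinj
    rw [map_mul, hr, hs, ← k.Nm_mul, Units.mul_inv, map_one]
    simp [Kum.Nm]
  rw [isOfFinOrder_iff_pow_eq_one]
  refine ⟨6, by norm_num, ?_⟩
  ext1
  rw [Units.val_pow_eq_pow_val]
  change (k.Nm x) ^ 6 = 1
  rw [← hr]
  obtain ⟨i, hi | hi⟩ := k.hunits r hur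
  · rw [hi, ← map_pow, ← pow_mul, show i * 6 = 3 * (2 * i) by ring, pow_mul, k.z3, one_pow, map_one]
  · rw [hi, ← map_pow, Even.neg_pow (by decide), ← pow_mul, show i * 6 = 3 * (2 * i) by ring, pow_mul, k.z3, one_pow, map_one]

end Build

theorem nine_D {S : Type*} [CommRing S] {t : S} (ht : t ^ 6 + t ^ 3 + 1 = 0) (a b c : S) :
    (a + b * t + c * t ^ 2) ^ 2 * (a + b * t ^ 7 + c * t ^ 14)
      + (a + b * t ^ 4 + c * t ^ 8) ^ 2 * (a + b * t + c * t ^ 2)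
      + (a + b * t ^ 7 + c * t ^ 14) ^ 2 * (a + b * t ^ 4 + c * t ^ 8)
      - 3 * (a + b * t + c * t ^ 2) * (a + b * t ^ 4 + c * t ^ 8) * (a + b * t ^ 7 + c * t ^ 14)
      = t ^ 3 * (t ^ 3 - 1) ^ 3 * dpoly (t ^ 3) a b c := by
  unfold dpoly
  linear_combination (t^30 * c^3 - t^27 * c^3 + t^26 * b * c^2 + t^23 * b * c^2 + t^22 * a * c^2 + t^21 * c^3 - 2 * t^20 * b * c^2 - t^19 * a * c^2 + 2 * t^19 * b^2 * c - 4 * t^18 * c^3 - 2 * t^17 * b * c^2 - t^16 * a * c^2 - t^16 * b^2 * c + 2 * t^15 * a * b * c + 3 * t^15 * c^3 + t^14 * b * c^2 + 2 * t^13 * a * c^2 - 4 * t^13 * b^2 * c - 4 * t^12 * a * b * c + t^12 * b^3 + 3 * t^12 * c^3 + t^11 * b * c^2 - t^10 * a * c^2 + 3 * t^10 * b^2 * c + 4 * t^9 * a * b * c - 2 * t^9 * b^3 - 6 * t^9 * c^3 + t^8 * a * b^2 - t^7 * a * c^2 - 4 * t^6 * a * b * c + t^6 * b^3 + 4 * t^6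 * c^3 - 2 * t^5 * a * b^2 + t^4 * a * c^2 + 2 * t^3 * a * b * c - t^3 * c^3 + t^2 * a * b^2) * ht

theorem nine_N {S : Type*} [CommRing S] {t : S} (ht : t ^ 6 + t ^ 3 + 1 = 0) (a b c : S) :
    (a + b * t + c * t ^ 2) * (a + b * t ^ 4 + c * t ^ 8) * (a + b * t ^ 7 + c * t ^ 14)
      = npoly (t ^ 3) a b c := by
  unfold npoly
  linear_combination (t^18 * c^3 + t^17 * b * c^2 + t^16 * a * c^2 - t^15 * c^3 - t^13 * a * c^2 + t^13 * b^2 * c + t^12 * a * b * c + t^10 * a * c^2 + t^9 * a * b * c + t^9 * c^3 + t^8 * a^2 * c - 2 * t^6 * a * b * c + t^6 * b^3 - t^6 * c^3 - t^5 * a^2 * c + t^5 * a * b^2 + 3 * t^3 * a * b * c - t^3 * b^3 + t^2 * a^2 * c + t * a^2 * b) * ht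

theorem nine_lam {R : Type*} [CommRing R] {z : R} (hz : z ^ 2 + z + 1 = 0) (a b c : R) :
    ∃ e, npoly z (1 + (z - 1) * a) ((z - 1) * b) ((z - 1) * c) = 1 + (z - 1) ^ 3 * e := by
  refine ⟨-z^2*a-z^2*(z-1)*a^2+a^3+z*b^3+z^2*c^3+z^3*(z-1)*(1 + (z - 1) * a)*b*c, ?_⟩
  unfold npoly
  linear_combination (- z^6 * a * b * c + 6 * z^5 * a * b * c - z^5 * b * c + z^4 * a^2 - 15 * z^4 * a * b * c + 5 * z^4 * b * c - 5 * z^3 * a^2 + 19 * z^3 * a * b * c + z^3 * a - 10 * z^3 * b * c + 10 * z^2 * a^2 - 12 * z^2 * a * b * c - 4 * z^2 * a + 9 * z^2 * b * c - 9 * z * a^2 + 3 * z * a * b * c + 6 * z * a - 3 * z * b * c + 3 * a^2 - 3 * a) * hz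

theorem nine_unit18 {Q : Type*} [CommRing Q] {t : Q} (ht : t ^ 3 = 1) (h3 : (3 : Q) = 0)
    (n0 n1 n2 : ℕ) (h0 : n0 < 3) (h1 : n1 < 3) (h2 : n2 < 3) (hs : (n0 + n1 + n2) % 3 ≠ 0) :
    ∃ (s : ℤ) (i j : ℕ), (s = 1 ∨ s = -1) ∧
      (s : Q) * t ^ i * (1 + t ^ 2) ^ j * (n0 + n1 * t + n2 * t ^ 2) = 1 := by
  interval_cases n0 <;> interval_cases n1 <;> interval_cases n2
  · exact absurd hs (by decide)
  · exact ⟨1, 1, 0, by simp, by push_cast; linear_combination (1) * ht + (0) * h3⟩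
  · exact ⟨-1, 1, 0, by simp, by push_cast; linear_combination (- 2) * ht + (- 1) * h3⟩
  · exact ⟨1, 2, 0, by simp, by push_cast; linear_combination (1) * ht + (0) * h3⟩
  · exact ⟨-1, 1, 2, by simp, by push_cast; linear_combination (- t^4 - t^3 - 2 * t^2 - 3 * t - 2) * ht + (- t^2 - t - 1) * h3⟩
  · exact absurd hs (by decide)
  · exact ⟨-1, 2, 0, by simp, by push_cast; linear_combination (- 2) * ht + (- 1) * h3⟩
  · exact absurd hs (by decide)
  · exact ⟨1, 1, 2, by simp, by push_cast; linear_combination (2 * t^4 + 2 * t^3 + 4 * t^2 + 6 * t + 4) * ht + (2 * t^2 + 2 * t + 1) * h3⟩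
  · exact ⟨1, 0, 0, by simp, by push_cast; linear_combination (0) * ht + (0) * h3⟩
  · exact ⟨-1, 0, 2, by simp, by push_cast; linear_combination (- t^3 - 3 * t - 1) * ht + (- t^2 - t - 1) * h3⟩
  · exact absurd hs (by decide)
  · exact ⟨-1, 2, 2, by simp, by push_cast; linear_combination (- t^4 - t^3 - 2 * t^2 - 3 * t - 2) * ht + (- t^2 - t - 1) * h3⟩
  · exact absurd hs (by decide)
  · exact ⟨-1, 0, 1, by simp, by push_cast; linear_combination (- 2 * t - 1) * ht + (- t^2 - t - 1) * h3⟩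
  · exact absurd hs (by decide)
  · exact ⟨-1, 1, 1, by simp, by push_cast; linear_combination (- t^2 - 2 * t - 2) * ht + (- t^2 - t - 1) * h3⟩
  · exact ⟨1, 2, 1, by simp, by push_cast; linear_combination (2 * t^3 + 2 * t^2 + 3 * t + 4) * ht + (t^2 + t + 1) * h3⟩
  · exact ⟨-1, 0, 0, by simp, by push_cast; linear_combination (0) * ht + (- 1) * h3⟩
  · exact absurd hs (by decide)
  · exact ⟨1, 0, 2, by simp, by push_cast; linear_combination (2 * t^3 + 6 * t + 2) * ht + (2 * t^2 + 2 * t + 1) * h3⟩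
  · exact absurd hs (by decide)
  · exact ⟨-1, 2, 1, by simp, by push_cast; linear_combination (- t^3 - t^2 - 3 * t - 2) * ht + (- t^2 - t - 1) * h3⟩
  · exact ⟨1, 1, 1, by simp, by push_cast; linear_combination (2 * t^2 + t + 4) * ht + (t^2 + t + 1) * h3⟩
  · exact ⟨1, 2, 2, by simp, by push_cast; linear_combination (2 * t^4 + 2 * t^3 + 4 * t^2 + 6 * t + 4) * ht + (2 * t^2 + 2 * t + 1) * h3⟩
  · exact ⟨1, 0, 1, by simp, by push_cast; linear_combination (t + 2) * ht + (t^2 + t + 1) * h3⟩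
  · exact absurd hs (by decide)

/-- the abstract ring of integers of the ninth cyclotomic field -/
structure Nine (R S : Type*) [CommRing R] [CommRing S] [IsDomain R] [IsPrincipalIdealRing R]
    [Module.Free ℤ R] where
  z : R
  hz : z ^ 2 + z + 1 = 0
  θ : S
  hθ : θ ^ 6 + θ ^ 3 + 1 = 0
  j : R →+* S
  hj : Function.Injective j
  hjz : j z = θ ^ 3
  g : S ≃+* S
  hg : g θ = θ ^ 2
  c : R →+* R
  hc : c z = z ^ 2
  repR : ∀ r : R, ∃ x y : ℤ, r = x + y * z
  repS : ∀ s : S, ∃ a b d : R, s = j a + j b * θ + j d * θ ^ 2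
  lift : ∀ (n : ℕ) (r : ZMod n), r ^ 6 + r ^ 3 + 1 = 0 → ∃ φ : S →+* ZMod n, φ θ = r
  hroot : ∀ η : S, η * g (g (g η)) = 1 → ∃ i : ℕ, η = θ ^ i ∨ η = - θ ^ i
  hU : ∀ u : R, IsUnit u → u ^ 6 = 1
  hnorm : ∀ a : R, ((Ideal.absNorm (Ideal.span {a}) : ℕ) : R) = a * c a

namespace Nine
variable {R S : Type*} [CommRing R] [CommRing S] [IsDomain R] [IsPrincipalIdealRing R]
    [Module.Free ℤ R] [Module.Finite ℤ R] [IsDomain S] [IsPrincipalIdealRing S] [CharZero R] [CharZero S]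
    (X : Nine R S)

theorem θ9 : X.θ ^ 9 = 1 := by linear_combination (X.θ ^ 3 - 1) * X.hθ

theorem z3 : X.z ^ 3 = 1 := by linear_combination (X.z - 1) * X.hz

theorem gj (r : R) : X.g (X.j r) = X.j (X.c r) := by
  obtain ⟨x, y, rfl⟩ := X.repR r
  simp [X.hjz, X.hg, X.hc]; left; ring

theorem cc (r : R) : X.c (X.c r) = r := by
  obtain ⟨x, y, rfl⟩ := X.repR r
  simp only [map_add, map_mul, map_intCast, X.hc, map_pow]
  linear_combination (y * X.z) * X.z3

theorem ggj (r : R) : X.g (X.g (X.j r)) = X.j r := by rw [gj, gj, cc]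

/-- the powers of `g` -/
def G : ℕ → S →+* S
  | 0 => RingHom.id S
  | n + 1 => X.g.toRingHom.comp (G n)

theorem G0 (s : S) : X.G 0 s = s := rfl
theorem G1 (n : ℕ) (s : S) : X.G (n + 1) s = X.g (X.G n s) := rfl

theorem Gadd (n m : ℕ) (s : S) : X.G n (X.G m s) = X.G (n + m) s := by
  induction n with
  | zero => simp [G0]
  | succ n ih => rw [G1, ih, show n + 1 + m = n + m + 1 by ring, G1]

theorem Gθ (n : ℕ) : X.G n X.θ = X.θ ^ (2 ^ n) := by
  induction n with
  | zero => simp [G0]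
  | succ n ih => rw [G1, ih, map_pow, X.hg, ← pow_mul]; congr 1; ring

theorem Gj (n : ℕ) (r : R) : X.G (2 * n) (X.j r) = X.j r := by
  induction n with
  | zero => simp [G0]
  | succ n ih => rw [show 2 * (n + 1) = 2 * n + 1 + 1 by ring, G1, G1, ih, ggj]

theorem Gj' (n : ℕ) (r : R) : X.G (2 * n + 1) (X.j r) = X.j (X.c r) := by
  rw [G1, Gj, gj]

theorem G6 (s : S) : X.G 6 s = s := by
  obtain ⟨a, b, d, rfl⟩ := X.repS s
  have h := X.Gj 3
  norm_num at h
  have h1 : X.θ ^ 64 = X.θ := by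
    rw [show 64 = 9 * 7 + 1 by norm_num, pow_succ, pow_mul, X.θ9]; simp
  simp [h, Gθ, h1]

theorem G6' (n : ℕ) (s : S) : X.G (n + 6) s = X.G n s := by rw [← Gadd, G6]

theorem G_inj (n : ℕ) : Function.Injective (X.G n) := by
  induction n with
  | zero => exact fun a b h => h
  | succ n ih => exact fun a b h => ih (X.g.injective h)

theorem rep2 (a b d : R) : X.G 2 (X.j a + X.j b * X.θ + X.j d * X.θ ^ 2) =
    X.j a + X.j b * X.θ ^ 4 + X.j d * X.θ ^ 8 := by
  have h := X.Gj 1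
  norm_num at h
  simp [h, Gθ]; left; ring

theorem rep4 (a b d : R) : X.G 4 (X.j a + X.j b * X.θ + X.j d * X.θ ^ 2) =
    X.j a + X.j b * X.θ ^ 7 + X.j d * X.θ ^ 14 := by
  have h := X.Gj 2
  norm_num at h
  have h1 : X.θ ^ 16 = X.θ ^ 7 := by
    rw [show 16 = 9 + 7 by norm_num, pow_add, X.θ9]; simp
  simp [h, Gθ, h1]; left; ring

/-- the cubic form -/
def Df (s : S) : S := s ^ 2 * X.G 4 s + X.G 2 s ^ 2 * s + X.G 4 s ^ 2 * X.G 2 s - 3 * s * X.G 2 s * X.G 4 s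

theorem one_lam (s : S) : ∃ a b c e : R,
    X.j (npoly X.z (1 + (X.z - 1) * a) ((X.z - 1) * b) ((X.z - 1) * c)) =
      (1 + X.j (X.z - 1) * s) * X.G 2 (1 + X.j (X.z - 1) * s) * X.G 4 (1 + X.j (X.z - 1) * s) ∧
    npoly X.z (1 + (X.z - 1) * a) ((X.z - 1) * b) ((X.z - 1) * c) = 1 + (X.z - 1) ^ 3 * e ∧
    X.j (X.z * (X.z - 1) ^ 3 * dpoly X.z (1 + (X.z - 1) * a) ((X.z - 1) * b) ((X.z - 1) * c)) =
      X.Df (1 + X.j (X.z - 1) * s) := by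
  obtain ⟨a, b, c, hs⟩ := X.repS s
  obtain ⟨e, he⟩ := nine_lam X.hz a b c
  have h1 : (1 + X.j (X.z - 1) * s) = X.j (1 + (X.z - 1) * a) + X.j ((X.z - 1) * b) * X.θ + X.j ((X.z - 1) * c) * X.θ ^ 2 := by
    rw [hs]; simp only [map_add, map_mul, map_one]; ring
  have hn : ∀ a b c : R, X.j (npoly X.z a b c) = npoly (X.θ ^ 3) (X.j a) (X.j b) (X.j c) := by
    intro a b c; simp [npoly, X.hjz, map_ofNat]
  have hd : ∀ a b c : R, X.j (dpoly X.z a b c) = dpoly (X.θ ^ 3) (X.j a) (X.j b) (X.j c) := by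
    intro a b c; simp [dpoly, X.hjz]
  refine ⟨a, b, c, e, ?_, he, ?_⟩
  · rw [h1, rep2, rep4, hn, nine_N X.hθ]
  · unfold Df
    rw [h1, rep2, rep4, nine_D X.hθ, map_mul, hd, map_mul, map_pow, map_sub, X.hjz, map_one]

theorem isUnit_θ : IsUnit X.θ := IsUnit.of_mul_eq_one (X.θ ^ 8) (by rw [← X.θ9]; ring)

theorem isUnit_ε : IsUnit (1 + X.θ ^ 2) :=
  IsUnit.of_mul_eq_one (1 + X.θ ^ 4 + X.θ ^ 8 + X.θ ^ 12 + X.θ ^ 16) (by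
    linear_combination (X.θ^12 + X.θ^10 - X.θ^9 + X.θ^8 - X.θ^7 + X.θ^6 - X.θ^5 + X.θ^4 + X.θ^2) * X.hθ)

end Nine

namespace Nine
variable {R S : Type*} [CommRing R] [CommRing S] [IsDomain R] [IsPrincipalIdealRing R]
    [Module.Free ℤ R] [Module.Finite ℤ R] [IsDomain S] [IsPrincipalIdealRing S] [CharZero R] [CharZero S]
    (X : Nine R S)

theorem jlam : X.j (X.z - 1) = X.θ ^ 3 - 1 := by simp [X.hjz]

theorem red3 {Q : Type*} [CommRing Q] (f : R →+* Q) (h3 : (3 : Q) = 0) (hz : f X.z = 1) (ψ : R →+* ZMod 3)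
    (hψ : ψ X.z = 1) (a : R) :
    ∃ n : ℕ, n < 3 ∧ f a = n ∧ ψ a = n := by
  obtain ⟨x, y, rfl⟩ := X.repR a
  have h := Int.emod_add_mul_ediv (x + y) 3
  have h1 := Int.emod_nonneg (x + y) (show (3:ℤ) ≠ 0 by norm_num)
  have h2 := Int.emod_lt_of_pos (x + y) (show (3:ℤ) > 0 by norm_num)
  obtain ⟨n, hn⟩ := Int.eq_ofNat_of_zero_le h1
  have key : ∀ {Q : Type _} [CommRing Q] (f : R →+* Q) (h3 : (3 : Q) = 0) (hz : f X.z = 1), f (x + y * X.z) = n := by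
    intro Q _ f h3 hz
    simp only [map_add, map_mul, hz, map_intCast]
    rw [hn] at h
    have := congrArg (Int.cast : ℤ → Q) h
    push_cast at this
    linear_combination - this + ((x + y) / 3 : ℤ) * h3
  refine ⟨n, by omega, key f h3 hz, ?_⟩
  simp only [map_add, map_mul, hψ, map_intCast]
  rw [hn] at h
  have := congrArg (Int.cast : ℤ → ZMod 3) h
  push_cast at this
  have h3 : (3 : ZMod 3) = 0 := by decide
  linear_combination - this + ((x + y) / 3 : ℤ) * h3

theorem exists_ψ : ∃ ψ : S →+* ZMod 3, ψ X.θ = 1 := X.lift 3 1 (by decide)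

theorem exists_rho {N : ℕ} (hN : N.Prime) (hmod : N % 9 = 1) (φ : S →+* ZMod N) :
    ∃ ρ s : S, ρ = 1 + X.j (X.z - 1) * s ∧ ∀ x, φ x = 0 ↔ ρ ∣ x := by
  obtain ⟨ψ, hψ⟩ := X.exists_ψ
  obtain ⟨ρ, hρ⟩ := (IsPrincipalIdealRing.principal (RingHom.ker φ)).principal
  have hk : ∀ x, φ x = 0 ↔ ρ ∣ x := by
    intro x
    rw [← RingHom.mem_ker, hρ, Ideal.submodule_span_eq, Ideal.mem_span_singleton]
  have h1 : ψ ρ ≠ 0 := by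
    intro h
    have h2 : ρ ∣ (N : S) := (hk _).1 (by simp)
    obtain ⟨y, hy⟩ := h2
    have h3 := congrArg ψ hy
    rw [map_mul, h, zero_mul, map_natCast] at h3
    rw [ZMod.natCast_eq_zero_iff] at h3
    omega
  let mk := Ideal.Quotient.mk (Ideal.span {X.θ ^ 3 - 1})
  have hz0 : mk (X.θ ^ 3) = 1 := by
    rw [← sub_eq_zero, ← map_one mk, ← map_sub]
    exact Ideal.Quotient.eq_zero_iff_mem.2 (Ideal.mem_span_singleton_self _)
  have h3 : (3 : S ⧸ Ideal.span {X.θ ^ 3 - 1}) = 0 := by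
    have : mk 3 = 0 := Ideal.Quotient.eq_zero_iff_mem.2 (Ideal.mem_span_singleton.2
      ⟨-X.θ ^ 3 - 2, by linear_combination X.hθ⟩)
    rw [← this]; simp [map_ofNat]
  obtain ⟨a, b, d, hrep⟩ := X.repS ρ
  have hψz : ψ (X.j X.z) = 1 := by rw [X.hjz, map_pow, hψ, one_pow]
  have hmz : mk (X.j X.z) = 1 := by rw [X.hjz, hz0]
  obtain ⟨n0, l0, ha, ha'⟩ := X.red3 (mk.comp X.j) h3 hmz (ψ.comp X.j) hψz a
  obtain ⟨n1, l1, hb, hb'⟩ := X.red3 (mk.comp X.j) h3 hmz (ψ.comp X.j) hψz b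
  obtain ⟨n2, l2, hd, hd'⟩ := X.red3 (mk.comp X.j) h3 hmz (ψ.comp X.j) hψz d
  simp only [RingHom.comp_apply] at ha ha' hb hb' hd hd'
  have hs : (n0 + n1 + n2) % 3 ≠ 0 := by
    intro h
    apply h1
    rw [hrep]
    simp only [map_add, map_mul, map_pow, hψ, ha', hb', hd']
    have : ((n0 + n1 + n2 : ℕ) : ZMod 3) = 0 := by
      rw [ZMod.natCast_eq_zero_iff]; omega
    push_cast at this
    linear_combination this
  rw [map_pow] at hz0
  obtain ⟨s, i, l, hs1, hs2⟩ := nine_unit18 hz0 h3 n0 n1 n2 l0 l1 l2 hs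
  let u : S := (s : S) * X.θ ^ i * (1 + X.θ ^ 2) ^ l
  have hu : IsUnit u := by
    refine (IsUnit.mul ?_ (X.isUnit_θ.pow _)).mul (X.isUnit_ε.pow _)
    rcases hs1 with rfl | rfl <;> simp
  have hmu : mk (u * ρ - 1) = 0 := by
    rw [hrep]
    simp only [map_sub, map_mul, map_one, map_add, map_pow, u, map_intCast, ha, hb, hd]
    rw [hs2]; simp
  obtain ⟨w, hw⟩ := Ideal.mem_span_singleton.1 (Ideal.Quotient.eq_zero_iff_mem.1 hmu)
  refine ⟨u * ρ, w, ?_, ?_⟩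
  · rw [jlam, ← hw]; ring
  · intro x; rw [hk, hu.mul_left_dvd]

/-- the data of a prime above `N` -/
structure Rho (N : ℕ) where
  hN : N.Prime
  hmod : N % 9 = 1
  φ : S →+* ZMod N
  ρ : S
  s : S
  hρ : ρ = 1 + X.j (X.z - 1) * s
  hk : ∀ x, φ x = 0 ↔ ρ ∣ x
  hord : orderOf (φ X.θ) = 9

variable {X} {N : ℕ} (Y : X.Rho N)

namespace Rho

theorem ne0 : Y.ρ ≠ 0 := by
  intro h
  have h1 : Y.ρ ∣ (N : S) := (Y.hk _).1 (by simp)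
  rw [h, zero_dvd_iff] at h1
  exact Y.hN.ne_zero (by exact_mod_cast h1)

theorem prime : Prime Y.ρ := by
  haveI := Fact.mk Y.hN
  refine ⟨Y.ne0, ?_, ?_⟩
  · intro h
    have := (Y.hk 1).2 h.dvd
    simp at this
  · intro a b hab
    rw [← Y.hk, map_mul, mul_eq_zero, Y.hk, Y.hk] at hab
    exact hab

/-- conjugates -/
def r (i : ℕ) : S := X.G i Y.ρ

theorem rN (i : ℕ) : Y.r i ∣ (N : S) := by
  have h1 : Y.ρ ∣ (N : S) := (Y.hk _).1 (by simp)
  have := map_dvd (X.G i) h1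
  rw [map_natCast] at this
  exact this

theorem φr {i : ℕ} (h0 : 0 < i) (h6 : i < 6) : Y.φ (Y.r i) ≠ 0 := by
  haveI := Fact.mk Y.hN
  intro h
  obtain ⟨n, hn⟩ := ZMod.intCast_surjective (Y.φ X.θ)
  have h1 : Y.φ (X.θ - n) = 0 := by rw [map_sub, map_intCast, hn, sub_self]
  obtain ⟨y, hy⟩ := (Y.hk _).1 h1
  have h2 := congrArg (fun x => Y.φ (X.G i x)) hy
  simp only [map_mul, map_sub, map_intCast, X.Gθ, map_pow] at h2
  rw [show Y.φ (X.G i Y.ρ) = 0 from h, zero_mul, hn, sub_eq_zero] at h2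
  have h3 : Y.φ X.θ ^ (2 ^ i) = Y.φ X.θ ^ 1 := by rw [h2, pow_one]
  have hne : Y.φ X.θ ≠ 0 := by
    intro h; have := Y.hord; rw [h] at this; simp at this
  rw [← Units.val_mk0 hne, ← Units.val_pow_eq_pow_val, ← Units.val_pow_eq_pow_val, Units.ext_iff.symm, pow_inj_mod, ← orderOf_units, Units.val_mk0, Y.hord] at h3
  interval_cases i <;> simp at h3

theorem Gdvd (i : ℕ) {a b : S} : X.G i a ∣ X.G i b ↔ a ∣ b := by
  constructor
  · intro h
    have h1 := map_dvd (X.G (5 * i)) h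
    have h2 : ∀ x, X.G (5 * i) (X.G i x) = x := by
      intro x
      rw [X.Gadd, show 5 * i + i = 6 * i by ring]
      clear h h1
      induction i with
      | zero => rfl
      | succ i ih => rw [show 6 * (i + 1) = 6 * i + 6 by ring, X.G6', ih]
    rwa [h2, h2] at h1
  · exact fun h => map_dvd _ h

/-- divisibility by conjugates -/
theorem r_dvd {i l : ℕ} (h : (i + l) % 6 = 0) {x : S} (hx : Y.φ (X.G l x) = 0) : Y.r i ∣ x := by
  have h1 : X.G (i + l) x = x := by
    obtain ⟨q, hq⟩ := Nat.dvd_of_mod_eq_zero h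
    rw [hq]
    clear hq h hx
    induction q with
    | zero => rfl
    | succ i ih => rw [show 6 * (i + 1) = 6 * i + 6 by ring, X.G6', ih]
  rw [Y.hk, ← Gdvd (X := X) i, X.Gadd, h1] at hx
  exact hx

theorem r_prime (i : ℕ) : Prime (Y.r i) := by
  have : ∀ i, Prime (X.G i Y.ρ) := by
    intro i
    induction i with
    | zero => exact Y.prime
    | succ i ih => rw [X.G1]; exact (MulEquiv.prime_iff X.g.toMulEquiv).2 ih
  exact this i

theorem r_cop {i l : ℕ} (h : i < l) (h6 : l < 6) : IsCoprime (Y.r i) (Y.r l) := by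
  rw [Prime.coprime_iff_not_dvd (Y.r_prime i)]
  intro h1
  have h2 : Y.r l = X.G i (Y.r (l - i)) := by
    unfold r; rw [X.Gadd]; congr 2; omega
  rw [h2, r, Gdvd, ← Y.hk] at h1
  exact Y.φr (by omega) (by omega) h1

theorem prod3_dvd {x : S} {i l n : ℕ} (h1 : i < l) (h2 : l < n) (h3 : n < 6) (hi : Y.r i ∣ x) (hl : Y.r l ∣ x)
    (hn : Y.r n ∣ x) : Y.r i * Y.r l * Y.r n ∣ x :=
  IsCoprime.mul_dvd (IsCoprime.mul_left (Y.r_cop (h1.trans h2) h3) (Y.r_cop h2 h3))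
    (IsCoprime.mul_dvd (Y.r_cop h1 (by omega)) hi hl) hn

theorem prod6_dvd : (Y.r 0 * Y.r 2 * Y.r 4) * (Y.r 1 * Y.r 3 * Y.r 5) ∣ (N : S) := by
  apply IsCoprime.mul_dvd _ (Y.prod3_dvd (by norm_num) (by norm_num) (by norm_num) (Y.rN _) (Y.rN _) (Y.rN _))
    (Y.prod3_dvd (by norm_num) (by norm_num) (by norm_num) (Y.rN _) (Y.rN _) (Y.rN _))
  have c := @r_cop _ _ _ _ _ _ _ _ _ _ _ _ _ _ Y
  refine IsCoprime.mul_left (IsCoprime.mul_left ?_ ?_) ?_ <;>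
  refine IsCoprime.mul_right (IsCoprime.mul_right ?_ ?_) ?_ <;>
  first
  | (refine c ?_ ?_ <;> omega)
  | (refine IsCoprime.symm (c ?_ ?_) <;> omega)

end Rho
end Nine

namespace Nine
variable {R S : Type*} [CommRing R] [CommRing S] [IsDomain R] [IsPrincipalIdealRing R]
    [Module.Free ℤ R] [Module.Finite ℤ R] [IsDomain S] [IsPrincipalIdealRing S] [CharZero R] [CharZero S]
    {X : Nine R S}

theorem nat_unit (X : Nine R S) {t : ℕ} {s : S} (h : (t : S) * s = 1) : t = 1 := by
  obtain ⟨a, b, d, hs⟩ := X.repS s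
  have h2 := congrArg (X.G 2) h
  have h4 := congrArg (X.G 4) h
  rw [hs, map_mul, X.rep2, map_natCast, map_one] at h2
  rw [hs, map_mul, X.rep4, map_natCast, map_one] at h4
  rw [hs] at h
  have h1 : X.j (3 * (t * a)) = X.j 3 := by
    simp only [map_mul, map_ofNat, map_natCast]
    have h5 : X.θ ^ 14 = X.θ ^ 5 := by
      rw [show 14 = 9 + 5 by norm_num, pow_add, X.θ9]; simp
    rw [h5] at h4
    linear_combination h + h2 + h4 - t * (X.j b * X.θ + X.j d * X.θ ^ 2) * X.hθ
  have h3 : (t : R) * a = 1 := by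
    have := X.hj h1
    have h30 : (3 : R) ≠ 0 := by norm_num
    apply mul_left_cancel₀ h30; rw [this, mul_one]
  have h6 := X.hU t (IsUnit.of_mul_eq_one _ h3)
  have h7 : t ^ 6 = 1 := by exact_mod_cast h6
  simpa using h7

theorem Df_inv (X : Nine R S) {y : S} (e0 : X.G 3 y = y) : X.G 3 (X.Df y) = X.Df y := by
  have e2 : X.G 3 (X.G 2 y) = X.G 2 y := by
    rw [X.Gadd, show 3 + 2 = 2 + 3 by norm_num, ← X.Gadd, e0]
  have e4 : X.G 3 (X.G 4 y) = X.G 4 y := by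
    rw [X.Gadd, show 3 + 4 = 4 + 3 by norm_num, ← X.Gadd, e0]
  unfold Df
  simp only [map_add, map_sub, map_mul, map_pow, map_ofNat, e0, e2, e4]

variable {N : ℕ} (Y : X.Rho N)

namespace Rho

theorem norm_pi {π : R} (h : X.j π = Y.r 0 * Y.r 2 * Y.r 4) :
    X.j (X.c π) = Y.r 1 * Y.r 3 * Y.r 5 ∧ π * X.c π = N ∧ Ideal.absNorm (Ideal.span {π}) = N ∧ Prime π ∧
    (∀ a, Y.φ (X.j a) = 0 ↔ π ∣ a) ∧ IsCoprime π (X.c π) := by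
  haveI := Fact.mk Y.hN
  have h1 : X.j (X.c π) = Y.r 1 * Y.r 3 * Y.r 5 := by
    rw [← X.gj, h, map_mul, map_mul]; rfl
  have hφ0 : Y.φ (X.j π) = 0 := by
    rw [h, Y.hk]; exact ⟨Y.r 2 * Y.r 4, by rw [mul_assoc]; rfl⟩
  have h2 := X.hnorm π
  set n0 := Ideal.absNorm (Ideal.span {π}) with hn0
  have h3 : N ∣ n0 := by
    rw [← ZMod.natCast_eq_zero_iff]
    rw [← map_natCast (Y.φ.comp X.j), h2, map_mul, RingHom.comp_apply, hφ0, zero_mul]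
  obtain ⟨t, ht⟩ := h3
  have h4 := Y.prod6_dvd
  rw [← h1, ← h, ← map_mul, ← h2, map_natCast] at h4
  obtain ⟨y, hy⟩ := h4
  have ht1 : t = 1 := by
    apply X.nat_unit (s := y)
    have hN0 : (N : S) ≠ 0 := by exact_mod_cast Y.hN.ne_zero
    apply mul_left_cancel₀ hN0
    rw [← mul_assoc, ← Nat.cast_mul, ← ht, ← hy, mul_one]
  rw [ht1, mul_one] at ht
  have hpr : Prime π := by
    have : (Ideal.span {π}).IsPrime := by
      apply Ideal.isPrime_of_irreducible_absNorm
      rw [← hn0, ht]; exact Y.hN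
    refine (Ideal.span_singleton_prime ?_).1 this
    rintro rfl
    apply Y.hN.ne_zero
    rw [← ht, hn0]; simp
  have hker : ∀ a, Y.φ (X.j a) = 0 ↔ π ∣ a := by
    intro a
    constructor
    · intro ha
      by_contra hc
      rw [← Prime.coprime_iff_not_dvd hpr] at hc
      obtain ⟨u, v, huv⟩ := hc
      have := congrArg (fun x => Y.φ (X.j x)) huv
      simp [hφ0, ha] at this
    · rintro ⟨y, rfl⟩
      rw [map_mul, map_mul, hφ0, zero_mul]
  refine ⟨h1, by rw [← h2, ht], ht, hpr, hker, ?_⟩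
  rw [Prime.coprime_iff_not_dvd hpr, ← hker, h1, map_mul, map_mul]
  have := fun i => @φr _ _ _ _ _ _ _ _ _ _ _ _ _ _ Y i
  exact mul_ne_zero (mul_ne_zero (this 1 (by norm_num) (by norm_num)) (this 3 (by norm_num) (by norm_num)))
    (this 5 (by norm_num) (by norm_num))

theorem main1 : ∃ π e a b c a' b' c' : R, X.j π = Y.r 0 * Y.r 2 * Y.r 4 ∧ π = 1 + (X.z - 1) ^ 3 * e ∧
    npoly X.z (1 + (X.z - 1) * a) ((X.z - 1) * b) ((X.z - 1) * c) = π ∧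
    npoly X.z (1 + (X.z - 1) * a') ((X.z - 1) * b') ((X.z - 1) * c') = N ∧
    Y.φ (X.j (X.z * (X.z - 1) ^ 3 * dpoly X.z (1 + (X.z - 1) * a) ((X.z - 1) * b) ((X.z - 1) * c))) =
      Y.φ (Y.r 4) ^ 2 * Y.φ (Y.r 2) ∧
    Y.φ (X.j (X.z * (X.z - 1) ^ 3 * dpoly X.z (1 + (X.z - 1) * a') ((X.z - 1) * b') ((X.z - 1) * c'))) =
      (Y.φ (Y.r 4) * Y.φ (Y.r 1)) ^ 2 * (Y.φ (Y.r 2) * Y.φ (Y.r 5)) ∧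
    Y.φ (X.j (X.c (X.z * (X.z - 1) ^ 3 * dpoly X.z (1 + (X.z - 1) * a') ((X.z - 1) * b') ((X.z - 1) * c')))) =
      (Y.φ (Y.r 4) * Y.φ (Y.r 1)) ^ 2 * (Y.φ (Y.r 2) * Y.φ (Y.r 5)) := by
  haveI := Fact.mk Y.hN
  obtain ⟨a, b, c, e, h1, h2, h3⟩ := X.one_lam Y.s
  rw [← Y.hρ] at h1 h3
  obtain ⟨hc, hN, -⟩ := Y.norm_pi h1
  have hφ0 : Y.φ Y.ρ = 0 := by rw [Y.hk]
  let s' : S := Y.s + X.j (X.z + 1) * X.G 3 Y.s + X.j (X.z - 1) * X.j (X.z + 1) * Y.s * X.G 3 Y.s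
  have hϖ : 1 + X.j (X.z - 1) * s' = Y.ρ * X.G 3 Y.ρ := by
    rw [Y.hρ, map_add, map_mul, map_one, show 3 = 2 * 1 + 1 by norm_num, X.Gj']
    have : X.c (X.z - 1) = (X.z - 1) * (X.z + 1) := by rw [map_sub, X.hc, map_one]; ring
    rw [this, map_mul]
    simp only [s']
    ring
  obtain ⟨a', b', c', e', h1', h2', h3'⟩ := X.one_lam s'
  rw [hϖ] at h1' h3'
  have e3 : ∀ i, X.G i (Y.ρ * X.G 3 Y.ρ) = Y.r i * Y.r (i + 3) := by
    intro i; rw [map_mul, X.Gadd]; rfl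
  have e71 : Y.r (4 + 3) = Y.r 1 := X.G6' 1 _
  have hDf : ∀ y : S, Y.φ y = 0 → Y.φ (X.Df y) = Y.φ (X.G 4 y) ^ 2 * Y.φ (X.G 2 y) := by
    intro y hy; unfold Df; simp only [map_add, map_sub, map_mul, map_pow, hy]; ring
  refine ⟨_, e, a, b, c, a', b', c', h1, h2, rfl, ?_, ?_, ?_, ?_⟩
  · apply X.hj
    rw [h1', e3, e3, ← hN, map_mul, h1, hc, e71]
    rw [show X.G 3 Y.ρ = Y.r 3 from rfl, show X.G 2 Y.ρ = Y.r 2 from rfl, show X.G 4 Y.ρ = Y.r 4 from rfl]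
    norm_num
    ring
  · rw [h3, hDf _ hφ0]; rfl
  · rw [h3', hDf _ (by rw [map_mul, hφ0, zero_mul]), e3, e3, e71, map_mul, map_mul]
  · rw [← X.Gj' 1, h3']
    have : X.G (2 * 1 + 1) (X.Df (Y.ρ * X.G 3 Y.ρ)) = X.Df (Y.ρ * X.G 3 Y.ρ) := by
      have e0 : X.G 3 (Y.ρ * X.G 3 Y.ρ) = Y.ρ * X.G 3 Y.ρ := by
        rw [map_mul, X.Gadd, X.G6, mul_comm]
      exact X.Df_inv e0
    rw [this, hDf _ (by rw [map_mul, hφ0, zero_mul]), e3, e3, e71, map_mul, map_mul]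

end Rho
end Nine

section ZN
open Finset
variable {N : ℕ}

theorem zn_wilson (hN : N.Prime) (j : ℕ) (hj : j ≤ N - 1) :
    ((j.factorial * (N - 1 - j).factorial : ℕ) : ZMod N) = (-1) ^ (j + 1) := by
  haveI := Fact.mk hN
  induction j with
  | zero => simp [ZMod.wilsons_lemma]
  | succ j ih =>
    have h := ih (by omega)
    have h1 : N - 1 - j = (N - 1 - (j + 1)) + 1 := by omega
    rw [h1, Nat.factorial_succ] at h
    have h2 : ((N - 1 - (j + 1) + 1 : ℕ) : ZMod N) = - ((j + 1 : ℕ) : ZMod N) := by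
      rw [eq_neg_iff_add_eq_zero, ← Nat.cast_add, show N - 1 - (j + 1) + 1 + (j + 1) = N by omega]; simp
    rw [Nat.factorial_succ, pow_succ, ← h]
    push_cast at h2 ⊢
    linear_combination (j.factorial : ZMod N) * (N - 1 - (j + 1)).factorial * h2

theorem zn_sum_pow (hN : N.Prime) [NeZero N] {i : ℕ} (hi : 0 < i) :
    ∑ x : ZMod N, x ^ i = if N - 1 ∣ i then -1 else 0 := by
  haveI := Fact.mk hN
  have h := FiniteField.sum_pow_units (ZMod N) i
  rw [ZMod.card] at h
  rw [← h]
  rw [← Finset.sum_subset (Finset.subset_univ (univ.map ⟨fun x : (ZMod N)ˣ => (x : ZMod N), Units.val_injective⟩))]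
  · rw [Finset.sum_map]; rfl
  · intro x _ hx
    by_cases h0 : x = 0
    · rw [h0, zero_pow hi.ne']
    · exact absurd (Finset.mem_map.2 ⟨Units.mk0 x h0, mem_univ _, rfl⟩) hx

theorem zn_jac (hN : N.Prime) [NeZero N] {u v : ℕ} (hu : 0 < u) (hu' : u < N - 1) (hv : v < N - 1) :
    ∑ x : ZMod N, x ^ u * (1 - x) ^ v = - ((-1) ^ (N - 1 - u) * (v.choose (N - 1 - u) : ℕ)) := by
  haveI := Fact.mk hN
  have h1 : ∀ x : ZMod N, x ^ u * (1 - x) ^ v = ∑ m ∈ range (v + 1), ((-1) ^ m * (v.choose m : ℕ)) * x ^ (u + m) := by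
    intro x
    rw [sub_eq_add_neg, add_comm, add_pow, mul_sum]
    apply sum_congr rfl
    intro m _
    rw [one_pow, neg_pow]; ring
  simp_rw [h1]
  rw [sum_comm]
  simp_rw [← mul_sum]
  have h2 : ∀ m ∈ range (v + 1), ((-1) ^ m * (v.choose m : ℕ)) * ∑ x : ZMod N, x ^ (u + m) =
      if m = N - 1 - u then - ((-1) ^ m * ((v.choose m : ℕ) : ZMod N)) else 0 := by
    intro m hm
    rw [mem_range] at hm
    rw [zn_sum_pow hN (by omega)]
    by_cases h : m = N - 1 - u
    · rw [if_pos h, if_pos (by rw [h, show u + (N - 1 - u) = N - 1 by omega])]; ring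
    · rw [if_neg h, if_neg, mul_zero]
      intro hd
      obtain ⟨q, hq⟩ := hd
      have : q = 1 := by
        rcases q with _ | _ | q
        · omega
        · rfl
        · exfalso
          have : (N - 1) * (q + 1 + 1) ≥ (N - 1) * 2 := Nat.mul_le_mul_left _ (by omega)
          omega
      rw [this] at hq; omega
  rw [sum_congr rfl h2, sum_ite_eq']
  by_cases h : N - 1 - u ∈ range (v + 1)
  · rw [if_pos h]
  · rw [if_neg h, Nat.choose_eq_zero_of_lt (by rw [mem_range] at h; omega)]; simp

end ZN

namespace Nine
variable {R S : Type*} [CommRing R] [CommRing S] [IsDomain R] [IsPrincipalIdealRing R]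
    [Module.Free ℤ R] [Module.Finite ℤ R] [IsDomain S] [IsPrincipalIdealRing S] [CharZero R] [CharZero S]
    (X : Nine R S)

theorem prim : IsPrimitiveRoot X.θ 9 := by
  have h1 : ¬ X.θ ^ 3 ^ 1 = 1 := by
    intro h
    have h2 := X.hθ
    rw [show X.θ ^ 6 = (X.θ ^ 3 ^ 1) ^ 2 by ring, show X.θ ^ 3 = (X.θ ^ 3 ^ 1) by ring, h] at h2
    norm_num at h2
  have := orderOf_eq_prime_pow h1 (n := 1) (p := 3) (by simpa using X.θ9)
  rw [show 9 = 3 ^ (1 + 1) by norm_num, ← this]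
  exact IsPrimitiveRoot.orderOf _

theorem prim3 : IsPrimitiveRoot (X.θ ^ 3) 3 := X.prim.pow (by norm_num) (by norm_num)

/-- character data -/
structure Om {N : ℕ} (hN : N.Prime) (k : ℕ) (φ : S →+* ZMod N) where
  hk : N = 9 * k + 1
  hev : Even k
  γ : (ZMod N)ˣ
  hγ : ∀ x, x ∈ Subgroup.zpowers γ
  hφ : φ X.θ = γ ^ k
  ω : MulChar (ZMod N) S
  hω : ω γ = X.θ

theorem exists_om {N : ℕ} (hN : N.Prime) (hmod : N % 9 = 1) : ∃ k, ∃ φ : S →+* ZMod N, orderOf (φ X.θ) = 9 ∧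
    Nonempty (X.Om hN k φ) := by
  haveI := Fact.mk hN
  obtain ⟨γ, hγ⟩ := IsCyclic.exists_generator (α := (ZMod N)ˣ)
  have hk : N = 9 * (N / 9) + 1 := by omega
  have hc : Fintype.card (ZMod N)ˣ = N - 1 := by rw [ZMod.card_units]
  have ho : orderOf γ = N - 1 := by
    rw [orderOf_eq_card_of_forall_mem_zpowers hγ, Nat.card_eq_fintype_card, hc]
  have ho' : orderOf (γ : ZMod N) = N - 1 := by rw [orderOf_units, ho]
  have hNne2 : N ≠ 2 := by intro h; rw [h] at hmod; norm_num at hmod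
  have hpos : 0 < N / 9 := by
    by_contra h
    have : N / 9 = 0 := by omega
    rw [this] at hk
    exact hN.one_lt.ne' (by omega)
  have ho9 : orderOf ((γ : ZMod N) ^ (N / 9)) = 9 := by
    rw [orderOf_pow_of_dvd (by omega) (by rw [ho']; exact ⟨9, by omega⟩), ho', show N - 1 = 9 * (N / 9) by omega,
      Nat.mul_div_cancel _ hpos]
  have hr : ((γ : ZMod N) ^ (N / 9)) ^ 6 + ((γ : ZMod N) ^ (N / 9)) ^ 3 + 1 = 0 := by
    set r := (γ : ZMod N) ^ (N / 9)
    have h9 : r ^ 9 = 1 := by rw [← ho9]; exact pow_orderOf_eq_one r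
    have h3 : r ^ 3 ≠ 1 := by
      intro h; have := orderOf_dvd_of_pow_eq_one h; rw [ho9] at this; norm_num at this
    have : (r ^ 3 - 1) * (r ^ 6 + r ^ 3 + 1) = 0 := by linear_combination h9
    exact (mul_eq_zero.1 this).resolve_left (sub_ne_zero.2 h3)
  obtain ⟨φ, hφ⟩ := X.lift N _ hr
  have hmem : X.isUnit_θ.unit ∈ rootsOfUnity (Fintype.card (ZMod N)ˣ) S := by
    rw [mem_rootsOfUnity, hc]
    ext
    rw [Units.val_pow_eq_pow_val, IsUnit.unit_spec, show N - 1 = 9 * (N / 9) by omega, pow_mul, X.θ9, one_pow]; rfl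
  refine ⟨N / 9, φ, by rw [hφ, ho9], ⟨hk, ?_, γ, hγ, hφ, MulChar.ofRootOfUnity hmem hγ, ?_⟩⟩
  · have := hN.eq_two_or_odd
    rw [Nat.even_iff]
    omega
  · rw [MulChar.ofRootOfUnity_spec]; rfl

namespace Om
variable {X} {N : ℕ} {hN : N.Prime} {k : ℕ} {φ : S →+* ZMod N} (W : X.Om hN k φ)

theorem kpos (W : X.Om hN k φ) : 0 < k := by
  have := W.hk; have := hN.one_lt
  omega

theorem ωpow (i : ℕ) : W.ω ((W.γ : ZMod N) ^ i) = X.θ ^ i := by rw [map_pow, W.hω]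

theorem elt {x : ZMod N} (hx : x ≠ 0) : ∃ i : ℕ, x = (W.γ : ZMod N) ^ i := by
  haveI := Fact.mk hN
  have := W.hγ (Units.mk0 x hx)
  rw [← mem_powers_iff_mem_zpowers] at this
  obtain ⟨i, hi⟩ := this
  exact ⟨i, by rw [← Units.val_pow_eq_pow_val]; rw [show W.γ ^ i = Units.mk0 x hx from hi]; rfl⟩

theorem φω (x : ZMod N) : φ (W.ω x) = x ^ k := by
  haveI := Fact.mk hN
  by_cases hx : x = 0
  · rw [hx, MulChar.map_zero, map_zero, zero_pow W.kpos.ne']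
  · obtain ⟨i, rfl⟩ := W.elt hx
    rw [W.ωpow, map_pow, W.hφ, ← pow_mul, ← pow_mul, mul_comm]

theorem ω9 : W.ω ^ 9 = 1 := by
  haveI := Fact.mk hN
  rw [MulChar.eq_iff W.hγ, MulChar.pow_apply_coe, W.hω, X.θ9, MulChar.one_apply_coe]

theorem ωne {a : ℕ} (h : ¬ 9 ∣ a) : W.ω ^ a ≠ 1 := by
  haveI := Fact.mk hN
  rw [Ne, MulChar.eq_iff W.hγ, MulChar.pow_apply_coe, W.hω, MulChar.one_apply_coe, X.prim.pow_eq_one_iff_dvd]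
  exact h

theorem ωG (i a : ℕ) : (W.ω ^ a).ringHomComp (X.G i) = W.ω ^ (2 ^ i * a) := by
  haveI := Fact.mk hN
  rw [MulChar.eq_iff W.hγ, MulChar.ringHomComp_apply, MulChar.pow_apply_coe, MulChar.pow_apply_coe, W.hω, map_pow,
    X.Gθ, pow_mul]

/-- Jacobi sums -/
noncomputable def J (a b : ℕ) : S := haveI := Fact.mk hN; jacobiSum (W.ω ^ a) (W.ω ^ b)

theorem GJ (i a b : ℕ) : X.G i (W.J a b) = W.J (2 ^ i * a) (2 ^ i * b) := by
  haveI := Fact.mk hN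
  unfold J
  rw [← jacobiSum_ringHomComp, W.ωG, W.ωG]

theorem ωmod (a : ℕ) : W.ω ^ a = W.ω ^ (a % 9) := by
  conv_lhs => rw [← Nat.mod_add_div a 9, pow_add, pow_mul, W.ω9, one_pow, mul_one]

theorem Jmod (a b : ℕ) : W.J a b = W.J (a % 9) (b % 9) := by
  unfold J; rw [← W.ωmod, ← W.ωmod]

theorem φJ {a b : ℕ} (ha : 0 < a) (ha' : a < 9) (hb : 0 < b) (hb' : b < 9) :
    φ (W.J a b) = - (((b * k).choose ((9 - a) * k) : ℕ) : ZMod N) := by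
  haveI := Fact.mk hN
  have hk := W.kpos
  unfold J jacobiSum
  rw [map_sum]
  have h1 : ∀ x : ZMod N, φ ((W.ω ^ a) x * (W.ω ^ b) (1 - x)) = x ^ (a * k) * (1 - x) ^ (b * k) := by
    intro x
    rw [map_mul, MulChar.pow_apply' _ ha.ne', MulChar.pow_apply' _ hb.ne', map_pow, map_pow, W.φω, W.φω, ← pow_mul, ← pow_mul,
      mul_comm k, mul_comm k]
  rw [Finset.sum_congr rfl (fun x _ => h1 x)]
  have hN1 : N - 1 = 9 * k := by have := W.hk; omega
  rw [zn_jac hN (by positivity) (by rw [hN1]; exact Nat.mul_lt_mul_of_pos_right ha' hk)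
    (by rw [hN1]; exact Nat.mul_lt_mul_of_pos_right hb' hk), hN1, ← Nat.sub_mul,
    (W.hev.mul_left _).neg_one_pow, one_mul]

theorem φJ0 {a b : ℕ} (ha : 0 < a) (ha' : a < 9) (hb : 0 < b) (hb' : b < 9) (h : a + b < 9) :
    φ (W.J a b) = 0 := by
  rw [W.φJ ha ha' hb hb', Nat.choose_eq_zero_of_lt]
  · simp
  · exact Nat.mul_lt_mul_of_pos_right (by omega) W.kpos

theorem JJ {a b : ℕ} (ha : ¬ 9 ∣ a) (hb : ¬ 9 ∣ b) (hab : ¬ 9 ∣ a + b) : W.J a b * X.G 3 (W.J a b) = N := by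
  haveI := Fact.mk hN
  have hinj : Function.Injective (algebraMap S (FractionRing S)) := IsFractionRing.injective _ _
  apply hinj
  rw [W.GJ, W.Jmod (2 ^ 3 * a)]
  have h8 : ∀ a, W.ω ^ (2 ^ 3 * a % 9) = (W.ω ^ a)⁻¹ := by
    intro a
    rw [← W.ωmod, eq_inv_iff_mul_eq_one, ← pow_add, show 2 ^ 3 * a + a = 9 * a by ring, pow_mul, W.ω9, one_pow]
  unfold J
  rw [h8, h8, map_mul, ← jacobiSum_ringHomComp, ← jacobiSum_ringHomComp]
  have hi : ∀ χ : MulChar (ZMod N) S, (χ⁻¹).ringHomComp (algebraMap S (FractionRing S)) = (χ.ringHomComp (algebraMap S (FractionRing S)))⁻¹ := by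
    intro χ
    rw [eq_inv_iff_mul_eq_one, ← MulChar.ringHomComp_mul, inv_mul_cancel, MulChar.ringHomComp_one]
  rw [hi, hi, jacobiSum_mul_jacobiSum_inv, ZMod.card, map_natCast]
  · haveI : CharZero (FractionRing S) := charZero_of_injective_algebraMap hinj
    rw [ringChar.eq_zero, ZMod.ringChar_zmod_n]
    exact hN.ne_zero.symm
  · exact (MulChar.ringHomComp_ne_one_iff hinj).2 (W.ωne ha)
  · exact (MulChar.ringHomComp_ne_one_iff hinj).2 (W.ωne hb)
  · rw [← MulChar.ringHomComp_mul, ← pow_add]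
    exact (MulChar.ringHomComp_ne_one_iff hinj).2 (W.ωne hab)

theorem Jcong (a b : ℕ) : ∃ y, W.J a b = -1 + y * (X.θ - 1) ^ 2 := by
  haveI := Fact.mk hN
  have h1 : ∀ a, (W.ω ^ a) ^ 9 = 1 := by intro a; rw [← pow_mul, mul_comm, pow_mul, W.ω9, one_pow]
  obtain ⟨y, -, hy⟩ := exists_jacobiSum_eq_neg_one_add (by norm_num) (h1 a) (h1 b)
    (by rw [ZMod.card]; exact ⟨k, by have := W.hk; omega⟩) X.prim
  exact ⟨y, hy⟩

theorem Jcong3 : ∃ y, W.J 6 6 = -1 + y * (X.θ ^ 3 - 1) ^ 2 := by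
  haveI := Fact.mk hN
  have h1 : (W.ω ^ 6) ^ 3 = 1 := by rw [← pow_mul, show 6 * 3 = 9 * 2 by norm_num, pow_mul, W.ω9, one_pow]
  obtain ⟨y, -, hy⟩ := exists_jacobiSum_eq_neg_one_add (by norm_num) h1 h1
    (by rw [ZMod.card]; exact ⟨3 * k, by have := W.hk; omega⟩) X.prim3
  exact ⟨y, hy⟩

end Om
end Nine

namespace Nine
variable {R S : Type*} [CommRing R] [CommRing S] [IsDomain R] [IsPrincipalIdealRing R]
    [Module.Free ℤ R] [Module.Finite ℤ R] [IsDomain S] [IsPrincipalIdealRing S] [CharZero R] [CharZero S]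
    {X : Nine R S}

theorem root3 {ψ : S →+* ZMod 3} {μ q : S} (h1 : μ ≠ 1) (hψ : ψ μ = 1) {i : ℕ}
    (h : μ ^ i = 1 + (μ - 1) ^ 2 * q) : 3 ∣ i := by
  have h2 := mul_geom_sum μ i
  have h3 : ∑ l ∈ Finset.range i, μ ^ l = (μ - 1) * q := by
    apply mul_left_cancel₀ (sub_ne_zero.2 h1)
    rw [h2, h]; ring
  have h4 := congrArg ψ h3
  rw [map_sum, map_mul, map_sub, hψ, map_one, sub_self, zero_mul] at h4
  simp only [map_pow, hψ, one_pow, Finset.sum_const, Finset.card_range, nsmul_eq_mul, mul_one] at h4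
  exact (ZMod.natCast_eq_zero_iff _ _).1 h4

theorem lam2 (X : Nine R S) : ∃ y, X.θ ^ 3 - 1 = (X.θ - 1) ^ 2 * y :=
  ⟨(X.θ - 1) + X.θ * (X.θ ^ 2 + X.θ + 1) * (- X.θ ^ 3 - 2), by
    linear_combination X.θ * (X.θ - 1) * X.hθ⟩

theorem eta6 (X : Nine R S) {η P w y : S} (hη : η * X.G 3 η = 1) (hP : P = 1 + X.j (X.z - 1) * w)
    (hJ : η * P = -1 + y * (X.θ - 1) ^ 2) : ∃ l : ℕ, η = - (X.θ ^ 3) ^ l := by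
  obtain ⟨ψ, hψ⟩ := X.exists_ψ
  obtain ⟨v, hv⟩ := X.lam2
  have h0 : X.θ ≠ 1 := X.prim.ne_one (by norm_num)
  rw [hP, jlam, hv] at hJ
  have hJ' : η = -1 + (X.θ - 1) ^ 2 * (y - η * v * w) := by linear_combination hJ
  obtain ⟨i, hi | hi⟩ := X.hroot η hη
  · exfalso
    have := congrArg ψ hJ'
    rw [hi] at this
    simp only [map_add, map_mul, map_sub, map_pow, map_neg, hψ, map_one] at this
    norm_num at this
    exact absurd this (by decide)
  · rw [hi] at hJ'
    obtain ⟨l, rfl⟩ := root3 (q := - (y - - X.θ ^ i * v * w)) h0 hψ (i := i) (by linear_combination - hJ')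
    exact ⟨l, by rw [hi, pow_mul]⟩

theorem eta1 (X : Nine R S) {η P w y : S} (hη : η * X.G 3 η = 1) (hP : P = 1 + X.j (X.z - 1) ^ 2 * w)
    (hJ : η * P = -1 + y * (X.θ ^ 3 - 1) ^ 2) : η = -1 := by
  obtain ⟨ψ, hψ⟩ := X.exists_ψ
  obtain ⟨v, hv⟩ := X.lam2
  have h0 : X.θ ^ 3 ≠ 1 := X.prim3.ne_one (by norm_num)
  obtain ⟨l, hl⟩ := X.eta6 (η := η) (P := P) (w := X.j (X.z - 1) * w) (y := y * (X.θ ^ 3 - 1) * v) hη (by rw [hP]; ring)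
    (by linear_combination hJ + y * (X.θ ^ 3 - 1) * hv)
  rw [hP, jlam] at hJ
  obtain ⟨m, rfl⟩ := root3 (ψ := ψ) (μ := X.θ ^ 3) (q := - (y - η * w)) h0 (by simp [hψ]) (i := l) (by
    linear_combination - hJ + hl)
  rw [hl, ← pow_mul, show 3 * (3 * m) = 9 * m by ring, pow_mul, X.θ9, one_pow]

variable {N : ℕ} (Y : X.Rho N)
namespace Rho

theorem rlam (i : ℕ) : ∃ w, Y.r i = 1 + X.j (X.z - 1) * w := by
  unfold r
  have hρ := Y.hρ
  induction i with
  | zero => exact ⟨_, Y.hρ⟩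
  | succ i ih =>
    obtain ⟨w, hw⟩ := ih
    rw [X.G1, hw, map_add, map_mul, map_one, X.gj]
    have : X.c (X.z - 1) = (X.z - 1) * (X.z + 1) := by rw [map_sub, X.hc, map_one]; ring
    rw [this, map_mul, mul_assoc]
    exact ⟨_, rfl⟩

theorem rlam3 (i l n : ℕ) : ∃ w, Y.r i * Y.r l * Y.r n = 1 + X.j (X.z - 1) * w := by
  obtain ⟨a, ha⟩ := Y.rlam i
  obtain ⟨b, hb⟩ := Y.rlam l
  obtain ⟨c, hc⟩ := Y.rlam n
  rw [ha, hb, hc]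
  refine ⟨a + b + c + X.j (X.z - 1) * (a * b + b * c + c * a) + X.j (X.z - 1) ^ 2 * (a * b * c), by ring⟩

theorem Gr (i l : ℕ) : X.G i (Y.r l) = Y.r (i + l) := X.Gadd _ _ _

theorem r6 (i : ℕ) : Y.r (i + 6) = Y.r i := X.G6' _ _

variable {k : ℕ} (W : X.Om Y.hN k Y.φ)

theorem dvdJ {a b i l : ℕ} (h : (i + l) % 6 = 0) (ha : 0 < 2 ^ l * a % 9) (hb : 0 < 2 ^ l * b % 9)
    (hab : 2 ^ l * a % 9 + 2 ^ l * b % 9 < 9) : Y.r i ∣ W.J a b := by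
  apply Y.r_dvd h
  rw [W.GJ, W.Jmod]
  exact W.φJ0 ha (Nat.mod_lt _ (by norm_num)) hb (Nat.mod_lt _ (by norm_num)) hab

theorem quo (Y : X.Rho N) {J P η : S} (hJ : J = P * η) (hJJ : J * X.G 3 J = N) (hPP : P * X.G 3 P = N) : η * X.G 3 η = 1 := by
  have hN0 : (N : S) ≠ 0 := by exact_mod_cast Y.hN.ne_zero
  apply mul_left_cancel₀ hN0
  rw [hJ, map_mul] at hJJ
  linear_combination hJJ - η * X.G 3 η * hPP

theorem N6 : Y.r 0 * Y.r 1 * Y.r 2 * Y.r 3 * Y.r 4 * Y.r 5 = N := by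
  obtain ⟨π, e, a, b, c, a', b', c', h1, -⟩ := Y.main1
  obtain ⟨hc, hN, -⟩ := Y.norm_pi h1
  have := congrArg X.j hN
  rw [map_mul, h1, hc, map_natCast] at this
  linear_combination this

theorem J8 {b : ℕ} (hb : b = 8 ∨ b = 6) : ∃ η : S, η ^ 6 = 1 ∧ W.J 8 b = η * (Y.r 1 * Y.r 2 * Y.r 3) := by
  have hd : Y.r 1 * Y.r 2 * Y.r 3 ∣ W.J 8 b := by
    apply Y.prod3_dvd (by norm_num) (by norm_num) (by norm_num)
    · apply Y.dvdJ W (l := 5) <;> rcases hb with rfl | rfl <;> norm_num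
    · apply Y.dvdJ W (l := 4) <;> rcases hb with rfl | rfl <;> norm_num
    · apply Y.dvdJ W (l := 3) <;> rcases hb with rfl | rfl <;> norm_num
  obtain ⟨η, hη⟩ := hd
  have hPP : (Y.r 1 * Y.r 2 * Y.r 3) * X.G 3 (Y.r 1 * Y.r 2 * Y.r 3) = N := by
    rw [map_mul, map_mul, Y.Gr, Y.Gr, Y.Gr, show 3 + 3 = 0 + 6 by norm_num, Y.r6, ← Y.N6]; ring
  have h1 := Y.quo hη (W.JJ (by norm_num) (by rcases hb with rfl | rfl <;> norm_num)
    (by rcases hb with rfl | rfl <;> norm_num)) hPP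
  obtain ⟨w, hw⟩ := Y.rlam3 1 2 3
  obtain ⟨y, hy⟩ := W.Jcong 8 b
  obtain ⟨l, hl⟩ := X.eta6 h1 hw (by rw [mul_comm, ← hη, hy])
  refine ⟨η, ?_, by rw [hη, mul_comm]⟩
  rw [hl, Even.neg_pow (by decide), ← pow_mul, ← pow_mul, show 3 * (l * 6) = 9 * (2 * l) by ring, pow_mul, X.θ9, one_pow]

theorem J66 {π e : R} (h : X.j π = Y.r 0 * Y.r 2 * Y.r 4) (he : π = 1 + (X.z - 1) ^ 3 * e) :
    W.J 6 6 = - X.j (X.c π) := by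
  obtain ⟨hc, -⟩ := Y.norm_pi h
  have hd : Y.r 1 * Y.r 3 * Y.r 5 ∣ W.J 6 6 := by
    apply Y.prod3_dvd (by norm_num) (by norm_num) (by norm_num)
    · apply Y.dvdJ W (l := 5) <;> norm_num
    · apply Y.dvdJ W (l := 3) <;> norm_num
    · apply Y.dvdJ W (l := 1) <;> norm_num
  obtain ⟨η, hη⟩ := hd
  have hPP : (Y.r 1 * Y.r 3 * Y.r 5) * X.G 3 (Y.r 1 * Y.r 3 * Y.r 5) = N := by
    rw [map_mul, map_mul, Y.Gr, Y.Gr, Y.Gr, show 3 + 3 = 0 + 6 by norm_num, Y.r6, show 3 + 5 = 2 + 6 by norm_num, Y.r6,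
      ← Y.N6]; ring
  have h1 := Y.quo hη (W.JJ (by norm_num) (by norm_num) (by norm_num)) hPP
  obtain ⟨y, hy⟩ := W.Jcong3
  have h2 : Y.r 1 * Y.r 3 * Y.r 5 = 1 + X.j (X.z - 1) ^ 2 * (X.j ((X.z - 1) * (X.z + 1) ^ 3 * X.c e)) := by
    rw [← hc, he, map_add, map_one, map_mul, map_pow]
    have : X.c (X.z - 1) = (X.z - 1) * (X.z + 1) := by rw [map_sub, X.hc, map_one]; ring
    rw [this, map_add, map_one, ← map_pow, ← map_mul]
    congr 2; ring
  have h3 := X.eta1 h1 h2 (by rw [mul_comm, ← hη, hy])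
  rw [hη, h3, hc]; ring

end Rho
end Nine

theorem uniq_AB {N : ℕ} (hN : N.Prime) {A B A0 B0 : ℤ} (h : (4 * N : ℤ) = A ^ 2 + 27 * B ^ 2)
    (h0 : (4 * N : ℤ) = A0 ^ 2 + 27 * B0 ^ 2) : A = A0 ∨ A = - A0 := by
  have hNp : Prime (N : ℤ) := Nat.prime_iff_prime_int.1 hN
  have hNpos : (0 : ℤ) < N := by exact_mod_cast hN.pos
  have key : ∀ B0 : ℤ, (4 * N : ℤ) = A0 ^ 2 + 27 * B0 ^ 2 → (N : ℤ) ∣ A * B0 - A0 * B → A = A0 ∨ A = -A0 := by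
    intro B0 h0 hd
    have h1 : 16 * (N : ℤ) ^ 2 = (A * A0 + 27 * B * B0) ^ 2 + 27 * (A * B0 - A0 * B) ^ 2 := by
      linear_combination (4 * N : ℤ) * h + (A ^ 2 + 27 * B ^ 2) * h0
    have h2 : A * B0 - A0 * B = 0 := by
      apply Int.eq_zero_of_abs_lt_dvd hd
      apply abs_lt_of_sq_lt_sq _ hNpos.le
      nlinarith [sq_nonneg (A * A0 + 27 * B * B0)]
    have h3 : 4 * (N : ℤ) * (B0 ^ 2 - B ^ 2) = 0 := by
      linear_combination (A * B0 + A0 * B) * h2 + B0 ^ 2 * h - B ^ 2 * h0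
    have h4 : B0 ^ 2 - B ^ 2 = 0 := by
      rcases mul_eq_zero.1 h3 with h | h
      · omega
      · exact h
    apply sq_eq_sq_iff_eq_or_eq_neg.1
    linear_combination - h + h0 + 27 * h4
  have h3 : (N : ℤ) ∣ (A * B0 - A0 * B) * (A * B0 + A0 * B) :=
    ⟨4 * (B0 ^ 2 - B ^ 2), by linear_combination - B0 ^ 2 * h + B ^ 2 * h0⟩
  rcases hNp.dvd_or_dvd h3 with hd | hd
  · exact key B0 h0 hd
  · refine key (-B0) (by rw [h0]; ring) ?_
    rw [show A * -B0 - A0 * B = -(A * B0 + A0 * B) by ring]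
    exact hd.neg_right

namespace Nine
variable {R S : Type*} [CommRing R] [CommRing S] [IsDomain R] [IsPrincipalIdealRing R]
    [Module.Free ℤ R] [Module.Finite ℤ R] [IsDomain S] [IsPrincipalIdealRing S] [CharZero R] [CharZero S]
    {X : Nine R S}
variable {N : ℕ} (Y : X.Rho N)
namespace Rho
variable {k : ℕ} (W : X.Om Y.hN k Y.φ)

theorem pow6 (W : X.Om Y.hN k Y.φ) {x : ZMod N} (h : x ^ 6 = 1) : x ^ (3 * k) = 1 := by
  obtain ⟨m, rfl⟩ := W.hev
  rw [show 3 * (m + m) = 6 * m by ring, pow_mul, h, one_pow]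

theorem negpow (W : X.Om Y.hN k Y.φ) (x : ZMod N) : (- x) ^ (3 * k) = x ^ (3 * k) :=
  Even.neg_pow (W.hev.mul_left _) x

theorem cube (W : X.Om Y.hN k Y.φ) {x : ZMod N} (h : x ≠ 0) : (x ^ (3 * k)) ^ 3 = 1 := by
  haveI := Fact.mk Y.hN
  have := ZMod.pow_card_sub_one_eq_one h
  rw [← this, ← pow_mul]; congr 1; have := W.hk; omega

theorem fact_ne (W : X.Om Y.hN k Y.φ) {m : ℕ} (hm : m < 9) : (((m * k).factorial : ℕ) : ZMod N) ≠ 0 := by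
  rw [Ne, ZMod.natCast_eq_zero_iff, Y.hN.dvd_factorial]
  have := W.hk
  have : m * k ≤ 9 * k := Nat.mul_le_mul_right _ hm.le
  omega

theorem fact_neg (W : X.Om Y.hN k Y.φ) {m l : ℕ} (h : m + l = 9) :
    (((m * k).factorial : ℕ) : ZMod N) * (((l * k).factorial : ℕ) : ZMod N) = - 1 := by
  have h9 : m * k + l * k = 9 * k := by rw [← add_mul, h]
  have h1 := W.hk
  have := zn_wilson Y.hN (m * k) (by omega)
  rw [show N - 1 - m * k = l * k by omega, pow_succ, (W.hev.mul_left _).neg_one_pow] at this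
  push_cast at this
  rw [this]; ring

theorem choose_fact {m l : ℕ} (h : l ≤ m) : (((m * k).choose (l * k) : ℕ) : ZMod N) * (((l * k).factorial : ℕ) : ZMod N) *
    ((((m - l) * k).factorial : ℕ) : ZMod N) = (((m * k).factorial : ℕ) : ZMod N) := by
  have := Nat.choose_mul_factorial_mul_factorial (Nat.mul_le_mul_right k h)
  rw [← this, Nat.sub_mul]; push_cast; rfl

theorem kappa_fact (W : X.Om Y.hN k Y.φ) : (((3 * k).factorial : ℕ) : ZMod N) ^ (3 * k) * (Y.φ (Y.r 1) * Y.φ (Y.r 2)) ^ (3 * k) =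
    (Y.φ (Y.r 4) * Y.φ (Y.r 5)) ^ (3 * k) := by
  haveI := Fact.mk Y.hN
  obtain ⟨η, h6, hη⟩ := Y.J8 W (b := 8) (Or.inl rfl)
  obtain ⟨η', h6', hη'⟩ := Y.J8 W (b := 6) (Or.inr rfl)
  have e1 := congrArg (fun x => Y.φ (X.G 2 x)) hη
  simp only [map_mul, Y.Gr] at e1
  rw [W.GJ, W.Jmod, show 2 ^ 2 * 8 % 9 = 5 by norm_num, W.φJ (by norm_num) (by norm_num) (by norm_num) (by norm_num)] at e1
  have e2 := congrArg Y.φ hη'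
  simp only [map_mul] at e2
  rw [W.φJ (by norm_num) (by norm_num) (by norm_num) (by norm_num)] at e2
  norm_num only at e1 e2
  have k1 := congrArg (fun x => x ^ (3 * k)) e1
  have k2 := congrArg (fun x => x ^ (3 * k)) e2
  simp only [mul_pow, Y.negpow W] at k1 k2
  rw [Y.pow6 W (x := Y.φ (X.G 2 η)) (by rw [← map_pow, ← map_pow, h6, map_one, map_one])] at k1
  rw [Y.pow6 W (x := Y.φ η') (by rw [← map_pow, h6', map_one])] at k2
  have c1 := congrArg (fun x => x ^ (3 * k)) (choose_fact (N := N) (k := k) (m := 5) (l := 4) (by norm_num))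
  have c2 := congrArg (fun x => x ^ (3 * k)) (choose_fact (N := N) (k := k) (m := 6) (l := 1) (by norm_num))
  have w1 := congrArg (fun x => x ^ (3 * k)) (Y.fact_neg W (m := 4) (l := 5) (by norm_num))
  have w2 := congrArg (fun x => x ^ (3 * k)) (Y.fact_neg W (m := 3) (l := 6) (by norm_num))
  norm_num only at c1 c2
  simp only [mul_pow, Y.negpow W, one_pow] at c1 c2 w1 w2
  rw [k1] at c1
  rw [k2] at c2
  have u5 := Y.cube W (Y.fact_ne W (m := 5) (by norm_num))
  have n1 : (((1 * k).factorial : ℕ) : ZMod N) ^ (3 * k) ≠ 0 := pow_ne_zero _ (Y.fact_ne W (by norm_num))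
  have n5 : (((5 * k).factorial : ℕ) : ZMod N) ^ (3 * k) ≠ 0 := pow_ne_zero _ (Y.fact_ne W (by norm_num))
  have n3 : Y.φ (Y.r 3) ^ (3 * k) ≠ 0 := pow_ne_zero _ (Y.φr (by norm_num) (by norm_num))
  rw [mul_pow, mul_pow]
  simp only [one_mul] at *
  generalize ((k.factorial : ℕ) : ZMod N) ^ (3 * k) = F1 at *
  generalize (((3 * k).factorial : ℕ) : ZMod N) ^ (3 * k) = F3 at *
  generalize (((4 * k).factorial : ℕ) : ZMod N) ^ (3 * k) = F4 at *
  generalize (((5 * k).factorial : ℕ) : ZMod N) ^ (3 * k) = F5 at *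
  generalize (((6 * k).factorial : ℕ) : ZMod N) ^ (3 * k) = F6 at *
  generalize Y.φ (Y.r 1) ^ (3 * k) = f1 at *
  generalize Y.φ (Y.r 2) ^ (3 * k) = f2 at *
  generalize Y.φ (Y.r 3) ^ (3 * k) = f3 at *
  generalize Y.φ (Y.r 4) ^ (3 * k) = f4 at *
  generalize Y.φ (Y.r 5) ^ (3 * k) = f5 at *
  apply mul_left_cancel₀ (mul_ne_zero (mul_ne_zero n1 n5) n3)
  linear_combination F3 * c2 + w2 - u5 - F5 ^ 2 * c1 + f3 * f4 * f5 * F1 * F5 * w1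

end Rho
end Nine

namespace Nine
variable {R S : Type*} [CommRing R] [CommRing S] [IsDomain R] [IsPrincipalIdealRing R]
    [Module.Free ℤ R] [Module.Finite ℤ R] [IsDomain S] [IsPrincipalIdealRing S] [CharZero R] [CharZero S]
    {X : Nine R S}
variable {N : ℕ} (Y : X.Rho N)
namespace Rho
variable {k : ℕ}

theorem Apart (W : X.Om Y.hN k Y.φ) {π e : R} (h : X.j π = Y.r 0 * Y.r 2 * Y.r 4) (he : π = 1 + (X.z - 1) ^ 3 * e) :
    Y.φ (X.j (X.c π)) ^ k * (((3 * k).factorial : ℕ) : ZMod N) ^ (3 * k) = 1 := by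
  haveI := Fact.mk Y.hN
  have h1 := congrArg Y.φ (Y.J66 W h he)
  rw [W.φJ (by norm_num) (by norm_num) (by norm_num) (by norm_num), map_neg, neg_inj] at h1
  norm_num only at h1
  rw [← h1]
  have c1 := choose_fact (N := N) (k := k) (m := 6) (l := 3) (by norm_num)
  norm_num only at c1
  have w := Y.fact_neg W (m := 3) (l := 6) (by norm_num)
  rw [← c1] at w
  rw [pow_mul, ← mul_pow, ← W.hev.neg_one_pow, ← w]
  ring

theorem trace (W : X.Om Y.hN k Y.φ) {π e : R} (h : X.j π = Y.r 0 * Y.r 2 * Y.r 4) (he : π = 1 + (X.z - 1) ^ 3 * e) :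
    ∃ A0 B0 : ℤ, (4 * N : ℤ) = A0 ^ 2 + 27 * B0 ^ 2 ∧ (A0 : ZMod N) = Y.φ (X.j (X.c π)) := by
  obtain ⟨hc, hn, -, -, hk, -⟩ := Y.norm_pi h
  obtain ⟨u, v, rfl⟩ := X.repR e
  have hz := X.hz
  have e1 : π = ((1 + 3 * (u - 2 * v) : ℤ) : R) + ((3 * (2 * u - v) : ℤ) : R) * X.z := by
    rw [he]; push_cast
    linear_combination ((u:R) * X.z - 4 * u + v * X.z^2 - 4 * v * X.z + 6 * v) * hz
  generalize hx : 1 + 3 * (u - 2 * v) = x at e1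
  have e2 : X.c π = (x : R) + ((3 * (2 * u - v) : ℤ) : R) * X.z ^ 2 := by
    rw [e1]; simp only [map_add, map_mul, map_intCast, X.hc]
  have e3 : π + X.c π = ((2 * x - 3 * (2 * u - v) : ℤ) : R) := by
    rw [e2, e1]; push_cast; linear_combination (3 * (2 * u - v : R)) * hz
  refine ⟨2 * x - 3 * (2 * u - v), 2 * u - v, ?_, ?_⟩
  · have : ((4 * N : ℤ) : R) = (((2 * x - 3 * (2 * u - v)) ^ 2 + 27 * (2 * u - v) ^ 2 : ℤ) : R) := by
      push_cast
      rw [← hn, e2, e1]; push_cast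
      linear_combination (4 * x * (3 * (2 * u - v)) + 4 * (X.z - 1) * (3 * (2 * u - v)) ^ 2 : R) * hz
    exact_mod_cast this
  · have h0 : Y.φ (X.j π) = 0 := (hk π).2 dvd_rfl
    have := congrArg (fun x => Y.φ (X.j x)) e3
    simp only [map_add, map_intCast, h0, zero_add] at this
    rw [this]

theorem ninth (W : X.Om Y.hN k Y.φ) (A : ℤ) (hA : (A : ZMod N) ≠ 0) :
    (∃ x : ℤ, x ^ 9 ≡ A [ZMOD (N : ℤ)]) ↔ (A : ZMod N) ^ k = 1 := by
  haveI := Fact.mk Y.hN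
  have hk := W.hk
  constructor
  · rintro ⟨x, hx⟩
    rw [← ZMod.intCast_eq_intCast_iff] at hx
    push_cast at hx
    have hx0 : (x : ZMod N) ≠ 0 := by
      intro h; apply hA; rw [← hx, h]; simp
    rw [← hx, ← pow_mul, ← ZMod.pow_card_sub_one_eq_one hx0]
    congr 1; omega
  · intro h
    obtain ⟨i, hi⟩ := W.elt hA
    have ho : orderOf W.γ = 9 * k := by
      rw [orderOf_eq_card_of_forall_mem_zpowers W.hγ, Nat.card_eq_fintype_card, ZMod.card_units_eq_totient, Nat.totient_prime Y.hN]
      omega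
    rw [hi, ← pow_mul] at h
    have h' : W.γ ^ (i * k) = 1 := by
      apply Units.ext; push_cast; exact h
    have := orderOf_dvd_of_pow_eq_one h'
    rw [ho] at this
    obtain ⟨q, rfl⟩ := Nat.dvd_of_mul_dvd_mul_right W.kpos this
    obtain ⟨x, hx⟩ := ZMod.intCast_surjective ((W.γ : ZMod N) ^ q)
    refine ⟨x, ?_⟩
    rw [← ZMod.intCast_eq_intCast_iff]
    push_cast
    rw [hx, hi]; ring

end Rho

theorem final (X : Nine R S) (hN : N.Prime) (hmod : N % 9 = 1) (A B : ℤ) (hAB : (4 * N : ℤ) = A ^ 2 + 27 * B ^ 2) :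
    ∃ (φ : R →+* ZMod N) (π e a b c a' b' c' : R), Prime π ∧ Prime (X.c π) ∧ IsCoprime π (X.c π) ∧ π = 1 + (X.z - 1) ^ 3 * e ∧
    π * X.c π = N ∧ Ideal.absNorm (Ideal.span {π}) = N ∧ (∀ a, φ a = 0 ↔ π ∣ a) ∧
    npoly X.z (1 + (X.z - 1) * a) ((X.z - 1) * b) ((X.z - 1) * c) = π ∧
    npoly X.z (1 + (X.z - 1) * a') ((X.z - 1) * b') ((X.z - 1) * c') = N ∧
    φ (dpoly X.z (1 + (X.z - 1) * a) ((X.z - 1) * b) ((X.z - 1) * c)) ≠ 0 ∧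
    φ (dpoly X.z (1 + (X.z - 1) * a') ((X.z - 1) * b') ((X.z - 1) * c')) ≠ 0 ∧
    φ (X.c (dpoly X.z (1 + (X.z - 1) * a') ((X.z - 1) * b') ((X.z - 1) * c'))) ≠ 0 ∧
    (φ (dpoly X.z (1 + (X.z - 1) * a) ((X.z - 1) * b) ((X.z - 1) * c)) ^ ((N - 1) / 3) = 1 →
      ((φ (dpoly X.z (1 + (X.z - 1) * a') ((X.z - 1) * b') ((X.z - 1) * c')) *
        φ (X.c (dpoly X.z (1 + (X.z - 1) * a') ((X.z - 1) * b') ((X.z - 1) * c')))) ^ ((N - 1) / 3) = 1 ↔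
        ∃ x : ℤ, x ^ 9 ≡ A [ZMOD (N : ℤ)])) := by
  haveI := Fact.mk hN
  obtain ⟨k, φ, hord, ⟨W⟩⟩ := X.exists_om hN hmod
  obtain ⟨ρ, s, hρ, hk⟩ := X.exists_rho hN hmod φ
  let Y : X.Rho N := ⟨hN, hmod, φ, ρ, s, hρ, hk, hord⟩
  change X.Om Y.hN k Y.φ at W
  obtain ⟨π, e, a, b, c, a', b', c', h, he, hn1, hn2, h1, h2, h3⟩ := Y.main1
  obtain ⟨hcj, hpc, hab, hpr, hkp, hcop⟩ := Y.norm_pi h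
  have hpr' : Prime (X.c π) := by
    have e : MulEquiv R R := ⟨⟨X.c, X.c, X.cc, X.cc⟩, map_mul _⟩
    let e : R ≃* R := ⟨⟨X.c, X.c, X.cc, X.cc⟩, map_mul _⟩
    exact (MulEquiv.prime_iff (e := e)).2 hpr
  have hf : ∀ i, 0 < i → i < 6 → Y.φ (Y.r i) ≠ 0 := fun i h h' => Y.φr h h'
  have f1 := hf 1 (by norm_num) (by norm_num)
  have f2 := hf 2 (by norm_num) (by norm_num)
  have f4 := hf 4 (by norm_num) (by norm_num)
  have f5 := hf 5 (by norm_num) (by norm_num)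
  have hA := Y.Apart W h he
  have hK := Y.kappa_fact W
  obtain ⟨A0, B0, hAB0, hA0⟩ := Y.trace W h he
  have hA1 : (A : ZMod N) ^ k = (A0 : ZMod N) ^ k := by
    rcases uniq_AB hN hAB hAB0 with rfl | rfl
    · rfl
    · push_cast; rw [W.hev.neg_pow]
  have hA2 : (A : ZMod N) ≠ 0 := by
    intro h0
    rw [h0, zero_pow W.kpos.ne', hA0] at hA1
    rw [← hA1, zero_mul] at hA
    exact zero_ne_one hA
  rw [← hA0, ← hA1] at hA
  rw [Y.ninth W A hA2]
  have h3k : (N - 1) / 3 = 3 * k := by have := W.hk; omega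
  rw [h3k]
  generalize hd : dpoly X.z (1 + (X.z - 1) * a) ((X.z - 1) * b) ((X.z - 1) * c) = d at *
  generalize hd' : dpoly X.z (1 + (X.z - 1) * a') ((X.z - 1) * b') ((X.z - 1) * c') = d' at *
  simp only [map_mul] at h1 h2 h3
  have n1 : Y.φ (X.j d) ≠ 0 := by
    intro h; rw [h, mul_zero] at h1; exact mul_ne_zero (pow_ne_zero _ f4) f2 h1.symm
  have nR := mul_ne_zero (pow_ne_zero 2 (mul_ne_zero f4 f1)) (mul_ne_zero f2 f5)
  have n2 : Y.φ (X.j d') ≠ 0 := by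
    intro h; rw [h, mul_zero] at h2; exact nR h2.symm
  have n3 : Y.φ (X.j (X.c d')) ≠ 0 := by
    intro h; rw [h, mul_zero] at h3; exact nR h3.symm
  refine ⟨Y.φ.comp X.j, π, e, a, b, c, a', b', c', hpr, hpr', hcop, he, hpc, hab, hkp, hn1, hn2, ?_⟩
  rw [hd, hd']
  refine ⟨n1, n2, n3, ?_⟩
  simp only [RingHom.comp_apply]
  have z6 : X.z ^ 6 = 1 := by
    have := X.z3; linear_combination (X.z ^ 3 + 1) * this
  have kz : Y.φ (X.j X.z) ^ (3 * k) = 1 := Y.pow6 W (by rw [← map_pow, ← map_pow, z6, map_one, map_one])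
  have kz' : Y.φ (X.j (X.c X.z)) ^ (3 * k) = 1 :=
    Y.pow6 W (by rw [← map_pow, ← map_pow, ← map_pow, z6, map_one, map_one, map_one])
  have l0 : Y.φ (X.j (X.z - 1) ^ 3) ≠ 0 := by
    intro h; simp only [map_pow] at h1; rw [← map_pow, h] at h1; simp at h1
    rcases h1 with h | h
    · exact f4 h
    · exact f2 h
  have l0' : Y.φ (X.j (X.c (X.z - 1)) ^ 3) ≠ 0 := by
    intro h; simp only [map_pow] at h3; rw [← map_pow, h] at h3; simp at h3
    rcases h3 with h | h
    · rcases h with h | h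
      · exact f4 h
      · exact f1 h
    · rcases h with h | h
      · exact f2 h
      · exact f5 h
  have kl : (Y.φ (X.j (X.z - 1)) ^ 3) ^ (3 * k) = 1 := by
    rw [← pow_mul, mul_comm, pow_mul]
    exact Y.cube W (fun h => l0 (by rw [map_pow, h, zero_pow (by norm_num)]))
  have kl' : (Y.φ (X.j (X.c (X.z - 1))) ^ 3) ^ (3 * k) = 1 := by
    rw [← pow_mul, mul_comm, pow_mul]
    exact Y.cube W (fun h => l0' (by rw [map_pow, h, zero_pow (by norm_num)]))
  simp only [map_pow] at h1 h2 h3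
  replace h1 := congrArg (fun x => x ^ (3 * k)) h1
  replace h2 := congrArg (fun x => x ^ (3 * k)) h2
  replace h3 := congrArg (fun x => x ^ (3 * k)) h3
  rw [mul_pow, mul_pow, kz, kl, one_mul, one_mul, mul_pow, ← pow_mul, mul_comm 2, pow_mul _ (3 * k) 2] at h1
  rw [mul_pow, mul_pow, kz, kl, one_mul, one_mul, mul_pow, ← pow_mul, mul_comm 2, pow_mul _ (3 * k) 2, mul_pow, mul_pow, mul_pow] at h2
  rw [mul_pow, mul_pow, kz', kl', one_mul, one_mul, mul_pow, ← pow_mul, mul_comm 2, pow_mul _ (3 * k) 2, mul_pow, mul_pow, mul_pow] at h3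
  rw [mul_pow _ _ (3 * k), h2, h3]
  intro hd1
  rw [h1] at hd1
  have q1 := Y.cube W f1
  have q2 := Y.cube W f2
  have q4 := Y.cube W f4
  have q5 := Y.cube W f5
  have qF := Y.cube W (Y.fact_ne W (m := 3) (by norm_num))
  rw [mul_pow, mul_pow] at hK
  generalize (((3 * k).factorial : ℕ) : ZMod N) ^ (3 * k) = F at *
  generalize (A : ZMod N) ^ k = a at *
  generalize Y.φ (Y.r 1) ^ (3 * k) = x1 at *
  generalize Y.φ (Y.r 2) ^ (3 * k) = x2 at *
  generalize Y.φ (Y.r 4) ^ (3 * k) = x4 at *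
  generalize Y.φ (Y.r 5) ^ (3 * k) = x5 at *
  have e24 : x2 = x4 := by linear_combination x4 * hd1 - x2 * q4
  subst e24
  have hx2 : x2 ≠ 0 := by rintro rfl; simp at q2
  have e5 : x5 = F * x1 := mul_left_cancel₀ hx2 (by linear_combination - hK)
  subst e5
  have e6 : x2 ^ 2 * x1 ^ 2 * (x2 * (F * x1)) = F := by
    linear_combination (x1 ^ 3 * F) * q2 + F * q1
  rw [e6]
  constructor
  · intro h
    have : F = 1 := by linear_combination qF - F * h
    rw [this, mul_one] at hA; exact hA
  · intro h
    rw [h, one_mul] at hA; rw [hA, one_mul]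
end Nine

theorem nine_pid (K : Type*) [Field K] [NumberField K] [hK : IsCyclotomicExtension {9} ℚ K] : IsPrincipalIdealRing (𝓞 K) := by
  haveI : Fact (Nat.Prime 3) := ⟨Nat.prime_three⟩
  haveI : Fact (Nat.Prime 2) := ⟨Nat.prime_two⟩
  have h9 : ({3 ^ (1 + 1)} : Set ℕ) = {9} := by norm_num
  haveI hK' : IsCyclotomicExtension {3 ^ (1 + 1)} ℚ K := by rw [h9]; exact hK
  have hd : NumberField.discr K = -19683 := by
    have := IsCyclotomicExtension.Rat.discr_prime_pow_succ 3 1 K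
    rw [this]; norm_num
  have ht : Nat.totient 9 = 6 := by decide
  have hfl : ⌊(4 / Real.pi) ^ InfinitePlace.nrComplexPlaces K *
      ((Module.finrank ℚ K).factorial / (Module.finrank ℚ K) ^ (Module.finrank ℚ K) * √|discr K|)⌋₊ ≤ 4 := by
    rw [IsCyclotomicExtension.finrank (n := 9) K (cyclotomic.irreducible_rat (by norm_num)),
      IsCyclotomicExtension.Rat.nrComplexPlaces_eq_totient_div_two 9, ht, hd]
    norm_num [Nat.factorial]
    have h1 : √(19683 : ℝ) < 141 := by rw [Real.sqrt_lt' (by norm_num)]; norm_num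
    have h2 : (4 / Real.pi) ^ 3 < (4 / 3.14) ^ 3 := by
      have := Real.pi_gt_d2
      gcongr
    rw [← Nat.lt_succ_iff, Nat.floor_lt (by positivity)]
    push_cast
    have h3 : (0:ℝ) < (4 / Real.pi) ^ 3 := by positivity
    have h4 : (0:ℝ) ≤ √(19683 : ℝ) := Real.sqrt_nonneg _
    norm_num at h2 h3 ⊢
    nlinarith
  apply RingOfIntegers.isPrincipalIdealRing_of_isPrincipal_of_pow_le_of_mem_primesOver_of_mem_Icc
  intro p hp hpp P hP hle
  have hp4 : p ≤ 4 := (Finset.mem_Icc.1 hp).2.trans hfl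
  replace hle := hle.trans hfl
  haveI := hP.1
  haveI := hP.2
  interval_cases p
  · exact absurd hpp (by norm_num)
  · exact absurd hpp (by norm_num)
  · exfalso
    have := IsCyclotomicExtension.Rat.inertiaDeg_eq_of_not_dvd (p := 2) (m := 9) (K := K) (P := P) (by norm_num)
    have ho : orderOf ((2 : ℕ) : ZMod 9) = 6 := by
      rw [orderOf_eq_iff (by norm_num)]
      decide
    rw [this, ho] at hle
    norm_num at hle
  · rw [IsCyclotomicExtension.Rat.eq_span_zeta_sub_one_of_liesOver 3 1 K hK'.zeta_spec P]
    exact ⟨_, rfl⟩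
  · exact absurd hpp (by norm_num)

/-- Ring homs out of the ring of integers of a cyclotomic field. -/
theorem cyc_lift {n : ℕ} [NeZero n] {K : Type*} [Field K] [NumberField K] [IsCyclotomicExtension {n} ℚ K] {ζ : K}
    (hζ : IsPrimitiveRoot ζ n) {T : Type*} [CommRing T] (t : T) (ht : aeval t (cyclotomic n ℤ) = 0) :
    ∃ f : 𝓞 K →ₐ[ℤ] T, f hζ.toInteger = t := by
  have hmin : minpoly ℤ hζ.integralPowerBasis.gen = cyclotomic n ℤ := by
    rw [IsPrimitiveRoot.integralPowerBasis_gen, cyclotomic_eq_minpoly hζ (NeZero.pos _), ← RingOfIntegers.minpoly_coe]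
    rfl
  refine ⟨hζ.integralPowerBasis.lift t (by rw [hmin]; exact ht), ?_⟩
  exact (congrArg _ hζ.integralPowerBasis_gen.symm).trans (hζ.integralPowerBasis.lift_gen t (by rw [hmin]; exact ht))

theorem cyc_ext {n : ℕ} [NeZero n] {K : Type*} [Field K] [NumberField K] [IsCyclotomicExtension {n} ℚ K] {ζ : K}
    (hζ : IsPrimitiveRoot ζ n) {T : Type*} [CommRing T] {f g : 𝓞 K →+* T} (h : f hζ.toInteger = g hζ.toInteger) (x : 𝓞 K) :
    f x = g x := by
  have : f.toIntAlgHom = g.toIntAlgHom := by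
    apply hζ.integralPowerBasis.algHom_ext
    rw [IsPrimitiveRoot.integralPowerBasis_gen]
    exact h
  exact congrArg (fun f => f x) this

theorem cyc3_aeval {T : Type*} [CommRing T] (t : T) (h : t ^ 2 + t + 1 = 0) : aeval t (cyclotomic 3 ℤ) = 0 := by
  rw [cyclotomic_three]; simpa using h

theorem cyc9_poly : cyclotomic 9 ℤ = X ^ 6 + X ^ 3 + 1 := by
  haveI := Fact.mk Nat.prime_three
  have := cyclotomic_prime_pow_eq_geom_sum (R := ℤ) (p := 3) (n := 1) Nat.prime_three
  norm_num at this
  rw [this]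
  simp [Finset.sum_range_succ]
  ring

theorem cyc9_aeval {T : Type*} [CommRing T] (t : T) (h : t ^ 6 + t ^ 3 + 1 = 0) : aeval t (cyclotomic 9 ℤ) = 0 := by
  rw [cyc9_poly]; simpa using h

theorem build_nine {F K : Type*} [Field F] [NumberField F] [IsCyclotomicExtension {3} ℚ F] [Field K] [NumberField K]
    [IsCyclotomicExtension {9} ℚ K] [IsPrincipalIdealRing (𝓞 F)] {ζ : F} (hζ : IsPrimitiveRoot ζ 3) :
    ∃ X : Nine (𝓞 F) (𝓞 K), X.z = hζ.toInteger := by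
  have hη := IsCyclotomicExtension.zeta_spec 9 ℚ K
  obtain ⟨z, hzdef⟩ : ∃ z, z = hζ.toInteger := ⟨_, rfl⟩
  obtain ⟨θ, hθdef⟩ : ∃ θ, θ = hη.toInteger := ⟨_, rfl⟩
  have hz : z ^ 2 + z + 1 = 0 := by
    rw [hzdef]
    have := hζ.toInteger_isPrimitiveRoot.isRoot_cyclotomic (by norm_num)
    rw [cyclotomic_three] at this; simpa using this
  have hθ : θ ^ 6 + θ ^ 3 + 1 = 0 := by
    rw [hθdef]
    have := hη.toInteger_isPrimitiveRoot.isRoot_cyclotomic (by norm_num)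
    rw [← map_cyclotomic_int, cyc9_poly] at this; simpa using this
  have hθ9 : θ ^ 9 = 1 := by linear_combination (θ ^ 3 - 1) * hθ
  obtain ⟨j, hj⟩ := cyc_lift hζ (θ ^ 3) (cyc3_aeval _ (by linear_combination hθ))
  obtain ⟨c, hc⟩ := cyc_lift hζ (z ^ 2) (cyc3_aeval _ (by linear_combination (z ^ 2 - z + 1) * hz))
  obtain ⟨g, hg⟩ := cyc_lift hη (θ ^ 2) (cyc9_aeval _ (by linear_combination hθ + θ ^ 3 * hθ9))
  obtain ⟨g', hg'⟩ := cyc_lift hη (θ ^ 5) (cyc9_aeval _ (by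
    linear_combination hθ + (θ ^ 21 + θ ^ 12 + θ ^ 3 + θ ^ 6) * hθ9))
  rw [← hzdef] at hj hc
  rw [← hθdef] at hg hg'
  have gg' : ∀ x, g (g' x) = x := fun x =>
    cyc_ext hη (f := (g : 𝓞 K →+* 𝓞 K).comp (g' : 𝓞 K →+* 𝓞 K)) (g := RingHom.id _) (by
      rw [← hθdef]; simp [hg, hg']; linear_combination θ * hθ9) x
  have g'g : ∀ x, g' (g x) = x := fun x =>
    cyc_ext hη (f := (g' : 𝓞 K →+* 𝓞 K).comp (g : 𝓞 K →+* 𝓞 K)) (g := RingHom.id _) (by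
      rw [← hθdef]; simp [hg, hg']; linear_combination θ * hθ9) x
  have hcc : ∀ x, c (c x) = x := fun x =>
    cyc_ext hζ (f := (c : 𝓞 F →+* 𝓞 F).comp (c : 𝓞 F →+* 𝓞 F)) (g := RingHom.id _) (by
      rw [← hzdef]; simp [hc]; linear_combination z * (z - 1) * hz) x
  have repR : ∀ r : 𝓞 F, ∃ x y : ℤ, r = x + y * z := by
    intro r
    have hr : r ∈ Algebra.adjoin ℤ {z} := by
      rw [hzdef, ← hζ.integralPowerBasis_gen, hζ.integralPowerBasis.adjoin_gen_eq_top]; trivial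
    induction hr using Algebra.adjoin_induction with
    | mem x hx => obtain rfl : x = z := hx; exact ⟨0, 1, by push_cast; ring⟩
    | algebraMap n => exact ⟨n, 0, by simp⟩
    | add a b _ _ h1 h2 =>
      obtain ⟨x, y, rfl⟩ := h1
      obtain ⟨x', y', rfl⟩ := h2
      exact ⟨x + x', y + y', by push_cast; ring⟩
    | mul a b _ _ h1 h2 =>
      obtain ⟨x, y, rfl⟩ := h1
      obtain ⟨x', y', rfl⟩ := h2
      exact ⟨x * x' - y * y', x * y' + y * x' - y * y', by push_cast; linear_combination (y * y' : 𝓞 F) * hz⟩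
  have repS : ∀ s : 𝓞 K, ∃ a b d : 𝓞 F, s = j a + j b * θ + j d * θ ^ 2 := by
    intro s
    have hr : s ∈ Algebra.adjoin ℤ {θ} := by
      rw [hθdef, ← hη.integralPowerBasis_gen, hη.integralPowerBasis.adjoin_gen_eq_top]; trivial
    induction hr using Algebra.adjoin_induction with
    | mem x hx => obtain rfl : x = θ := hx; exact ⟨0, 1, 0, by simp⟩
    | algebraMap n => exact ⟨n, 0, 0, by simp⟩
    | add a b _ _ h1 h2 =>
      obtain ⟨a1, a2, a3, rfl⟩ := h1
      obtain ⟨b1, b2, b3, rfl⟩ := h2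
      exact ⟨a1 + b1, a2 + b2, a3 + b3, by simp only [map_add]; ring⟩
    | mul a b _ _ h1 h2 =>
      obtain ⟨a1, a2, a3, rfl⟩ := h1
      obtain ⟨b1, b2, b3, rfl⟩ := h2
      refine ⟨a1 * b1 + z * (a2 * b3 + a3 * b2), a1 * b2 + a2 * b1 + z * (a3 * b3), a1 * b3 + a2 * b2 + a3 * b1, ?_⟩
      simp only [map_add, map_mul, hj]; ring
  have hnn : ∀ a : 𝓞 F, ∃ m : ℕ, a * c a = m ∧ (m = 0 → a = 0) := by
    intro a
    obtain ⟨x, y, rfl⟩ := repR a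
    have h0 : 0 ≤ x ^ 2 - x * y + y ^ 2 := by nlinarith [sq_nonneg (x - y), sq_nonneg x, sq_nonneg y]
    refine ⟨(x ^ 2 - x * y + y ^ 2).toNat, ?_, ?_⟩
    · have : (((x ^ 2 - x * y + y ^ 2).toNat : ℕ) : 𝓞 F) = ((((x ^ 2 - x * y + y ^ 2).toNat : ℕ) : ℤ) : 𝓞 F) := by push_cast; rfl
      rw [this, Int.toNat_of_nonneg h0]
      simp only [map_add, map_mul, map_intCast, hc]; push_cast
      linear_combination (x * y + y ^ 2 * (z - 1) : 𝓞 F) * hz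
    · intro h
      have h1 : x ^ 2 - x * y + y ^ 2 = 0 := by omega
      have hx : x = 0 := by nlinarith [sq_nonneg (x - 2 * y), sq_nonneg x]
      have hy : y = 0 := by nlinarith [sq_nonneg (y - 2 * x), sq_nonneg y]
      simp [hx, hy]
  have hcz : ∀ a, c a = 0 → a = 0 := fun a h => by rw [← hcc a, h, map_zero]
  refine ⟨{ z := z, hz := hz, θ := θ, hθ := hθ, j := j, hj := ?_, hjz := hj,
            g := ⟨⟨g, g', g'g, gg'⟩, map_mul g, map_add g⟩, hg := hg, c := c, hc := hc, repR := repR, repS := repS,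
            lift := ?_, hroot := ?_, hU := ?_, hnorm := ?_}, hzdef⟩
  · rw [injective_iff_map_eq_zero]
    intro a ha
    obtain ⟨m, hm, hm0⟩ := hnn a
    apply hm0
    have := congrArg j hm
    rw [map_mul, map_natCast] at this
    have ha' : j a = 0 := ha
    rw [ha', zero_mul] at this
    exact_mod_cast this.symm
  · intro n r hr
    obtain ⟨φ, hφ⟩ := cyc_lift hη r (cyc9_aeval _ hr)
    exact ⟨φ, by rw [hθdef]; exact hφ⟩
  · intro x hx
    have hx' : x * g (g (g x)) = 1 := hx
    have hfin : IsOfFinOrder (x : K) := by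
      obtain ⟨n, hn, h⟩ := NumberField.Embeddings.pow_eq_one_of_norm_eq_one K ℂ (x := (x : K)) x.isIntegral_coe (by
        intro σ
        let f : 𝓞 K →+* ℂ := σ.comp (algebraMap (𝓞 K) K)
        have hf : ∀ y, f (g (g (g y))) = (starRingEnd ℂ) (f y) := fun y =>
          cyc_ext hη (f := f.comp ((g : 𝓞 K →+* 𝓞 K).comp ((g : 𝓞 K →+* 𝓞 K).comp (g : 𝓞 K →+* 𝓞 K))))
            (g := (starRingEnd ℂ).comp f) (by
              rw [← hθdef]
              simp only [RingHom.comp_apply, RingHom.coe_coe, hg, map_pow]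
              have h9 : f θ ^ 9 = 1 := by rw [← map_pow, hθ9, map_one]
              have hn1 : ‖f θ‖ = 1 := Complex.norm_eq_one_of_pow_eq_one h9 (by norm_num)
              have h1 : f θ * (starRingEnd ℂ) (f θ) = 1 := by
                rw [Complex.mul_conj, Complex.normSq_eq_norm_sq, hn1]; norm_num
              have h0 : f θ ≠ 0 := by intro h; rw [h, zero_mul] at h1; exact zero_ne_one h1
              apply mul_left_cancel₀ h0
              rw [h1]; linear_combination h9) y
        have h2 := congrArg f hx'
        rw [map_mul, map_one, hf, Complex.mul_conj, Complex.normSq_eq_norm_sq] at h2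
        have h3 : ‖f x‖ ^ 2 = 1 := by exact_mod_cast h2
        have h4 : ‖f x‖ = 1 := by
          have := norm_nonneg (f x)
          nlinarith
        exact h4)
      exact isOfFinOrder_iff_pow_eq_one.2 ⟨n, hn, h⟩
    obtain ⟨r, -, hr⟩ := hη.exists_pow_or_neg_mul_pow_of_isOfFinOrder (by decide) hfin
    refine ⟨r, ?_⟩
    rw [hθdef]
    rcases hr with h | h
    · left; apply RingOfIntegers.ext; rw [h]; simp only [map_neg, map_pow]; rfl
    · right; apply RingOfIntegers.ext; rw [h]; simp only [map_neg, map_pow]; rfl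
  · rintro _ ⟨u, rfl⟩
    have := IsCyclotomicExtension.Rat.Three.Units.mem hζ u
    have h3 : (hζ.toInteger) ^ 3 = 1 := hζ.toInteger_isPrimitiveRoot.pow_eq_one
    have h6 : (hζ.toInteger) ^ 6 = 1 := by rw [show 6 = 3 * 2 by rfl, pow_mul, h3, one_pow]
    have h62 : (hζ.toInteger ^ 2) ^ 6 = 1 := by rw [← pow_mul, mul_comm, pow_mul, h6, one_pow]
    have hne : ∀ x : 𝓞 F, (-x) ^ 6 = x ^ 6 := fun x => by ring
    simp only [List.mem_cons, List.not_mem_nil, or_false] at this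
    rcases this with rfl | rfl | rfl | rfl | rfl | rfl <;> push_cast
    · simp
    · ring
    · exact h6
    · rw [hne]; exact h6
    · exact h62
    · rw [hne]; exact h62
  · intro a
    obtain ⟨m, hm, -⟩ := hnn a
    have hcn : Ideal.absNorm (Ideal.span {c a}) = Ideal.absNorm (Ideal.span {a}) := by
      rw [Ideal.absNorm_span_singleton, Ideal.absNorm_span_singleton]
      have : 𝓞 F ≃ₐ[ℤ] 𝓞 F := AlgEquiv.ofAlgHom c c (AlgHom.ext hcc) (AlgHom.ext hcc)
      let e : 𝓞 F ≃ₐ[ℤ] 𝓞 F := AlgEquiv.ofAlgHom c c (AlgHom.ext hcc) (AlgHom.ext hcc)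
      have := Algebra.norm_eq_of_algEquiv e a
      rw [← this]; rfl
    have h2 : Ideal.absNorm (Ideal.span {a}) ^ 2 = m ^ 2 := by
      have : Ideal.absNorm (Ideal.span {a * c a}) = m ^ 2 := by
        rw [hm, Ideal.absNorm_span_natCast, RingOfIntegers.rank,
          IsCyclotomicExtension.finrank (n := 3) F (cyclotomic.irreducible_rat (by norm_num))]
        rfl
      rw [← Ideal.span_singleton_mul_span_singleton, map_mul, hcn] at this
      rw [← this]; ring
    have h3 : Ideal.absNorm (Ideal.span {a}) = m := Nat.pow_left_injective (n := 2) (by norm_num) h2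
    show _ = a * c a
    rw [h3, hm]

theorem exists_cuberoot (F : Type) [Field F] [NumberField F] (a : F) :
    ∃ (M : Type) (_ : Field M) (_ : NumberField M) (_ : Algebra F M) (α : M), α ^ 3 = algebraMap F M a ∧
      Algebra.adjoin F {α} = ⊤ := by
  obtain ⟨α, hα⟩ := IsAlgClosed.exists_pow_nat_eq (algebraMap F (AlgebraicClosure F) a) (n := 3) (by norm_num)
  have hi : IsIntegral F α := Algebra.IsIntegral.isIntegral α
  haveI : FiniteDimensional F (IntermediateField.adjoin F {α}) := IntermediateField.adjoin.finiteDimensional hi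
  refine ⟨IntermediateField.adjoin F {α}, inferInstance, NumberField.of_module_finite F _, inferInstance,
    IntermediateField.AdjoinSimple.gen F α, ?_, ?_⟩
  · apply Subtype.ext
    simpa using hα
  · have := (IntermediateField.adjoin.powerBasis hi).adjoin_gen_eq_top
    rwa [IntermediateField.adjoin.powerBasis_gen] at this

theorem kappa_d {F : Type} [Field F] [NumberField F] [IsCyclotomicExtension {3} ℚ F] [IsPrincipalIdealRing (𝓞 F)]
    {ζ : F} (hζ : IsPrimitiveRoot ζ 3) {N : ℕ} (hN : N.Prime) (hmod : N % 9 = 1)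
    (hu6 : ∀ u : 𝓞 F, IsUnit u → u ^ 6 = 1) {φ : 𝓞 F →+* ZMod N} {π e a b c : 𝓞 F} (hp : Prime π)
    (he : π = 1 + (hζ.toInteger - 1) ^ 3 * e) (hk : ∀ a, φ a = 0 ↔ π ∣ a)
    (hn : npoly hζ.toInteger (1 + (hζ.toInteger - 1) * a) ((hζ.toInteger - 1) * b) ((hζ.toInteger - 1) * c) = π)
    (hd : φ (dpoly hζ.toInteger (1 + (hζ.toInteger - 1) * a) ((hζ.toInteger - 1) * b) ((hζ.toInteger - 1) * c)) ≠ 0) :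
    φ (dpoly hζ.toInteger (1 + (hζ.toInteger - 1) * a) ((hζ.toInteger - 1) * b) ((hζ.toInteger - 1) * c)) ^ ((N - 1) / 3) = 1 := by
  haveI := Fact.mk hN
  obtain ⟨M, _, _, _, α, hα, hgen⟩ := exists_cuberoot F ((π * 1 : 𝓞 F) : F)
  obtain ⟨k, kz, kp, km, hU, -⟩ := build_Kum hζ hp (Or.inr rfl) isCoprime_one_right (by rw [mul_one]; exact he) hα hgen
  rw [← kz] at hn hd ⊢
  generalize hD : dpoly k.z (1 + (k.z - 1) * a) ((k.z - 1) * b) ((k.z - 1) * c) = D at *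
  let β : Kum.Beta k := ⟨a, b, c, by rw [hn, kp, km, mul_one], by rw [hD]; rintro rfl; exact hd (map_zero _)⟩
  have hβ : β.d = D := hD
  have hpd : ¬ k.p ∣ β.d := by rw [hβ, kp, ← hk]; exact hd
  obtain ⟨x, r, u, hx, hu, hdv⟩ := β.L'_result hU km hpd
  rw [hβ, kp, ← hk, map_sub, sub_eq_zero, map_mul, map_pow, map_pow] at hdv
  rw [kp, ← hk] at hx
  have hN2 : N ≠ 2 := by rintro rfl; norm_num at hmod
  have hodd := hN.eq_two_or_odd.resolve_left hN2
  obtain ⟨l, hl⟩ : ∃ l, N = 18 * l + 1 := ⟨N / 18, by omega⟩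
  have hl3 : (N - 1) / 3 = 6 * l := by omega
  have hl1 : N - 1 = 6 * l * 3 := by omega
  rw [hl3]
  have q : ∀ y : ZMod N, y ≠ 0 → (y ^ (6 * l)) ^ 3 = 1 := by
    intro y hy
    rw [← pow_mul, ← hl1]; exact ZMod.pow_card_sub_one_eq_one hy
  have hlam : φ (k.z - 1) ≠ 0 := by
    rw [Ne, hk]
    intro h
    apply hp.not_unit
    have h1 : π ∣ 1 := by
      have h2 : π ∣ (k.z - 1) ^ 3 * e := (h.trans (dvd_pow_self _ (by norm_num))).mul_right _
      have := dvd_sub (dvd_refl π) h2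
      rwa [kz, show π - (hζ.toInteger - 1) ^ 3 * e = 1 by rw [he]; ring] at this
    exact isUnit_of_dvd_one h1
  have hu1 : φ u ≠ 0 := by
    have := congrArg φ (hu6 u hu)
    rw [map_pow, map_one] at this
    intro h; rw [h] at this; simp at this
  have hprod : φ ((k.z - 1) ^ 3 * D ^ 2 * u) ≠ 0 := by
    simp only [map_mul, map_pow]
    exact mul_ne_zero (mul_ne_zero (pow_ne_zero _ hlam) (pow_ne_zero _ hd)) hu1
  have hr : φ r ≠ 0 := by
    intro h; rw [h, zero_pow (by norm_num)] at hdv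
    exact mul_ne_zero (pow_ne_zero _ hx) hprod hdv
  have h1 := congrArg (fun y => y ^ (6 * l)) hdv
  simp only [map_mul, map_pow, mul_pow] at h1
  have sw : ∀ (y : ZMod N) (n : ℕ), (y ^ n) ^ (6 * l) = (y ^ (6 * l)) ^ n := fun y n => by rw [← pow_mul, ← pow_mul, mul_comm]
  have hu2 : φ u ^ (6 * l) = 1 := by rw [pow_mul, ← map_pow, hu6 u hu, map_one, one_pow]
  rw [sw, sw, sw, sw, q _ hx, q _ hr, q _ hlam, hu2] at h1
  have h3 := q _ hd
  linear_combination h3 - φ D ^ (6 * l) * h1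

theorem main_card_aux (F K : Type) [Field F] [NumberField F] [IsCyclotomicExtension {3} ℚ F] [Field K] [NumberField K]
    [IsCyclotomicExtension {9} ℚ K] (N : ℕ) (hN : N.Prime) (hmod9 : N % 9 = 1)
    (L : Type) [Field L] [NumberField L]
    (ζ : L) (hζ : IsPrimitiveRoot ζ 3)
    (α : L) (hα : α ^ 3 = (N : L))
    (hLgen : Algebra.adjoin ℚ {ζ, α} = (⊤ : Subalgebra ℚ L))
    (A B : ℤ) (hAB : (4 * N : ℤ) = A ^ 2 + 27 * B ^ 2) :
    ((∃ x : ℤ, x ^ 9 ≡ A [ZMOD (N : ℤ)]) → Nat.card {g : ClassGroup (𝓞 L) // g ^ 3 = 1} = 9) ∧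
    ((¬ ∃ x : ℤ, x ^ 9 ≡ A [ZMOD (N : ℤ)]) → Nat.card {g : ClassGroup (𝓞 L) // g ^ 3 = 1} = 3) := by
  haveI := Fact.mk hN
  haveI : IsPrincipalIdealRing (𝓞 F) := IsCyclotomicExtension.Rat.three_pid F
  haveI : IsPrincipalIdealRing (𝓞 K) := nine_pid K
  obtain ⟨η, hη⟩ : ∃ η : F, IsPrimitiveRoot η 3 := ⟨_, IsCyclotomicExtension.zeta_spec 3 ℚ F⟩
  obtain ⟨f, hf⟩ : ∃ f : F →ₐ[ℚ] L, f η = ζ := by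
    have hm : aeval ζ (minpoly ℚ (hη.powerBasis ℚ).gen) = 0 := by
      rw [IsPrimitiveRoot.powerBasis_gen, ← cyclotomic_eq_minpoly_rat hη (by norm_num), cyclotomic_eq_minpoly_rat hζ (by norm_num)]
      exact minpoly.aeval _ _
    refine ⟨(hη.powerBasis ℚ).lift ζ hm, ?_⟩
    exact (congrArg _ (hη.powerBasis_gen ℚ).symm).trans ((hη.powerBasis ℚ).lift_gen ζ hm)
  letI : Algebra F L := (f : F →+* L).toAlgebra
  have hfm : ∀ x, algebraMap F L x = f x := fun x => rfl
  have hgen : Algebra.adjoin F {α} = (⊤ : Subalgebra F L) := by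
    rw [eq_top_iff]
    intro x _
    have hx : x ∈ Algebra.adjoin ℚ {ζ, α} := by rw [hLgen]; trivial
    induction hx using Algebra.adjoin_induction with
    | mem x hx =>
      rcases hx with rfl | rfl
      · rw [← hf, ← hfm]; exact Subalgebra.algebraMap_mem _ _
      · exact Algebra.subset_adjoin rfl
    | algebraMap r => rw [← f.commutes r, ← hfm]; exact Subalgebra.algebraMap_mem _ _
    | add a b _ _ h1 h2 => exact add_mem (h1 trivial) (h2 trivial)
    | mul a b _ _ h1 h2 => exact mul_mem (h1 trivial) (h2 trivial)
  obtain ⟨X, hX⟩ := build_nine (K := K) hη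
  obtain ⟨φ, π, e, a, b, c, a', b', c', hp, hp', hcop, he, hpN, habs, hk, hn, hn', hd, hd1, hd2, hiff⟩ :=
    X.final hN hmod9 A B hAB
  rw [hX] at he hn hd hiff hn' hd1 hd2
  specialize hiff (kappa_d hη hN hmod9 X.hU hp he hk hn hd)
  rw [← hiff]
  have hcz : X.c hη.toInteger = hη.toInteger ^ 2 := by rw [← hX]; exact X.hc
  obtain ⟨e', he'⟩ : ∃ e', π * X.c π = 1 + (hη.toInteger - 1) ^ 3 * e' := by
    have h1 : X.c π = 1 + (hη.toInteger - 1) ^ 3 * ((hη.toInteger + 1) ^ 3 * X.c e) := by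
      rw [he]; simp only [map_add, map_mul, map_pow, map_sub, map_one, hcz]; ring
    refine ⟨e + ((hη.toInteger + 1) ^ 3 * X.c e) + (hη.toInteger - 1) ^ 3 * e * ((hη.toInteger + 1) ^ 3 * X.c e), ?_⟩
    rw [h1]; nth_rewrite 1 [he]; ring
  obtain ⟨k, kz, kp, km, hU, hO⟩ := build_Kum hη hp (Or.inl hp') hcop he' (α := α) (by rw [hα, hpN]; simp) hgen
  have hkc : ∀ a, φ (X.c a) = 0 ↔ X.c π ∣ a := by
    intro a
    rw [hk]
    constructor
    · intro h; have := map_dvd X.c h; rwa [X.cc] at this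
    · intro h; have := map_dvd X.c h; rwa [X.cc] at this
  let C : Kum.Chr k N :=
    { hN := hN
      hmod := by omega
      hm := by rw [km]; exact hp'
      φ := φ
      φ' := φ.comp X.c
      hk := by rw [kp]; exact hk
      hk' := by rw [km]; exact hkc
      hsw := by rw [km, kp]; rfl
      hφ := by
        intro a
        have := congrArg φ (X.hnorm a)
        rw [map_mul, map_natCast] at this
        rw [this]; rfl
      hpN := by rw [kp]; exact habs
      hmN := by
        rw [km]
        have := X.hnorm (X.c π)
        rw [X.cc, mul_comm, hpN] at this
        exact_mod_cast this
      hO := hO }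
  rw [← kz] at hn' hd1 hd2 ⊢
  let β : Kum.Beta k := ⟨a', b', c', by rw [hn', kp, km, hpN], fun h => hd1 (by rw [h, map_zero])⟩
  have := C.Lmain (by rw [kp, km, hpN]) hU β hd1 hd2
  exact this

theorem main_card (N : ℕ) (hN : N.Prime) (hmod9 : N % 9 = 1)
    (L : Type) [Field L] [NumberField L]
    (ζ : L) (hζ : IsPrimitiveRoot ζ 3)
    (α : L) (hα : α ^ 3 = (N : L))
    (hLgen : Algebra.adjoin ℚ {ζ, α} = (⊤ : Subalgebra ℚ L))
    (A B : ℤ) (hAB : (4 * N : ℤ) = A ^ 2 + 27 * B ^ 2) :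
    ((∃ x : ℤ, x ^ 9 ≡ A [ZMOD (N : ℤ)]) → Nat.card {g : ClassGroup (𝓞 L) // g ^ 3 = 1} = 9) ∧
    ((¬ ∃ x : ℤ, x ^ 9 ≡ A [ZMOD (N : ℤ)]) → Nat.card {g : ClassGroup (𝓞 L) // g ^ 3 = 1} = 3) := by
  haveI h3 : @IsCyclotomicExtension {3} ℚ (CyclotomicField 3 ℚ) _ _ DivisionRing.toRatAlgebra := by
    have hh : (CyclotomicField.algebra 3 ℚ : Algebra ℚ (CyclotomicField 3 ℚ)) = DivisionRing.toRatAlgebra := Subsingleton.elim _ _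
    rw [← hh]
    exact CyclotomicField.isCyclotomicExtension 3 ℚ
  haveI h9 : @IsCyclotomicExtension {9} ℚ (CyclotomicField 9 ℚ) _ _ DivisionRing.toRatAlgebra := by
    have hh : (CyclotomicField.algebra 9 ℚ : Algebra ℚ (CyclotomicField 9 ℚ)) = DivisionRing.toRatAlgebra := Subsingleton.elim _ _
    rw [← hh]
    exact CyclotomicField.isCyclotomicExtension 9 ℚ
  exact main_card_aux (CyclotomicField 3 ℚ) (CyclotomicField 9 ℚ) N hN hmod9 L ζ hζ α hα hLgen A B hAB

/-- Let `N` be a prime with `N ≡ 1 (mod 9)` and `L = ℚ(ζ_3, N^{1/3})`.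
Write `4N = A² + 27B²`.  Then `rk_3(Cl(L)) = 2` iff `A` is a 9th power modulo `N`,
and otherwise `rk_3(Cl(L)) = 1`. -/
theorem stmt10 (N : ℕ) (hN : N.Prime) (hmod9 : N % 9 = 1)
    (L : Type) [Field L] [NumberField L]
    (ζ : L) (hζ : IsPrimitiveRoot ζ 3)
    (α : L) (hα : α ^ 3 = (N : L))
    (hLgen : Algebra.adjoin ℚ {ζ, α} = (⊤ : Subalgebra ℚ L))
    (A B : ℤ) (hAB : (4 * N : ℤ) = A ^ 2 + 27 * B ^ 2) :
    (pRank 3 (ClassGroup (𝓞 L)) = 2 ↔ ∃ x : ℤ, x ^ 9 ≡ A [ZMOD (N : ℤ)]) ∧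
    (¬ (∃ x : ℤ, x ^ 9 ≡ A [ZMOD (N : ℤ)]) → pRank 3 (ClassGroup (𝓞 L)) = 1) := by
  obtain ⟨h9, h3⟩ := main_card N hN hmod9 L ζ hζ α hα hLgen A B hAB
  have f9 : (9 : ℕ).factorization 3 = 2 := by
    rw [show 9 = 3 ^ 2 by norm_num, Nat.prime_three.factorization_pow]; simp
  have f3 : (3 : ℕ).factorization 3 = 1 := Nat.prime_three.factorization_self
  unfold pRank
  refine ⟨⟨fun h => ?_, fun h => by rw [h9 h, f9]⟩, fun h => by rw [h3 h, f3]⟩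
  by_contra hx
  rw [h3 hx, f3] at h
  norm_num at h
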